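/- (Frequency-localized Strichartz estimates.) Let q ∈ (2,∞) and r = 2q/(q−2). There exists a constant C > 0, depending only on q, such that for all c > 0, ε > 0, k ∈ ℤ, and every Schwartz function g : ℝ³ → ℂ with support contained in {ξ : 2ᵏ ≤ |ξ| ≤ 2^{k+2}}, the functions u_Λ(t,x) = ∫_{ℝ³} e^{i(t·c·Λ_{cε}(ξ) + x·ξ)} g(ξ) dξ (for Λ ∈ {Ω, Σ}, where Λ_{cε} denotes the dispersion relation with parameter κ = cε) satisfy (∫_ℝ ‖u_Ω(t,·)‖_{L^r(ℝ³)}^q dt)^{1/q} ≤ C·((1 + (2ᵏcε)²)^{3/2}·ε⁻²·c⁻³)^{1/q}·‖g‖_{L²(ℝ³)} and (∫_ℝ ‖u_Σ(t,·)‖_{L^r(ℝ³)}^q dt)^{1/q} ≤ C·((1 + (2ᵏcε)²)^{7/6}·2^{k/3}·ε^{−5/3}·c^{−8/3})^{1/q}·‖g‖_{L²(ℝ³)}. -/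

import Mathlib

noncomputable section

open MeasureTheory

/-- `ℝ³` with the Euclidean norm. -/
abbrev E3 : Type := EuclideanSpace ℝ (Fin 3)

/-- `d₁(ξ)`, the distance from `ξ` to `(0,0,κ⁻¹)`. -/
def d1 (κ : ℝ) (ξ : E3) : ℝ := Real.sqrt ((ξ 0) ^ 2 + (ξ 1) ^ 2 + (ξ 2 - κ⁻¹) ^ 2)

/-- `d₂(ξ)`, the distance from `ξ` to `(0,0,−κ⁻¹)`. -/
def d2 (κ : ℝ) (ξ : E3) : ℝ := Real.sqrt ((ξ 0) ^ 2 + (ξ 1) ^ 2 + (ξ 2 + κ⁻¹) ^ 2)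

/-- `Σ_κ(ξ) = (d₂(ξ) + d₁(ξ))/2`, the sound wave dispersion relation. -/
def Sig (κ : ℝ) (ξ : E3) : ℝ := (d2 κ ξ + d1 κ ξ) / 2

/-- `Ω_κ(ξ) = (d₂(ξ) − d₁(ξ))/2`, the inertial wave dispersion relation. -/
def Om (κ : ℝ) (ξ : E3) : ℝ := (d2 κ ξ - d1 κ ξ) / 2

/-- The horizontal norm `|ξ_h| = √(ξ₁² + ξ₂²)`. -/
def nrmh (ξ : E3) : ℝ := Real.sqrt ((ξ 0) ^ 2 + (ξ 1) ^ 2)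

/-- `x·ξ`, the Euclidean dot product on `ℝ³`. -/
def dot3 (x ξ : E3) : ℝ := x 0 * ξ 0 + x 1 * ξ 1 + x 2 * ξ 2

/-- The Littlewood–Paley bump `φ(x) = ψ(x/2) − ψ(x)` built from the cutoff `ψ`. -/
def lpBump (ψ : ℝ → ℝ) (y : ℝ) : ℝ := ψ (y / 2) - ψ y

/-- The hypotheses on the cutoff function `ψ`: smooth, `0 ≤ ψ ≤ 1`, supported in `[−2,2]`
and equal to `1` on `[−1,1]`. -/
def IsCutoff (ψ : ℝ → ℝ) : Prop :=
  ContDiff ℝ (⊤ : ℕ∞) ψ ∧ (∀ y, 0 ≤ ψ y ∧ ψ y ≤ 1) ∧ (∀ y, 2 < |y| → ψ y = 0) ∧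
    (∀ y, |y| ≤ 1 → ψ y = 1)

section Strichartz

open Set Real
open scoped ENNReal FourierTransform ComplexConjugate

theorem lintegral_comp_abs_le (g : ℝ → ℝ≥0∞) :
    ∫⁻ v, g |v| ≤ 2 * ∫⁻ v in Ioi (0 : ℝ), g v := by
  have h1 : ∫⁻ v, g |v| = (∫⁻ v in Ioi (0 : ℝ), g |v|) + ∫⁻ v in Iic (0 : ℝ), g |v| := by
    rw [← lintegral_add_compl (fun v => g |v|) (measurableSet_Ioi (a := (0 : ℝ))), compl_Ioi]
  have h2 : ∫⁻ v in Ioi (0 : ℝ), g |v| = ∫⁻ v in Ioi (0 : ℝ), g v :=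
    setLIntegral_congr_fun measurableSet_Ioi fun v hv => by simp only [abs_of_pos (mem_Ioi.1 hv)]
  have h3 : ∫⁻ v in Iic (0 : ℝ), g |v| = ∫⁻ v in Ioi (0 : ℝ), g v := by
    rw [← setLIntegral_congr (Iio_ae_eq_Iic (a := (0 : ℝ)) (μ := volume)),
      ← lintegral_indicator measurableSet_Iio, ← lintegral_indicator measurableSet_Ioi,
      ← lintegral_neg_eq_self (μ := volume)]
    congr 1
    ext v
    by_cases hv : 0 < v
    · simp [indicator, hv, abs_of_pos hv]
    · simp [indicator, hv]
  rw [h1, h2, h3, two_mul]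

theorem lintegral_Ioc_rpow_neg {l R : ℝ} (hl : l < 1) (hR : 0 < R) :
    ∫⁻ v in Ioc 0 R, ENNReal.ofReal (v ^ (-l)) = ENNReal.ofReal (R ^ (1 - l) / (1 - l)) := by
  rw [← ofReal_integral_eq_lintegral_ofReal]
  · rw [← intervalIntegral.integral_of_le hR.le, integral_rpow (Or.inl (by linarith)),
      zero_rpow (by linarith), sub_zero, neg_add_eq_sub]
  · exact (intervalIntegrable_iff_integrableOn_Ioc_of_le hR.le).1
      (intervalIntegral.intervalIntegrable_rpow' (by linarith))
  · filter_upwards [ae_restrict_mem measurableSet_Ioc] with v hv using rpow_nonneg hv.1.le _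

theorem lintegral_Ioi_rpow_neg_two {R : ℝ} (hR : 0 < R) :
    ∫⁻ v in Ioi R, ENNReal.ofReal (v ^ (-2 : ℝ)) = ENNReal.ofReal R⁻¹ := by
  rw [← ofReal_integral_eq_lintegral_ofReal]
  · rw [integral_Ioi_rpow_of_lt (by norm_num) hR]
    congr 1
    norm_num [rpow_neg_one]
  · exact integrableOn_Ioi_rpow_of_lt (by norm_num) hR
  · filter_upwards [ae_restrict_mem measurableSet_Ioi] with v hv
    exact rpow_nonneg (hR.trans hv).le _

theorem lintegral_comp_abs_sub_le (g : ℝ → ℝ≥0∞) (t : ℝ) :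
    ∫⁻ s, g |t - s| ≤ 2 * ∫⁻ v in Ioi (0 : ℝ), g v := by
  rw [lintegral_sub_left_eq_self (fun v => g |v|) t]
  exact lintegral_comp_abs_le g

/-- The part of the fractional integral of `f` at `t` where `f s ≤ f t`. -/
theorem fractional_integral_sublevel_le {q : ℝ} (hq : 2 < q) {f : ℝ → ℝ≥0∞} (hf : Measurable f)
    {N a : ℝ} (hN : 0 < N) (ha : 0 < a) (t : ℝ)
    (hfN : ∫⁻ s, f s ^ (q / (q - 1)) = ENNReal.ofReal (N ^ (q / (q - 1)))) :
    ∫⁻ s in {s | f s ≤ ENNReal.ofReal a}, f s * ENNReal.ofReal (|t - s| ^ (-(2 / q))) ≤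
      ENNReal.ofReal ((2 / (1 - 2 / q) + 2 ^ (1 / q)) *
        (N ^ (2 - q / (q - 1)) * a ^ (q / (q - 1) - 1))) := by
  set p := q / (q - 1) with hp
  have hq1 : 0 < q - 1 := by linarith
  have hl : 2 / q < 1 := by rw [div_lt_one (by linarith)]; exact hq
  set R := (N / a) ^ p with hR
  have hR0 : 0 < R := by positivity
  set k : ℝ → ℝ≥0∞ := fun v => ENNReal.ofReal (v ^ (-(2 / q))) with hk
  have hkm : Measurable k := by fun_prop
  have hpq : p.HolderConjugate q := (Real.HolderConjugate.conjExponent (by linarith)).symm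
  set A := {s | f s ≤ ENNReal.ofReal a} with hA
  have hAm : MeasurableSet A := measurableSet_le hf measurable_const
  have split : ∫⁻ s in A, f s * k |t - s| ≤
      (∫⁻ s, ENNReal.ofReal a * (Iic R).indicator k |t - s|) +
        ∫⁻ s, f s * (Ioi R).indicator k |t - s| := by
    rw [← lintegral_indicator hAm, ← lintegral_add_left]
    · apply lintegral_mono
      intro s
      by_cases hs : s ∈ A
      · by_cases hB : |t - s| ≤ R
        · have : ¬ R < |t - s| := not_lt.2 hB
          simp only [indicator, hs, mem_Iic, hB, mem_Ioi, this, if_true, if_false, mul_zero,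
            add_zero]
          gcongr
          exact hs
        · have h' : R < |t - s| := not_le.1 hB
          simp only [indicator, hs, mem_Iic, hB, mem_Ioi, h', if_true, if_false, mul_zero,
            zero_add, le_refl]
      · simp [indicator, hs]
    · exact (((hkm.indicator measurableSet_Iic).comp (by fun_prop)).const_mul _)
  have near : ∫⁻ s, ENNReal.ofReal a * (Iic R).indicator k |t - s| ≤
      ENNReal.ofReal (2 / (1 - 2 / q) * (N ^ (2 - p) * a ^ (p - 1))) := by
    have hm : Measurable fun s => (Iic R).indicator k |t - s| :=
      (hkm.indicator measurableSet_Iic).comp (by fun_prop)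
    rw [lintegral_const_mul _ hm]
    calc _ ≤ ENNReal.ofReal a * (2 * ∫⁻ v in Ioi (0 : ℝ), (Iic R).indicator k v) := by
          gcongr; exact lintegral_comp_abs_sub_le _ t
      _ = ENNReal.ofReal a * (2 * ENNReal.ofReal (R ^ (1 - 2 / q) / (1 - 2 / q))) := by
          rw [← lintegral_Ioc_rpow_neg hl hR0, setLIntegral_indicator measurableSet_Iic,
            inter_comm, Ioi_inter_Iic]
      _ = _ := by
          rw [← ENNReal.ofReal_ofNat 2, ← ENNReal.ofReal_mul (by norm_num),
            ← ENNReal.ofReal_mul ha.le]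
          congr 1
          have e : p * (1 - 2 / q) = 2 - p := by
            rw [hp]; field_simp; ring
          rw [hR, ← rpow_mul (by positivity), e, div_rpow hN.le ha.le]
          have : a ^ (p - 1) = a / a ^ (2 - p) := by
            rw [show p - 1 = 1 - (2 - p) by ring, rpow_sub ha, rpow_one]
          rw [this]
          field_simp
  have far : ∫⁻ s, f s * (Ioi R).indicator k |t - s| ≤
      ENNReal.ofReal (2 ^ (1 / q) * (N ^ (2 - p) * a ^ (p - 1))) := by
    have hm : Measurable fun s => (Ioi R).indicator k |t - s| :=
      (hkm.indicator measurableSet_Ioi).comp (by fun_prop)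
    have h1 := ENNReal.lintegral_mul_le_Lp_mul_Lq volume hpq hf.aemeasurable hm.aemeasurable
    refine h1.trans ?_
    have h2 : ∫⁻ s, (Ioi R).indicator k |t - s| ^ q ≤ ENNReal.ofReal (2 * R⁻¹) := by
      calc _ = ∫⁻ s, (fun v => (Ioi R).indicator k v ^ q) |t - s| := rfl
        _ ≤ 2 * ∫⁻ v in Ioi (0 : ℝ), (Ioi R).indicator k v ^ q := lintegral_comp_abs_sub_le _ t
        _ = 2 * ∫⁻ v in Ioi (0 : ℝ),
              (Ioi R).indicator (fun v => ENNReal.ofReal (v ^ (-2 : ℝ))) v := by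
            congr 1
            refine setLIntegral_congr_fun measurableSet_Ioi fun v hv => ?_
            by_cases hvR : R < v
            · have hv0 : 0 < v := hv
              simp only [indicator, mem_Ioi, hvR, if_true, hk]
              rw [ENNReal.ofReal_rpow_of_pos (by positivity), ← rpow_mul hv0.le]
              congr 2
              have : q ≠ 0 := by linarith
              field_simp
            · simp [indicator, hvR, show 0 < q by linarith]
        _ = 2 * ENNReal.ofReal R⁻¹ := by
            rw [setLIntegral_indicator measurableSet_Ioi, Ioi_inter_Ioi,
              sup_eq_left.2 hR0.le, lintegral_Ioi_rpow_neg_two hR0]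
        _ = _ := by
          rw [← ENNReal.ofReal_ofNat 2, ← ENNReal.ofReal_mul (by norm_num)]
    calc _ ≤ (ENNReal.ofReal (N ^ p)) ^ (1 / p) * (ENNReal.ofReal (2 * R⁻¹)) ^ (1 / q) := by
          rw [hfN]; gcongr
      _ = _ := by
          have hp0 : p ≠ 0 := hpq.ne_zero
          have hN1 : (N ^ p) ^ (1 / p) = N := by
            rw [← rpow_mul hN.le, mul_one_div_cancel hp0, rpow_one]
          rw [ENNReal.ofReal_rpow_of_pos (by positivity), ENNReal.ofReal_rpow_of_pos (by positivity),
            ← ENNReal.ofReal_mul (by positivity), hN1, mul_rpow (by norm_num) (by positivity)]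
          congr 1
          have e : p * (1 / q) = p - 1 := by
            rw [hp]; field_simp; ring
          rw [hR, inv_rpow (by positivity), ← rpow_mul (by positivity), e, div_rpow hN.le ha.le]
          have : N ^ (2 - p) = N / N ^ (p - 1) := by
            rw [show 2 - p = 1 - (p - 1) by ring, rpow_sub hN, rpow_one]
          rw [this]
          field_simp
  refine split.trans ((add_le_add near far).trans_eq ?_)
  have : 0 < 1 - 2 / q := by linarith
  rw [← ENNReal.ofReal_add (by positivity) (by positivity), add_mul]

/-- Diagonal Hardy-Littlewood-Sobolev inequality on the line. -/
theorem hardy_littlewood_sobolev_diag {q : ℝ} (hq : 2 < q) :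
    ∃ C : ℝ, 0 < C ∧ ∀ f : ℝ → ℝ≥0∞, Measurable f → (∀ t, f t ≠ ∞) →
      ∫⁻ s, f s ^ (q / (q - 1)) ≠ ∞ →
      ∫⁻ t, ∫⁻ s, f t * f s * ENNReal.ofReal (|t - s| ^ (-(2 / q))) ≤
        ENNReal.ofReal C * (∫⁻ s, f s ^ (q / (q - 1))) ^ (2 / (q / (q - 1))) := by
  set p := q / (q - 1) with hp
  have hq1 : 0 < q - 1 := by linarith
  have hl : 2 / q < 1 := by rw [div_lt_one (by linarith)]; exact hq
  have hl' : 0 < 1 - 2 / q := by linarith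
  have hpq : p.HolderConjugate q := (Real.HolderConjugate.conjExponent (by linarith)).symm
  have hp0 : 0 < p := hpq.pos
  set C₀ := 2 / (1 - 2 / q) + 2 ^ (1 / q) with hC₀
  have hC₀0 : 0 < C₀ := by positivity
  refine ⟨2 * C₀, by positivity, fun f hf hft hfi => ?_⟩
  by_cases h0 : ∫⁻ s, f s ^ p = 0
  · have hf0 : f =ᵐ[volume] 0 := by
      rw [lintegral_eq_zero_iff (by fun_prop)] at h0
      filter_upwards [h0] with s hs
      simpa [ENNReal.rpow_eq_zero_iff, hp0, hp0.not_gt] using hs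
    have : ∫⁻ t, ∫⁻ s, f t * f s * ENNReal.ofReal (|t - s| ^ (-(2 / q))) = 0 := by
      rw [lintegral_congr_ae (g := fun _ => 0)]
      · simp
      · filter_upwards [hf0] with t ht
        simp [ht]
    rw [this]; exact zero_le
  set J := ∫⁻ s, f s ^ p
  set N := J.toReal ^ (1 / p) with hN
  have hJ0 : 0 < J.toReal := ENNReal.toReal_pos h0 hfi
  have hN0 : 0 < N := by positivity
  have hNp : N ^ p = J.toReal := by
    rw [hN, ← rpow_mul hJ0.le, one_div_mul_cancel hp0.ne', rpow_one]
  have hfN : J = ENNReal.ofReal (N ^ p) := by rw [hNp, ENNReal.ofReal_toReal hfi]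
  set F : ℝ → ℝ → ℝ≥0∞ := fun t s => f t * f s * ENNReal.ofReal (|t - s| ^ (-(2 / q))) with hF
  have hFm : Measurable (Function.uncurry F) := by
    simp only [hF, Function.uncurry_def]; fun_prop
  set D : Set (ℝ × ℝ) := {z | f z.2 ≤ f z.1} with hD
  have hDm : MeasurableSet D := measurableSet_le (by fun_prop) (by fun_prop)
  set G : ℝ → ℝ → ℝ≥0∞ := fun t s => D.indicator (Function.uncurry F) (t, s) with hG
  have hGm : Measurable (Function.uncurry G) := hFm.indicator hDm
  have hFG : ∀ t s, F t s ≤ G t s + G s t := by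
    intro t s
    have hsymm : F s t = F t s := by
      simp only [hF]; rw [abs_sub_comm, mul_comm (f s)]
    rcases le_total (f s) (f t) with h | h
    · have : (t, s) ∈ D := h
      simp only [hG, indicator_of_mem this]
      exact le_self_add
    · have : (s, t) ∈ D := h
      simp only [hG, indicator_of_mem this, Function.uncurry, hsymm]
      exact le_add_self
  have h1 : ∫⁻ t, ∫⁻ s, F t s ≤ 2 * ∫⁻ t, ∫⁻ s, G t s := by
    calc _ ≤ ∫⁻ t, ∫⁻ s, (G t s + G s t) := by
          gcongr with t s; exact hFG t s
      _ = ∫⁻ t, ((∫⁻ s, G t s) + ∫⁻ s, G s t) := by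
          congr 1; ext t; rw [lintegral_add_left (by exact hGm.of_uncurry_left)]
      _ = (∫⁻ t, ∫⁻ s, G t s) + ∫⁻ t, ∫⁻ s, G s t := by
          have hGi : Measurable fun t => ∫⁻ s, G t s := hGm.lintegral_prod_right'
          rw [lintegral_add_left hGi]
      _ = _ := by
          rw [lintegral_lintegral_swap (f := fun t s => G s t), two_mul]
          exact (hGm.comp measurable_swap).aemeasurable
  have h2 : ∀ t, ∫⁻ s, G t s ≤ ENNReal.ofReal (C₀ * N ^ (2 - p)) * f t ^ p := by
    intro t
    by_cases hft0 : f t = 0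
    · have : ∀ s, G t s = 0 := by
        intro s
        simp only [hG, indicator, Function.uncurry, hF, hft0]; simp
      simp [this]
    set a := (f t).toReal with ha
    have ha0 : 0 < a := ENNReal.toReal_pos hft0 (hft t)
    have hfa : f t = ENNReal.ofReal a := (ENNReal.ofReal_toReal (hft t)).symm
    have key := fractional_integral_sublevel_le hq hf hN0 ha0 t hfN
    rw [← hfa] at key
    calc ∫⁻ s, G t s = f t * ∫⁻ s in {s | f s ≤ f t},
            f s * ENNReal.ofReal (|t - s| ^ (-(2 / q))) := by
          rw [← lintegral_indicator (measurableSet_le hf measurable_const),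
            ← lintegral_const_mul]
          · congr 1
            ext s
            by_cases h : f s ≤ f t
            · have : (t, s) ∈ D := h
              simp [hG, hF, indicator, this, h, mul_assoc]
            · have : (t, s) ∉ D := h
              simp [hG, indicator, this, h]
          · exact Measurable.indicator (by fun_prop) (measurableSet_le hf measurable_const)
      _ ≤ f t * ENNReal.ofReal (C₀ * (N ^ (2 - p) * a ^ (p - 1))) := by gcongr
      _ = _ := by
          rw [hfa, ENNReal.ofReal_rpow_of_pos ha0, ← ENNReal.ofReal_mul ha0.le,
            ← ENNReal.ofReal_mul (by positivity)]
          congr 1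
          rw [rpow_sub ha0, rpow_one]
          field_simp
  calc _ ≤ 2 * ∫⁻ t, ∫⁻ s, G t s := h1
    _ ≤ 2 * ∫⁻ t, ENNReal.ofReal (C₀ * N ^ (2 - p)) * f t ^ p := by
        gcongr with t; exact h2 t
    _ = 2 * (ENNReal.ofReal (C₀ * N ^ (2 - p)) * J) := by
        rw [lintegral_const_mul _ (by fun_prop)]
    _ = _ := by
        rw [hfN, ENNReal.ofReal_rpow_of_pos (by positivity), ← ENNReal.ofReal_mul (by positivity),
          ← ENNReal.ofReal_mul (by positivity), ← ENNReal.ofReal_ofNat 2,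
          ← ENNReal.ofReal_mul (by norm_num)]
        congr 1
        rw [← rpow_mul hN0.le, mul_div_cancel₀ _ hp0.ne', rpow_sub hN0]
        field_simp

/-- Plancherel's identity for functions in `L¹ ∩ L²`. -/
theorem eLpNorm_fourier_two {f : E3 → ℂ} (h1 : Integrable f) (h2 : MemLp f 2) :
    eLpNorm (𝓕 f) 2 = eLpNorm f 2 := by
  set F : Lp ℂ 2 (volume : Measure E3) := 𝓕 (h2.toLp f) with hF
  have hcont : Continuous (𝓕 f) :=
    VectorFourier.fourierIntegral_continuous Real.continuous_fourierChar continuous_inner h1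
  have hae : F =ᵐ[volume] 𝓕 f := by
    refine ae_eq_of_integral_contDiff_smul_eq ?_ hcont.locallyIntegrable fun φ hφ hφc => ?_
    · exact (Lp.memLp F).locallyIntegrable (by norm_num)
    · have hφ' : ContDiff ℝ (⊤ : ℕ∞) (fun x => (φ x : ℂ)) := by
        exact Complex.ofRealCLM.contDiff.comp hφ
      have hφc' : HasCompactSupport (fun x => (φ x : ℂ)) :=
        hφc.comp_left (g := fun r : ℝ => (r : ℂ)) (by simp)
      set ψ : SchwartzMap E3 ℂ := hφc'.toSchwartzMap hφ' with hψ
      have hψx : ∀ x, ψ x = (φ x : ℂ) := fun x => rfl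
      have e1 : ∫ x, ψ x • F x = ∫ x, (𝓕 ψ) x • (h2.toLp f) x := by
        have := congrArg (fun T => T ψ) (Lp.fourier_toTemperedDistribution_eq (h2.toLp f))
        simpa [Lp.toTemperedDistribution_apply, TemperedDistribution.fourier_apply] using this.symm
      have e2 : ∫ x, (𝓕 ψ) x • (h2.toLp f) x = ∫ x, (𝓕 ψ) x • f x := by
        refine integral_congr_ae ?_
        filter_upwards [h2.coeFn_toLp] with x hx
        rw [hx]
      have e3 : ∫ x, (𝓕 (ψ : E3 → ℂ)) x • f x = ∫ x, ψ x • (𝓕 f) x := by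
        simpa using! (VectorFourier.integral_fourierIntegral_smul_eq_flip (L := innerₗ E3)
          Real.continuous_fourierChar continuous_inner (ψ.integrable) h1)
      simp only [← Complex.coe_smul] 
      have e4 := e1.trans (e2.trans e3)
      simpa [hψx] using e4
  rw [← eLpNorm_congr_ae hae]
  have : ‖F‖ = ‖h2.toLp f‖ := Lp.norm_fourier_eq _
  have h3 := congrArg ENNReal.ofReal this
  rw [Lp.norm_def, Lp.norm_def, ENNReal.ofReal_toReal (Lp.eLpNorm_ne_top _),
    ENNReal.ofReal_toReal (Lp.eLpNorm_ne_top _)] at h3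
  rw [h3, eLpNorm_congr_ae h2.coeFn_toLp]

/-- The Fourier integral with phase `x·ξ`. -/
def fourierDot (h : E3 → ℂ) (x : E3) : ℂ := ∫ ξ, Complex.exp (Complex.I * (dot3 x ξ : ℝ)) * h ξ

theorem dot3_eq_inner (x ξ : E3) : dot3 x ξ = inner ℝ ξ x := by
  simp [dot3, PiLp.inner_apply, Fin.sum_univ_three]

theorem fourierDot_eq (h : E3 → ℂ) (x : E3) : fourierDot h x = 𝓕 h ((-(2 * π)⁻¹) • x) := by
  rw [fourierDot, Real.fourier_eq']
  congr 1
  ext ξ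
  rw [dot3_eq_inner, inner_smul_right, smul_eq_mul]
  congr 2
  push_cast
  have : (π : ℂ) ≠ 0 := by exact_mod_cast pi_ne_zero
  field_simp

theorem continuous_fourierDot {h : E3 → ℂ} (h1 : Integrable h) : Continuous (fourierDot h) := by
  have hcont : Continuous (𝓕 h) :=
    VectorFourier.fourierIntegral_continuous Real.continuous_fourierChar continuous_inner h1
  have : fourierDot h = fun x => 𝓕 h ((-(2 * π)⁻¹) • x) := funext (fourierDot_eq h)
  rw [this]
  exact hcont.comp (continuous_const_smul _)

theorem lintegral_comp_smul_E3 (f : E3 → ℝ≥0∞) (hf : Measurable f) {r : ℝ} (hr : r ≠ 0) :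
    ∫⁻ x, f (r • x) = ENNReal.ofReal |r ^ 3|⁻¹ * ∫⁻ x, f x := by
  have := Measure.map_addHaar_smul (volume : Measure E3) hr
  rw [← lintegral_map (f := f) hf (measurable_const_smul r), this, lintegral_smul_measure]
  simp [abs_inv]

theorem lintegral_fourierDot_sq {h : E3 → ℂ} (h1 : Integrable h) (h2 : MemLp h 2) :
    ∫⁻ x, ‖fourierDot h x‖ₑ ^ 2 = ENNReal.ofReal ((2 * π) ^ 3) * ∫⁻ ξ, ‖h ξ‖ₑ ^ 2 := by
  have hcont : Continuous (𝓕 h) :=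
    VectorFourier.fourierIntegral_continuous Real.continuous_fourierChar continuous_inner h1
  simp only [fourierDot_eq]
  rw [lintegral_comp_smul_E3 (fun y => ‖𝓕 h y‖ₑ ^ 2) (by fun_prop) (by
    have := pi_pos; simp [pi_ne_zero])]
  have := eLpNorm_fourier_two h1 h2
  rw [eLpNorm_eq_lintegral_rpow_enorm_toReal (by norm_num) (by norm_num),
    eLpNorm_eq_lintegral_rpow_enorm_toReal (by norm_num) (by norm_num)] at this
  have h4 := congrArg (fun z => z ^ (2 : ℝ)) this
  simp only [← ENNReal.rpow_mul] at h4
  norm_num at h4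
  rw [h4]
  congr 2
  have := pi_pos
  rw [abs_pow, abs_neg, abs_inv, abs_of_pos (by positivity), ← inv_pow, inv_inv]

theorem memLp_two_of_lintegral {h : E3 → ℂ} (hm : AEStronglyMeasurable h)
    (hi : ∫⁻ ξ, ‖h ξ‖ₑ ^ 2 ≠ ∞) : MemLp h 2 := by
  refine ⟨hm, ?_⟩
  rw [eLpNorm_lt_top_iff_lintegral_rpow_enorm_lt_top (by norm_num) (by norm_num)]
  simpa using lt_top_iff_ne_top.2 hi

/-- The operator with Fourier symbol `m`, up to a constant. -/
def symbolOp (m f : E3 → ℂ) : E3 → ℂ := fourierDot fun ξ => m ξ * fourierDot f (-ξ)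

section symbolOp
variable {m f : E3 → ℂ}

theorem norm_exp_I_mul (x : ℝ) : ‖Complex.exp (Complex.I * x)‖ = 1 := by
  rw [mul_comm, Complex.norm_exp_ofReal_mul_I]

theorem norm_fourierDot_le (h : E3 → ℂ) (x : E3) : ‖fourierDot h x‖ ≤ ∫ ξ, ‖h ξ‖ := by
  refine (norm_integral_le_integral_norm _).trans_eq ?_
  simp

theorem integrable_mul_fourierDot (hm : Integrable m) (hf : Integrable f) :
    Integrable fun ξ => m ξ * fourierDot f (-ξ) :=
  hm.mul_bdd (c := ∫ ξ, ‖f ξ‖) ((continuous_fourierDot hf).comp continuous_neg).aestronglyMeasurable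
    (.of_forall fun _ => norm_fourierDot_le _ _)

theorem continuous_symbolOp (hm : Integrable m) (hf : Integrable f) : Continuous (symbolOp m f) :=
  continuous_fourierDot (integrable_mul_fourierDot hm hf)

theorem lintegral_symbolOp_sq_le (hm : Integrable m) (hmb : ∀ ξ, ‖m ξ‖ ≤ 1) (hf : Integrable f)
    (hf2 : MemLp f 2) :
    ∫⁻ x, ‖symbolOp m f x‖ₑ ^ 2 ≤ ENNReal.ofReal ((2 * π) ^ 6) * ∫⁻ ξ, ‖f ξ‖ₑ ^ 2 := by
  have hl : ∫⁻ ξ, ‖m ξ * fourierDot f (-ξ)‖ₑ ^ 2 ≤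
      ENNReal.ofReal ((2 * π) ^ 3) * ∫⁻ ξ, ‖f ξ‖ₑ ^ 2 := by
    calc _ ≤ ∫⁻ ξ, ‖fourierDot f (-ξ)‖ₑ ^ 2 := by
          gcongr with ξ
          rw [enorm_mul]
          have : ‖m ξ‖ₑ ≤ 1 := by
            rw [← ofReal_norm]; exact ENNReal.ofReal_le_one.2 (hmb ξ)
          exact mul_le_of_le_one_left zero_le this
      _ = ∫⁻ ξ, ‖fourierDot f ξ‖ₑ ^ 2 :=
          lintegral_neg_eq_self (μ := volume) (fun ξ => ‖fourierDot f ξ‖ₑ ^ 2)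
      _ = _ := lintegral_fourierDot_sq hf hf2
  have hi := integrable_mul_fourierDot hm hf
  have h2 : ∫⁻ ξ, ‖f ξ‖ₑ ^ 2 ≠ ∞ := by
    have := (eLpNorm_lt_top_iff_lintegral_rpow_enorm_lt_top (by norm_num) (by norm_num)).1 hf2.2
    simpa using this.ne
  rw [symbolOp, lintegral_fourierDot_sq hi
    (memLp_two_of_lintegral hi.1 (ne_top_of_le_ne_top (ENNReal.mul_ne_top (by simp) h2) hl))]
  calc _ ≤ ENNReal.ofReal ((2 * π) ^ 3) * (ENNReal.ofReal ((2 * π) ^ 3) * ∫⁻ ξ, ‖f ξ‖ₑ ^ 2) := by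
        gcongr
    _ = _ := by
        rw [← mul_assoc, ← ENNReal.ofReal_mul (by positivity), ← pow_add]

theorem symbolOp_eq_integral (hm : Integrable m) (hf : Integrable f) (x : E3) :
    symbolOp m f x = ∫ y, fourierDot m (x - y) * f y := by
  have hint : Integrable (Function.uncurry fun (ξ y : E3) =>
      Complex.exp (Complex.I * (dot3 x ξ : ℝ)) * (m ξ *
        (Complex.exp (Complex.I * (dot3 (-ξ) y : ℝ)) * f y))) (volume.prod volume) := by
    have h1 : Integrable (fun z : E3 × E3 => m z.1 * f z.2) (volume.prod volume) := hm.mul_prod hf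
    refine (h1.bdd_mul (c := 1) (f := fun z : E3 × E3 => Complex.exp (Complex.I * (dot3 x z.1 : ℝ)) *
      Complex.exp (Complex.I * (dot3 (-z.1) z.2 : ℝ))) ?_ ?_).congr ?_
    · apply Continuous.aestronglyMeasurable
      simp only [dot3]; fun_prop
    · exact .of_forall fun z => by simp
    · exact .of_forall fun z => by simp only [Function.uncurry]; ring
  calc symbolOp m f x = ∫ ξ, ∫ y, Complex.exp (Complex.I * (dot3 x ξ : ℝ)) * (m ξ *
        (Complex.exp (Complex.I * (dot3 (-ξ) y : ℝ)) * f y)) := by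
        simp only [symbolOp, fourierDot, integral_const_mul]
    _ = ∫ y, ∫ ξ, Complex.exp (Complex.I * (dot3 x ξ : ℝ)) * (m ξ *
        (Complex.exp (Complex.I * (dot3 (-ξ) y : ℝ)) * f y)) := integral_integral_swap hint
    _ = _ := by
        congr 1; ext y
        rw [fourierDot, ← integral_mul_const]
        congr 1; ext ξ
        have : dot3 (x - y) ξ = dot3 x ξ + dot3 (-ξ) y := by simp [dot3]; ring
        rw [this]; push_cast
        rw [mul_add, Complex.exp_add]; ring

theorem enorm_symbolOp_le (hm : Integrable m) (hf : Integrable f) {a : ℝ}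
    (ha : ∀ x, ‖fourierDot m x‖ ≤ a) (x : E3) :
    ‖symbolOp m f x‖ₑ ≤ ENNReal.ofReal a * ∫⁻ y, ‖f y‖ₑ := by
  rw [symbolOp_eq_integral hm hf]
  refine (enorm_integral_le_lintegral_enorm _).trans ?_
  rw [← lintegral_const_mul' _ _ ENNReal.ofReal_ne_top]
  gcongr with y
  rw [enorm_mul, ← ofReal_norm]
  gcongr
  exact ha _

theorem symbolOp_add {f₁ f₂ : E3 → ℂ} (hm : Integrable m) (h1 : Integrable f₁)
    (h2 : Integrable f₂) : symbolOp m (f₁ + f₂) = symbolOp m f₁ + symbolOp m f₂ := by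
  have hadd : ∀ {u v : E3 → ℂ}, Integrable u → Integrable v →
      fourierDot (u + v) = fourierDot u + fourierDot v := by
    intro u v hu hv
    ext x
    have aux : ∀ {u : E3 → ℂ}, Integrable u →
        Integrable fun ξ => Complex.exp (Complex.I * (dot3 x ξ : ℝ)) * u ξ := by
      intro u hu
      refine hu.bdd_mul (c := 1) ?_ (.of_forall fun z => by simp)
      apply Continuous.aestronglyMeasurable
      simp only [dot3]; fun_prop
    simp only [fourierDot, Pi.add_apply, mul_add]
    exact integral_add (aux hu) (aux hv)
  rw [symbolOp, symbolOp, symbolOp, ← hadd (integrable_mul_fourierDot hm h1)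
    (integrable_mul_fourierDot hm h2), hadd h1 h2]
  congr 1
  ext ξ
  simp [mul_add]

end symbolOp

theorem measure_le_norm_symbolOp {r : ℝ} (hr : 2 < r) {m f : E3 → ℂ} {a M t : ℝ}
    (hm : Integrable m) (hmb : ∀ ξ, ‖m ξ‖ ≤ 1) (ha0 : 0 < a) (ha : ∀ x, ‖fourierDot m x‖ ≤ a)
    (hfm : Measurable f) (hf : Integrable f) (hf2 : MemLp f 2) (hM : 0 < M)
    (hfM : ∫⁻ x, ‖f x‖ₑ ^ (r / (r - 1)) = ENNReal.ofReal M) (ht : 0 < t) :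
    volume {x | t ≤ ‖symbolOp m f x‖} ≤ ENNReal.ofReal (4 * (2 * π) ^ 6 * t ^ (-2 : ℝ)) *
      ∫⁻ x in {x | ‖f x‖ ≤ (2 * a * M / t) ^ (r - 1)}, ‖f x‖ₑ ^ 2 := by
  set p := r / (r - 1) with hp
  have hr1 : 0 < r - 1 := by linarith
  have hp1 : (p - 1) * (r - 1) = 1 := by rw [hp]; field_simp; ring
  have hp0 : 0 < p - 1 := by
    by_contra h
    nlinarith
  set s := (2 * a * M / t) ^ (r - 1) with hs
  have hs0 : 0 < s := by positivity
  have hsp : s ^ (p - 1) = 2 * a * M / t := by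
    rw [hs, ← rpow_mul (by positivity), mul_comm (r - 1), hp1, rpow_one]
  set A := {x | ‖f x‖ ≤ s} with hA
  have hAm : MeasurableSet A := measurableSet_le (by fun_prop) measurable_const
  have hsplit : f = A.indicator f + Aᶜ.indicator f := (indicator_self_add_compl A f).symm
  have hi1 : Integrable (A.indicator f) := hf.indicator hAm
  have hi2 : Integrable (Aᶜ.indicator f) := hf.indicator hAm.compl
  have hK2 : ∀ x, ‖symbolOp m (Aᶜ.indicator f) x‖ ≤ t / 2 := by
    intro x
    have h1 := enorm_symbolOp_le hm hi2 ha x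
    have h2 : ∫⁻ y, ‖Aᶜ.indicator f y‖ₑ ≤ ENNReal.ofReal (s ^ (1 - p) * M) := by
      rw [ENNReal.ofReal_mul (by positivity), ← hfM, ← lintegral_const_mul' _ _ (by simp)]
      gcongr with y
      by_cases hy : y ∈ A
      · simp [hy]
      · have hy' : s < ‖f y‖ := not_le.1 hy
        have hy0 : 0 < ‖f y‖ := hs0.trans hy'
        rw [indicator_of_mem (by exact hy), ← ofReal_norm, ENNReal.ofReal_rpow_of_pos hy0,
          ← ENNReal.ofReal_mul (by positivity)]
        apply ENNReal.ofReal_le_ofReal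
        have : s ^ (p - 1) ≤ ‖f y‖ ^ (p - 1) := rpow_le_rpow hs0.le hy'.le hp0.le
        have e : s ^ (1 - p) = (s ^ (p - 1))⁻¹ := by rw [← rpow_neg hs0.le, neg_sub]
        have e2 : ‖f y‖ ^ p = ‖f y‖ ^ (p - 1) * ‖f y‖ := by
          rw [← rpow_add_one hy0.ne']; congr 1; ring
        rw [e, e2, inv_mul_eq_div, le_div_iff₀ (by positivity), mul_comm]
        gcongr
    have h3 : ‖symbolOp m (Aᶜ.indicator f) x‖ₑ ≤ ENNReal.ofReal (t / 2) := by
      refine h1.trans ((mul_le_mul_right h2 _).trans_eq ?_)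
      rw [← ENNReal.ofReal_mul ha0.le]
      congr 1
      have e : s ^ (1 - p) = (s ^ (p - 1))⁻¹ := by rw [← rpow_neg hs0.le, neg_sub]
      rw [e, hsp]
      field_simp
    rw [← ofReal_norm] at h3
    exact (ENNReal.ofReal_le_ofReal_iff (by positivity)).1 h3
  have hsub : {x | t ≤ ‖symbolOp m f x‖} ⊆
      {x | ENNReal.ofReal (t ^ 2 / 4) ≤ ‖symbolOp m (A.indicator f) x‖ₑ ^ 2} := by
    intro x hx
    have hx' : t ≤ ‖symbolOp m f x‖ := hx
    rw [hsplit, symbolOp_add hm hi1 hi2] at hx'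
    have h4 := norm_add_le (symbolOp m (A.indicator f) x) (symbolOp m (Aᶜ.indicator f) x)
    have h5 : t / 2 ≤ ‖symbolOp m (A.indicator f) x‖ := by
      have := hK2 x
      simp only [Pi.add_apply] at hx'
      linarith
    simp only [mem_ofPred_eq]
    rw [← ofReal_norm, ← ENNReal.ofReal_pow (by positivity)]
    apply ENNReal.ofReal_le_ofReal
    nlinarith
  refine (measure_mono hsub).trans ?_
  have hc1 := continuous_symbolOp hm hi1
  have hmark := mul_meas_ge_le_lintegral (μ := (volume : Measure E3))
    (f := fun x => ‖symbolOp m (A.indicator f) x‖ₑ ^ 2) (by fun_prop) (ENNReal.ofReal (t ^ 2 / 4))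
  have hsq := hmark.trans (lintegral_symbolOp_sq_le hm hmb hi1 (hf2.indicator hAm))
  have hin : ∫⁻ x, ‖A.indicator f x‖ₑ ^ 2 = ∫⁻ x in A, ‖f x‖ₑ ^ 2 := by
    rw [← lintegral_indicator hAm]
    congr 1; ext x
    by_cases hx : x ∈ A <;> simp [hx]
  rw [hin, mul_comm (ENNReal.ofReal (t ^ 2 / 4)), ← ENNReal.le_div_iff_mul_le (by left; simp; positivity) (by simp),
    mul_comm (ENNReal.ofReal ((2 * π) ^ 6)), mul_div_assoc, mul_comm] at hsq
  refine hsq.trans_eq ?_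
  rw [← ENNReal.ofReal_div_of_pos (by positivity)]
  congr 2
  rw [rpow_neg ht.le]
  norm_num
  field_simp

theorem lintegral_symbolOp_rpow_le {r : ℝ} (hr : 2 < r) {m f : E3 → ℂ} {a M : ℝ}
    (hm : Integrable m) (hmb : ∀ ξ, ‖m ξ‖ ≤ 1) (ha0 : 0 < a) (ha : ∀ x, ‖fourierDot m x‖ ≤ a)
    (hfm : Measurable f) (hf : Integrable f) (hf2 : MemLp f 2) (hM : 0 < M)
    (hfM : ∫⁻ x, ‖f x‖ₑ ^ (r / (r - 1)) = ENNReal.ofReal M) :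
    ∫⁻ x, ‖symbolOp m f x‖ₑ ^ r ≤ ENNReal.ofReal
      (r * (4 * (2 * π) ^ 6) / (r - 2) * ((2 * a * M) ^ (r - 2) * M)) := by
  have hr1 : 0 < r - 1 := by linarith
  have hr2 : 0 < r - 2 := by linarith
  set s : ℝ → ℝ := fun t => (2 * a * M / t) ^ (r - 1) with hs
  set B : ℝ := 4 * (2 * π) ^ 6 with hB
  have hB0 : 0 < B := by have := pi_pos; positivity
  have hc := continuous_symbolOp hm hf
  have hsm : Measurable s := by fun_prop
  calc ∫⁻ x, ‖symbolOp m f x‖ₑ ^ r = ∫⁻ x, ENNReal.ofReal (‖symbolOp m f x‖ ^ r) := by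
        congr 1; ext x
        rw [← ofReal_norm, ENNReal.ofReal_rpow_of_nonneg (norm_nonneg _) (by linarith)]
    _ = ENNReal.ofReal r * ∫⁻ t in Ioi (0:ℝ), volume {x | t ≤ ‖symbolOp m f x‖} *
          ENNReal.ofReal (t ^ (r - 1)) :=
        lintegral_rpow_eq_lintegral_meas_le_mul _ (.of_forall fun x => norm_nonneg _)
          (by fun_prop) (by linarith)
    _ ≤ ENNReal.ofReal r * ∫⁻ t in Ioi (0:ℝ), ∫⁻ x,
          ENNReal.ofReal (B * t ^ (r - 3)) * {x | ‖f x‖ ≤ s t}.indicator (fun x => ‖f x‖ₑ ^ 2) x := by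
        refine mul_le_mul_right (setLIntegral_mono' (measurableSet_Ioi (a := (0 : ℝ)))
          fun t ht => ?_) _
        have ht0 : 0 < t := ht
        have h1 := measure_le_norm_symbolOp hr hm hmb ha0 ha hfm hf hf2 hM hfM ht0
        have h2 : MeasurableSet {x : E3 | ‖f x‖ ≤ s t} := measurableSet_le (by fun_prop) measurable_const
        refine (mul_le_mul_left h1 _).trans_eq ?_
        rw [lintegral_const_mul' _ _ (by simp), lintegral_indicator h2, mul_right_comm,
          ← ENNReal.ofReal_mul (by positivity), mul_assoc B, ← rpow_add ht0]
        congr 4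
        ring
    _ = ENNReal.ofReal r * ∫⁻ x, ∫⁻ t in Ioi (0:ℝ),
          ENNReal.ofReal (B * t ^ (r - 3)) * {x | ‖f x‖ ≤ s t}.indicator (fun x => ‖f x‖ₑ ^ 2) x := by
        rw [lintegral_lintegral_swap]
        apply Measurable.aemeasurable
        have h2 : MeasurableSet {z : ℝ × E3 | ‖f z.2‖ ≤ s z.1} :=
          measurableSet_le (by fun_prop) (by fun_prop)
        have h3 : Measurable ({z : ℝ × E3 | ‖f z.2‖ ≤ s z.1}.indicator
          (fun z => ‖f z.2‖ₑ ^ 2)) := Measurable.indicator (by fun_prop) h2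
        have h4 : Measurable fun z : ℝ × E3 => ENNReal.ofReal (B * z.1 ^ (r - 3)) := by fun_prop
        exact h4.mul h3
    _ ≤ ENNReal.ofReal r * ∫⁻ x, ENNReal.ofReal (B * ((2 * a * M) ^ (r - 2) / (r - 2))) *
          ‖f x‖ₑ ^ (r / (r - 1)) := by
        gcongr with x
        by_cases hx : f x = 0
        · simp [hx, indicator]
        have hx0 : 0 < ‖f x‖ := norm_pos_iff.2 hx
        set T := 2 * a * M * ‖f x‖ ^ (-(1 / (r - 1))) with hT
        have hT0 : 0 < T := by positivity
        calc _ ≤ ∫⁻ t in Ioi (0:ℝ), ENNReal.ofReal B * ‖f x‖ₑ ^ 2 *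
              (Iic T).indicator (fun t => ENNReal.ofReal (t ^ (-(3 - r)))) t := by
              refine setLIntegral_mono' measurableSet_Ioi fun t ht => ?_
              have ht0 : 0 < t := ht
              by_cases h : ‖f x‖ ≤ s t
              · have htT : t ≤ T := by
                  have h1 : ‖f x‖ ^ (1 / (r - 1)) ≤ 2 * a * M / t := by
                    have := rpow_le_rpow hx0.le h (show 0 ≤ 1 / (r - 1) by positivity)
                    rwa [hs, ← rpow_mul (by positivity), mul_one_div_cancel hr1.ne', rpow_one]
                      at this
                  rw [hT, rpow_neg hx0.le, ← div_eq_mul_inv, le_div_iff₀ (by positivity)]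
                  rwa [le_div_iff₀ ht0, mul_comm] at h1
                rw [indicator_of_mem (by exact h), indicator_of_mem (by exact htT),
                  ENNReal.ofReal_mul hB0.le, neg_sub]
                exact (mul_right_comm _ _ _).le
              · rw [indicator_of_notMem (by exact h), mul_zero]
                exact zero_le
          _ = ENNReal.ofReal B * ‖f x‖ₑ ^ 2 * ENNReal.ofReal (T ^ (r - 2) / (r - 2)) := by
              rw [lintegral_const_mul' _ _ (ENNReal.mul_ne_top (by simp) (by simp)),
                setLIntegral_indicator measurableSet_Iic, inter_comm, Ioi_inter_Iic,
                lintegral_Ioc_rpow_neg (by linarith) hT0,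
                show 1 - (3 - r) = r - 2 by ring]
          _ = _ := by
              rw [← ofReal_norm, ← ENNReal.ofReal_pow hx0.le, ENNReal.ofReal_rpow_of_pos hx0,
                ← ENNReal.ofReal_mul hB0.le, ← ENNReal.ofReal_mul (by positivity),
                ← ENNReal.ofReal_mul (by positivity)]
              congr 1
              rw [hT, mul_rpow (by positivity) (by positivity), ← rpow_mul hx0.le,
                show r / (r - 1) = 2 + -(1 / (r - 1)) * (r - 2) by field_simp; ring,
                rpow_add hx0, rpow_two]
              ring
    _ = _ := by
        rw [lintegral_const_mul' _ _ (by simp), hfM, ← ENNReal.ofReal_mul (by positivity),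
          ← ENNReal.ofReal_mul (by positivity)]
        congr 1
        ring

theorem lintegral_symbolOp_mul_le {r : ℝ} (hr : 2 < r) {m f h : E3 → ℂ} {a : ℝ}
    (hm : Integrable m) (hmb : ∀ ξ, ‖m ξ‖ ≤ 1) (ha0 : 0 < a) (ha : ∀ x, ‖fourierDot m x‖ ≤ a)
    (hfm : Measurable f) (hf : Integrable f) (hf2 : MemLp f 2) (hh : Measurable h)
    (hfi : ∫⁻ x, ‖f x‖ₑ ^ (r / (r - 1)) ≠ ∞) :
    ∫⁻ x, ‖symbolOp m f x‖ₑ * ‖h x‖ₑ ≤ ENNReal.ofReal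
      ((r * (4 * (2 * π) ^ 6) / (r - 2) * 2 ^ (r - 2)) ^ (1 / r) * a ^ (1 - 2 / r)) *
      ((∫⁻ x, ‖f x‖ₑ ^ (r / (r - 1))) ^ (1 / (r / (r - 1))) *
        (∫⁻ x, ‖h x‖ₑ ^ (r / (r - 1))) ^ (1 / (r / (r - 1)))) := by
  have hr1 : 0 < r - 1 := by linarith
  have hr2 : 0 < r - 2 := by linarith
  have hr0 : 0 < r := by linarith
  set p := r / (r - 1) with hp
  have hpos : 0 < p := by positivity
  have hc := continuous_symbolOp hm hf
  have hpr : r.HolderConjugate p := Real.HolderConjugate.conjExponent (by linarith)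
  have hH := ENNReal.lintegral_mul_le_Lp_mul_Lq volume hpr (f := fun x => ‖symbolOp m f x‖ₑ)
    (g := fun x => ‖h x‖ₑ) (by fun_prop) (by fun_prop)
  refine hH.trans ?_
  rw [← mul_assoc]
  gcongr ?_ * _
  by_cases h0 : ∫⁻ x, ‖f x‖ₑ ^ p = 0
  · have hf0 : ∫⁻ x, ‖f x‖ₑ = 0 := by
      rw [lintegral_eq_zero_iff (by fun_prop)] at h0 ⊢
      filter_upwards [h0] with s hs
      simpa [ENNReal.rpow_eq_zero_iff, hpos, hpos.not_gt] using hs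
    have : ∀ x, ‖symbolOp m f x‖ₑ = 0 := by
      intro x
      have := enorm_symbolOp_le hm hf ha x
      rw [hf0, mul_zero] at this
      exact le_antisymm this zero_le
    simp [this, hr0]
  set M := (∫⁻ x, ‖f x‖ₑ ^ p).toReal with hM
  have hM0 : 0 < M := ENNReal.toReal_pos h0 hfi
  have hfM : ∫⁻ x, ‖f x‖ₑ ^ p = ENNReal.ofReal M := (ENNReal.ofReal_toReal hfi).symm
  have h1 := lintegral_symbolOp_rpow_le hr hm hmb ha0 ha hfm hf hf2 hM0 hfM
  rw [hfM, ENNReal.ofReal_rpow_of_pos hM0, ← ENNReal.ofReal_mul (by positivity)]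
  refine (ENNReal.rpow_le_rpow h1 (by positivity)).trans_eq ?_
  rw [ENNReal.ofReal_rpow_of_pos (by positivity)]
  congr 1
  have e1 : (2 * a * M) ^ (r - 2) * M = 2 ^ (r - 2) * (a ^ (r - 2) * M ^ (r - 1)) := by
    rw [mul_rpow (by positivity) hM0.le, mul_rpow (by positivity) ha0.le,
      show r - 1 = (r - 2) + 1 by ring, rpow_add_one hM0.ne']
    ring
  rw [e1, ← mul_assoc, mul_rpow (by positivity) (by positivity),
    mul_rpow (x := a ^ (r - 2)) (by positivity) (by positivity), ← rpow_mul ha0.le,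
    ← rpow_mul hM0.le, ← mul_assoc, show (r - 2) * (1 / r) = 1 - 2 / r by field_simp,
    show (r - 1) * (1 / r) = 1 / p by rw [hp]; field_simp]

/-- Adjoint relation for the Fourier integral. -/
theorem integral_fourierDot_mul_conj {w h : E3 → ℂ} (hw : Integrable w) (hh : Integrable h) :
    ∫ y, fourierDot w y * conj (h y) = ∫ ξ, w ξ * conj (fourierDot h (-ξ)) := by
  have hint : Integrable (Function.uncurry fun (y ξ : E3) =>
      Complex.exp (Complex.I * (dot3 y ξ : ℝ)) * w ξ * conj (h y)) (volume.prod volume) := by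
    have hh' : Integrable (fun y => conj (h y)) := by
      exact (ContinuousLinearEquiv.integrable_comp_iff Complex.conjCLE).2 hh
    have h1 : Integrable (fun z : E3 × E3 => conj (h z.1) * w z.2) (volume.prod volume) :=
      hh'.mul_prod hw
    refine (h1.bdd_mul (c := 1) (f := fun z : E3 × E3 => Complex.exp (Complex.I * (dot3 z.1 z.2 : ℝ)))
      ?_ ?_).congr ?_
    · apply Continuous.aestronglyMeasurable
      simp only [dot3]; fun_prop
    · exact .of_forall fun z => by simp
    · exact .of_forall fun z => by simp only [Function.uncurry]; ring
  calc _ = ∫ y, ∫ ξ, Complex.exp (Complex.I * (dot3 y ξ : ℝ)) * w ξ * conj (h y) := by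
        simp only [fourierDot, integral_mul_const]
    _ = ∫ ξ, ∫ y, Complex.exp (Complex.I * (dot3 y ξ : ℝ)) * w ξ * conj (h y) :=
        integral_integral_swap hint
    _ = _ := by
        congr 1; ext ξ
        rw [fourierDot, ← integral_conj, ← integral_const_mul]
        congr 1; ext y
        have : dot3 (-ξ) y = -dot3 y ξ := by simp [dot3]; ring
        rw [map_mul, ← Complex.exp_conj, this]
        simp only [map_mul, Complex.conj_I, Complex.conj_ofReal]
        push_cast
        rw [neg_mul_neg]; ring

section Duality
variable {Λ : E3 → ℝ} {F : ℝ → E3 → ℂ} {B N : ℝ}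

/-- Bounded measurable space-time functions with bounded support. -/
structure IsTest (F : ℝ → E3 → ℂ) (B N : ℝ) : Prop where
  meas : Measurable (Function.uncurry F)
  bound : ∀ t x, ‖F t x‖ ≤ B
  supp : ∀ t x, F t x ≠ 0 → |t| ≤ N ∧ ‖x‖ ≤ N

/-- The Fourier transform of `F` at time `t`, propagated back to time `0`. -/
def backProp (Λ : E3 → ℝ) (F : ℝ → E3 → ℂ) (t : ℝ) (ξ : E3) : ℂ :=
  Complex.exp (-(Complex.I * (t * Λ ξ : ℝ))) * fourierDot (F t) (-ξ)

theorem norm_exp_neg_I_mul (x : ℝ) : ‖Complex.exp (-(Complex.I * x))‖ = 1 := by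
  have := norm_exp_I_mul (-x)
  push_cast at this
  rwa [mul_neg] at this

namespace IsTest

theorem meas_slice (hF : IsTest F B N) (t : ℝ) : Measurable (F t) := hF.meas.of_uncurry_left

theorem bound_nonneg (hF : IsTest F B N) : 0 ≤ B := (norm_nonneg _).trans (hF.bound 0 0)

theorem norm_le_indicator (hF : IsTest F B N) (t : ℝ) (x : E3) :
    ‖F t x‖ ≤ (Metric.closedBall (0 : E3) N).indicator (fun _ => B) x := by
  by_cases h : F t x = 0
  · rw [h, norm_zero]; exact indicator_nonneg (fun _ _ => hF.bound_nonneg) x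
  · rw [indicator_of_mem (by simpa using (hF.supp t x h).2)]
    exact hF.bound t x

theorem integrable_slice (hF : IsTest F B N) (t : ℝ) : Integrable (F t) := by
  have : Integrable ((Metric.closedBall (0 : E3) N).indicator (fun _ => B)) :=
    (integrable_indicator_iff measurableSet_closedBall).2
      (integrableOn_const (measure_closedBall_lt_top.ne))
  exact this.mono' (hF.meas_slice t).aestronglyMeasurable (.of_forall (hF.norm_le_indicator t))

theorem memLp_slice (hF : IsTest F B N) (t : ℝ) : MemLp (F t) 2 := by
  have : MemLp ((Metric.closedBall (0 : E3) N).indicator (fun _ => B)) 2 volume :=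
    memLp_indicator_const _ measurableSet_closedBall _ (Or.inr measure_closedBall_lt_top.ne)
  refine this.mono (hF.meas_slice t).aestronglyMeasurable (.of_forall fun x => ?_)
  exact (hF.norm_le_indicator t x).trans (le_abs_self _)

theorem lintegral_rpow_ne_top (hF : IsTest F B N) {p : ℝ} (hp : 0 < p) (t : ℝ) : ∫⁻ x, ‖F t x‖ₑ ^ p ≠ ∞ := by
  have h1 : ∫⁻ x, ‖F t x‖ₑ ^ p ≤
      ∫⁻ x, (Metric.closedBall (0 : E3) N).indicator (fun _ => ENNReal.ofReal (B ^ p)) x := by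
    gcongr with x
    by_cases h : F t x = 0
    · rw [h]; simp [hp]
    · rw [indicator_of_mem (by simpa using (hF.supp t x h).2), ← ofReal_norm,
        ENNReal.ofReal_rpow_of_nonneg (norm_nonneg _) hp.le]
      exact ENNReal.ofReal_le_ofReal (rpow_le_rpow (norm_nonneg _) (hF.bound t x) hp.le)
  refine ne_top_of_le_ne_top ?_ h1
  rw [lintegral_indicator_const measurableSet_closedBall]
  exact ENNReal.mul_ne_top (by simp) measure_closedBall_lt_top.ne

theorem norm_backProp_le (hF : IsTest F B N) : ∃ β, 0 ≤ β ∧ ∀ (t : ℝ) (ξ : E3),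
    ‖backProp Λ F t ξ‖ ≤ (Icc (-N) N).indicator (fun _ => β) t := by
  refine ⟨∫ x, (Metric.closedBall (0 : E3) N).indicator (fun _ => B) x,
    integral_nonneg fun x => indicator_nonneg (fun _ _ => hF.bound_nonneg) x, fun t ξ => ?_⟩
  rw [backProp, norm_mul, norm_exp_neg_I_mul, one_mul]
  refine (norm_fourierDot_le _ _).trans ?_
  by_cases ht : |t| ≤ N
  · rw [indicator_of_mem (by exact abs_le.1 ht)]
    refine integral_mono (hF.integrable_slice t).norm ?_ (hF.norm_le_indicator t)
    exact (integrable_indicator_iff measurableSet_closedBall).2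
      (integrableOn_const (measure_closedBall_lt_top.ne))
  · have : ∀ x, F t x = 0 := fun x => by
      by_contra h; exact ht (hF.supp t x h).1
    simp only [this, norm_zero, integral_zero]
    exact indicator_nonneg (fun _ _ =>
      integral_nonneg fun x => indicator_nonneg (fun _ _ => hF.bound_nonneg) x) t

theorem stronglyMeasurable_backProp (hF : IsTest F B N) (hΛ : Measurable Λ) :
    StronglyMeasurable (Function.uncurry (backProp Λ F)) := by
  have h1 : Measurable fun w : (ℝ × E3) × E3 =>
      Complex.exp (Complex.I * (dot3 (-w.1.2) w.2 : ℝ)) * F w.1.1 w.2 := by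
    refine Measurable.mul (by simp only [dot3]; fun_prop) ?_
    exact hF.meas.comp (f := fun w : (ℝ × E3) × E3 => (w.1.1, w.2)) (by fun_prop)
  have h2 := h1.stronglyMeasurable.integral_prod_right' (ν := (volume : Measure E3))
  refine StronglyMeasurable.mul (Measurable.stronglyMeasurable ?_) h2
  fun_prop

theorem integral_mul_conj (hF : IsTest F B N) (hΛ : Measurable Λ) {g : E3 → ℂ} (hg : Integrable g) :
    ∫ t, ∫ x, fourierDot (fun ξ => Complex.exp (Complex.I * (t * Λ ξ : ℝ)) * g ξ) x *
        conj (F t x) = ∫ ξ, g ξ * conj (∫ t, backProp Λ F t ξ) := by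
  obtain ⟨β, hβ, hb⟩ := hF.norm_backProp_le (Λ := Λ)
  have hint : Integrable (Function.uncurry fun (t : ℝ) (ξ : E3) =>
      g ξ * conj (backProp Λ F t ξ)) (volume.prod volume) := by
    have hβi : Integrable ((Icc (-N) N).indicator (fun _ => β)) :=
      (integrable_indicator_iff measurableSet_Icc).2 (integrableOn_const (by simp))
    refine Integrable.mono' (hβi.mul_prod hg.norm) ?_ (.of_forall fun z => ?_)
    · refine AEStronglyMeasurable.mul hg.1.comp_snd ?_
      exact (Complex.continuous_conj.comp_stronglyMeasurable
        (hF.stronglyMeasurable_backProp hΛ)).aestronglyMeasurable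
    · simp only [Function.uncurry, norm_mul, RCLike.norm_conj]
      rw [mul_comm]
      gcongr
      exact hb _ _
  calc _ = ∫ t, ∫ ξ, g ξ * conj (backProp Λ F t ξ) := by
        congr 1; ext t
        have hw : Integrable fun ξ => Complex.exp (Complex.I * (t * Λ ξ : ℝ)) * g ξ := by
          refine hg.bdd_mul (c := 1) ?_ (.of_forall fun z => by simp [-Complex.ofReal_mul])
          apply Measurable.aestronglyMeasurable; fun_prop
        rw [integral_fourierDot_mul_conj hw (hF.integrable_slice t)]
        congr 1; ext ξ
        rw [backProp, map_mul, ← Complex.exp_conj]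
        simp only [map_neg, map_mul, Complex.conj_I, Complex.conj_ofReal]
        rw [neg_mul, neg_neg]; ring
    _ = ∫ ξ, ∫ t, g ξ * conj (backProp Λ F t ξ) := integral_integral_swap hint
    _ = _ := by
        congr 1; ext ξ
        rw [integral_const_mul, integral_conj]

theorem integral_weight_mul_normSq (hF : IsTest F B N) (hΛ : Measurable Λ) {χ : E3 → ℝ} (hχ : Integrable χ) :
    ((∫ ξ, χ ξ * ‖∫ t, backProp Λ F t ξ‖ ^ 2 : ℝ) : ℂ) =
      ∫ z : ℝ × ℝ, ∫ y, symbolOp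
        (fun ξ => χ ξ * Complex.exp (Complex.I * ((z.2 - z.1) * Λ ξ : ℝ))) (F z.1) y *
          conj (F z.2 y) := by
  obtain ⟨β, hβ, hb⟩ := hF.norm_backProp_le (Λ := Λ)
  have hβi : Integrable ((Icc (-N) N).indicator (fun _ => β)) :=
    (integrable_indicator_iff measurableSet_Icc).2 (integrableOn_const (by simp))
  have hχc : Integrable fun ξ => (χ ξ : ℂ) := hχ.ofReal
  have hint : Integrable (Function.uncurry fun (ξ : E3) (z : ℝ × ℝ) =>
      (χ ξ : ℂ) * (backProp Λ F z.1 ξ * conj (backProp Λ F z.2 ξ)))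
      (volume.prod (volume.prod volume)) := by
    refine Integrable.mono' (hχ.norm.mul_prod (hβi.mul_prod hβi)) ?_ (.of_forall fun z => ?_)
    · refine AEStronglyMeasurable.mul hχc.1.comp_fst
        (StronglyMeasurable.aestronglyMeasurable ?_)
      have hs := hF.stronglyMeasurable_backProp hΛ
      refine StronglyMeasurable.mul
        (hs.comp_measurable (g := fun z : E3 × ℝ × ℝ => (z.2.1, z.1)) (by fun_prop))
        (Complex.continuous_conj.comp_stronglyMeasurable
          (hs.comp_measurable (g := fun z : E3 × ℝ × ℝ => (z.2.2, z.1)) (by fun_prop)))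
    · simp only [Function.uncurry, norm_mul, RCLike.norm_conj, Complex.norm_real]
      gcongr
      · exact (norm_nonneg _).trans (hb _ z.1)
      · exact hb _ _
      · exact hb _ _
  calc ((∫ ξ, χ ξ * ‖∫ t, backProp Λ F t ξ‖ ^ 2 : ℝ) : ℂ)
      = ∫ ξ, (χ ξ : ℂ) * ((∫ t, backProp Λ F t ξ) * ∫ t, conj (backProp Λ F t ξ)) := by
        rw [← integral_complex_ofReal]
        congr 1; ext ξ
        rw [integral_conj, Complex.mul_conj, Complex.normSq_eq_norm_sq]
        push_cast; rfl
    _ = ∫ ξ, ∫ z : ℝ × ℝ, (χ ξ : ℂ) * (backProp Λ F z.1 ξ * conj (backProp Λ F z.2 ξ)) := by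
        congr 1; ext ξ
        rw [← integral_prod_mul, ← integral_const_mul]; rfl
    _ = ∫ z : ℝ × ℝ, ∫ ξ, (χ ξ : ℂ) * (backProp Λ F z.1 ξ * conj (backProp Λ F z.2 ξ)) :=
        integral_integral_swap hint
    _ = _ := by
        congr 1; ext z
        have hm : Integrable fun ξ =>
            (χ ξ : ℂ) * Complex.exp (Complex.I * ((z.2 - z.1) * Λ ξ : ℝ)) := by
          refine hχc.mul_bdd (c := 1) ?_ (.of_forall fun z => by simp [-Complex.ofReal_mul])
          apply Measurable.aestronglyMeasurable; fun_prop
        rw [symbolOp, integral_fourierDot_mul_conj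
          (integrable_mul_fourierDot hm (hF.integrable_slice _)) (hF.integrable_slice _)]
        congr 1; ext ξ
        have : Complex.exp (Complex.I * ((z.2 - z.1) * Λ ξ : ℝ)) =
          Complex.exp (-(Complex.I * (z.1 * Λ ξ : ℝ))) *
            Complex.exp (Complex.I * (z.2 * Λ ξ : ℝ)) := by
          rw [← Complex.exp_add]; congr 1; push_cast; ring
        rw [this, backProp, backProp, map_mul, ← Complex.exp_conj]
        simp only [map_neg, map_mul, Complex.conj_I, Complex.conj_ofReal]
        rw [neg_mul, neg_neg]; ring

end IsTest
end Duality

theorem lintegral_weight_mul_sq_le {q : ℝ} (hq : 2 < q) : ∃ C : ℝ, 0 < C ∧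
    ∀ (Λ χ : E3 → ℝ) (A : ℝ) (F : ℝ → E3 → ℂ) (B N : ℝ), Measurable Λ → Integrable χ →
      (∀ ξ, 0 ≤ χ ξ ∧ χ ξ ≤ 1) → 0 < A →
      (∀ t : ℝ, t ≠ 0 → ∀ x, ‖fourierDot
        (fun ξ => χ ξ * Complex.exp (Complex.I * (t * Λ ξ : ℝ))) x‖ ≤ A / |t|) →
      IsTest F B N →
      ∫⁻ ξ, ENNReal.ofReal (χ ξ) * ‖∫ t, backProp Λ F t ξ‖ₑ ^ 2 ≤
        ENNReal.ofReal (C * A ^ (2 / q)) *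
          (∫⁻ t, ((∫⁻ x, ‖F t x‖ₑ ^ (2 * q / (q + 2))) ^ ((q + 2) / (2 * q))) ^ (q / (q - 1))) ^
            (2 / (q / (q - 1))) := by
  obtain ⟨C₁, hC₁, HLS⟩ := hardy_littlewood_sobolev_diag hq
  set r := 2 * q / (q - 2) with hr
  have hq2 : 0 < q - 2 := by linarith
  have hr2 : 2 < r := by rw [hr, lt_div_iff₀ hq2]; linarith
  have hr2' : 0 < r - 2 := by linarith
  set C₂ := (r * (4 * (2 * π) ^ 6) / (r - 2) * 2 ^ (r - 2)) ^ (1 / r) with hC₂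
  have hC₂0 : 0 < C₂ := by positivity
  refine ⟨C₂ * C₁, by positivity, fun Λ χ A F B N hΛ hχ hχb hA hdec hF => ?_⟩
  have hp : r / (r - 1) = 2 * q / (q + 2) := by
    have h1 : r - 1 = (q + 2) / (q - 2) := by rw [hr]; field_simp; ring
    rw [h1, hr, div_div_div_cancel_right₀ hq2.ne']
  have hp' : 1 / (r / (r - 1)) = (q + 2) / (2 * q) := by rw [hp, one_div_div]
  have hθ : 1 - 2 / r = 2 / q := by rw [hr]; field_simp; ring
  set D : ℝ → ℝ≥0∞ := fun t =>
    (∫⁻ x, ‖F t x‖ₑ ^ (2 * q / (q + 2))) ^ ((q + 2) / (2 * q)) with hD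
  have hDm : Measurable D := by
    have hm : Measurable fun z : ℝ × E3 => ‖F z.1 z.2‖ₑ ^ (2 * q / (q + 2)) :=
      hF.meas.enorm.pow_const _
    exact hm.lintegral_prod_right'.pow_const _
  have hDt : ∀ t, D t ≠ ∞ := fun t =>
    ENNReal.rpow_ne_top_of_nonneg (by positivity) (hF.lintegral_rpow_ne_top (by positivity) t)
  set m : ℝ → E3 → ℂ := fun t ξ => χ ξ * Complex.exp (Complex.I * (t * Λ ξ : ℝ)) with hm
  have hmi : ∀ t, Integrable (m t) := by
    intro t
    refine hχ.ofReal.mul_bdd (c := 1) ?_ (.of_forall fun z => by simp [-Complex.ofReal_mul])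
    apply Measurable.aestronglyMeasurable; fun_prop
  have hmb : ∀ t ξ, ‖m t ξ‖ ≤ 1 := by
    intro t ξ
    simp only [hm, norm_mul, norm_exp_I_mul, mul_one, Complex.norm_real, norm_eq_abs,
      abs_of_nonneg (hχb ξ).1]
    exact (hχb ξ).2
  have hpair : ∀ s t : ℝ, t ≠ s → ‖∫ y, symbolOp (m (t - s)) (F s) y * conj (F t y)‖ₑ ≤
      ENNReal.ofReal (C₂ * A ^ (2 / q)) * (D s * D t * ENNReal.ofReal (|s - t| ^ (-(2 / q)))) := by
    intro s t hst
    have hst' : 0 < |t - s| := abs_pos.2 (sub_ne_zero.2 hst)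
    refine (enorm_integral_le_lintegral_enorm _).trans ?_
    have hnc : ∀ y, ‖conj (F t y)‖ₑ = ‖F t y‖ₑ := fun y => by
      rw [← ofReal_norm, RCLike.norm_conj, ofReal_norm]
    simp only [enorm_mul, hnc]
    have h1 := lintegral_symbolOp_mul_le hr2 (hmi (t - s)) (hmb _)
      (show 0 < A / |t - s| by positivity) (hdec _ (sub_ne_zero.2 hst)) (hF.meas_slice s)
      (hF.integrable_slice s) (hF.memLp_slice s) (hF.meas_slice t)
      (hF.lintegral_rpow_ne_top (by rw [hp]; positivity) s)
    rw [hp', hp, hθ, div_eq_mul_inv A, mul_rpow hA.le (by positivity), inv_rpow hst'.le,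
      ← rpow_neg hst'.le, abs_sub_comm, ← hC₂,
      ENNReal.ofReal_mul hC₂0.le, ENNReal.ofReal_mul (p := A ^ (2 / q)) (by positivity)] at h1
    refine h1.trans_eq ?_
    rw [ENNReal.ofReal_mul hC₂0.le]
    simp only [hD]
    ring
  have hGm : StronglyMeasurable fun ξ => ∫ t, backProp Λ F t ξ :=
    (hF.stronglyMeasurable_backProp hΛ).integral_prod_left'
  by_cases hfin : ∫⁻ s, D s ^ (q / (q - 1)) = ∞
  · have hq1 : 0 < q - 1 := by linarith
    rw [hfin, ENNReal.top_rpow_of_pos (by positivity), ENNReal.mul_top]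
    · exact le_top
    · simp only [ne_eq, ENNReal.ofReal_eq_zero, not_le]; positivity
  have hid := hF.integral_weight_mul_normSq hΛ hχ
  have hnn : ∀ ξ, 0 ≤ χ ξ * ‖∫ t, backProp Λ F t ξ‖ ^ 2 := fun ξ =>
    mul_nonneg (hχb ξ).1 (by positivity)
  obtain ⟨β, hβ, hb⟩ := hF.norm_backProp_le (Λ := Λ)
  have hGb : ∀ ξ, ‖∫ t, backProp Λ F t ξ‖ ≤ ∫ t, (Icc (-N) N).indicator (fun _ => β) t := by
    intro ξ
    exact norm_integral_le_of_norm_le ((integrable_indicator_iff measurableSet_Icc).2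
      (integrableOn_const (by simp))) (.of_forall fun t => hb t ξ)
  have hint : Integrable fun ξ => χ ξ * ‖∫ t, backProp Λ F t ξ‖ ^ 2 := by
    refine hχ.mul_bdd (c := (∫ t, (Icc (-N) N).indicator (fun _ => β) t) ^ 2) ?_ ?_
    · exact (hGm.norm.pow 2).aestronglyMeasurable
    · refine .of_forall fun ξ => ?_
      rw [norm_pow, norm_norm]
      exact pow_le_pow_left₀ (norm_nonneg _) (hGb ξ) 2
  calc ∫⁻ ξ, ENNReal.ofReal (χ ξ) * ‖∫ t, backProp Λ F t ξ‖ₑ ^ 2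
      = ∫⁻ ξ, ENNReal.ofReal (χ ξ * ‖∫ t, backProp Λ F t ξ‖ ^ 2) := by
        congr 1; ext ξ
        rw [ENNReal.ofReal_mul (hχb ξ).1, ENNReal.ofReal_pow (norm_nonneg _), ofReal_norm]
    _ = ‖((∫ ξ, χ ξ * ‖∫ t, backProp Λ F t ξ‖ ^ 2 : ℝ) : ℂ)‖ₑ := by
        rw [← ofReal_integral_eq_lintegral_ofReal hint (.of_forall hnn), ← ofReal_norm,
          Complex.norm_real, norm_eq_abs, abs_of_nonneg (integral_nonneg hnn)]
    _ ≤ ∫⁻ s, ∫⁻ t, ‖∫ y, symbolOp (m (t - s)) (F s) y * conj (F t y)‖ₑ := by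
        rw [hid]
        refine (enorm_integral_le_lintegral_enorm _).trans ?_
        exact lintegral_prod_le _
    _ ≤ ∫⁻ s, ∫⁻ t, ENNReal.ofReal (C₂ * A ^ (2 / q)) *
          (D s * D t * ENNReal.ofReal (|s - t| ^ (-(2 / q)))) := by
        refine lintegral_mono fun s => lintegral_mono_ae ?_
        have : ∀ᵐ t : ℝ, t ≠ s := by simp [ae_iff]
        filter_upwards [this] with t ht
        exact hpair s t ht
    _ = ENNReal.ofReal (C₂ * A ^ (2 / q)) *
          ∫⁻ s, ∫⁻ t, D s * D t * ENNReal.ofReal (|s - t| ^ (-(2 / q))) := by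
        simp only [lintegral_const_mul' _ _ ENNReal.ofReal_ne_top]
    _ ≤ ENNReal.ofReal (C₂ * A ^ (2 / q)) *
          (ENNReal.ofReal C₁ * (∫⁻ s, D s ^ (q / (q - 1))) ^ (2 / (q / (q - 1)))) := by
        gcongr
        exact HLS D hDm hDt hfin
    _ = _ := by
        rw [← mul_assoc, ← ENNReal.ofReal_mul (by positivity)]
        congr 2
        ring

theorem enorm_pairing_le {q : ℝ} (hq : 2 < q) : ∃ C : ℝ, 0 < C ∧
    ∀ (Λ χ : E3 → ℝ) (A c₀ : ℝ) (g : E3 → ℂ) (F : ℝ → E3 → ℂ) (B N : ℝ), Measurable Λ →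
      Integrable χ → (∀ ξ, 0 ≤ χ ξ ∧ χ ξ ≤ 1) → 0 < A → 0 < c₀ →
      (∀ t : ℝ, t ≠ 0 → ∀ x, ‖fourierDot
        (fun ξ => χ ξ * Complex.exp (Complex.I * (t * Λ ξ : ℝ))) x‖ ≤ A / |t|) →
      Integrable g → (∀ᵐ ξ, g ξ ≠ 0 → c₀ ≤ χ ξ) → IsTest F B N →
      ‖∫ t, ∫ x, fourierDot (fun ξ => Complex.exp (Complex.I * (t * Λ ξ : ℝ)) * g ξ) x *
        conj (F t x)‖ₑ ≤ ENNReal.ofReal (C * A ^ (1 / q) * c₀ ^ (-(1 / 2) : ℝ)) *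
          (∫⁻ ξ, ‖g ξ‖ₑ ^ 2) ^ (1 / 2 : ℝ) *
          (∫⁻ t, ((∫⁻ x, ‖F t x‖ₑ ^ (2 * q / (q + 2))) ^ ((q + 2) / (2 * q))) ^ (q / (q - 1))) ^
            (1 / (q / (q - 1))) := by
  obtain ⟨C, hC, hw⟩ := lintegral_weight_mul_sq_le hq
  refine ⟨C ^ (1 / 2 : ℝ), by positivity, ?_⟩
  intro Λ χ A c₀ g F B N hΛ hχ hχb hA hc₀ hdec hg hgχ hF
  have hw := hw Λ χ A F B N hΛ hχ hχb hA hdec hF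
  set I := ∫⁻ t, ((∫⁻ x, ‖F t x‖ₑ ^ (2 * q / (q + 2))) ^ ((q + 2) / (2 * q))) ^ (q / (q - 1))
  set G := fun ξ => ∫ t, backProp Λ F t ξ with hG
  have hGm : StronglyMeasurable G :=
    (hF.stronglyMeasurable_backProp hΛ).integral_prod_left'
  have hχm : AEMeasurable χ := hχ.1.aemeasurable
  rw [hF.integral_mul_conj hΛ hg]
  have hG2 : ∫⁻ ξ, ENNReal.ofReal (χ ξ) * ‖G ξ‖ₑ ^ 2 =
      ∫⁻ ξ, (ENNReal.ofReal (χ ξ ^ (1 / 2 : ℝ)) * ‖G ξ‖ₑ) ^ (2 : ℝ) := by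
    congr 1; ext ξ
    rw [ENNReal.mul_rpow_of_nonneg _ _ (by norm_num),
      ENNReal.ofReal_rpow_of_nonneg (rpow_nonneg (hχb ξ).1 _) (by norm_num),
      ← rpow_mul (hχb ξ).1]
    norm_num
  calc _ ≤ ∫⁻ ξ, ‖g ξ‖ₑ * ‖G ξ‖ₑ := by
        refine (enorm_integral_le_lintegral_enorm _).trans_eq ?_
        congr 1; ext ξ
        rw [enorm_mul, ← ofReal_norm (conj _), RCLike.norm_conj, ofReal_norm]
    _ ≤ ∫⁻ ξ, ENNReal.ofReal (c₀ ^ (-(1 / 2) : ℝ)) *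
          (‖g ξ‖ₑ * (ENNReal.ofReal (χ ξ ^ (1 / 2 : ℝ)) * ‖G ξ‖ₑ)) := by
        refine lintegral_mono_ae ?_
        filter_upwards [hgχ] with ξ hξ
        by_cases h : g ξ = 0
        · simp [h]
        · have h1 : 1 ≤ ENNReal.ofReal (c₀ ^ (-(1 / 2) : ℝ)) *
              ENNReal.ofReal (χ ξ ^ (1 / 2 : ℝ)) := by
            rw [← ENNReal.ofReal_mul (by positivity), ← ENNReal.ofReal_one]
            apply ENNReal.ofReal_le_ofReal
            rw [rpow_neg hc₀.le, inv_mul_eq_div, one_le_div (by positivity)]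
            exact rpow_le_rpow hc₀.le (hξ h) (by norm_num)
          calc _ ≤ ENNReal.ofReal (c₀ ^ (-(1 / 2) : ℝ)) * ENNReal.ofReal (χ ξ ^ (1 / 2 : ℝ)) *
                (‖g ξ‖ₑ * ‖G ξ‖ₑ) := le_mul_of_one_le_left zero_le h1
            _ = _ := by ring
    _ = ENNReal.ofReal (c₀ ^ (-(1 / 2) : ℝ)) *
          ∫⁻ ξ, (‖g ξ‖ₑ * (ENNReal.ofReal (χ ξ ^ (1 / 2 : ℝ)) * ‖G ξ‖ₑ)) :=
        lintegral_const_mul' _ _ (by simp)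
    _ ≤ ENNReal.ofReal (c₀ ^ (-(1 / 2) : ℝ)) * ((∫⁻ ξ, ‖g ξ‖ₑ ^ (2 : ℝ)) ^ (1 / 2 : ℝ) *
          (∫⁻ ξ, (ENNReal.ofReal (χ ξ ^ (1 / 2 : ℝ)) * ‖G ξ‖ₑ) ^ (2 : ℝ)) ^ (1 / 2 : ℝ)) := by
        refine mul_le_mul_right (ENNReal.lintegral_mul_le_Lp_mul_Lq volume
          (by rw [Real.holderConjugate_iff]; norm_num) ?_ ?_) _
        · exact hg.1.enorm
        · exact (hχm.pow_const _).ennreal_ofReal.mul hGm.measurable.enorm.aemeasurable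
    _ ≤ ENNReal.ofReal (c₀ ^ (-(1 / 2) : ℝ)) * ((∫⁻ ξ, ‖g ξ‖ₑ ^ (2 : ℝ)) ^ (1 / 2 : ℝ) *
          (ENNReal.ofReal (C * A ^ (2 / q)) * I ^ (2 / (q / (q - 1)))) ^ (1 / 2 : ℝ)) := by
        rw [← hG2]; gcongr
    _ = _ := by
        rw [ENNReal.mul_rpow_of_nonneg _ _ (by norm_num),
          ENNReal.ofReal_rpow_of_pos (by positivity), ← ENNReal.rpow_mul,
          mul_rpow hC.le (by positivity), ← rpow_mul hA.le, mul_comm _ (c₀ ^ _),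
          ENNReal.ofReal_mul (by positivity) (p := c₀ ^ _)]
        have e1 : 2 / q * (1 / 2) = 1 / q := by ring
        have e2 : 2 / (q / (q - 1)) * (1 / 2) = 1 / (q / (q - 1)) := by ring
        rw [e1, e2]
        simp only [ENNReal.rpow_ofNat]
        ring

section Extremizer

/-- The truncated dual extremizer for the norm `L^q_t L^r_x` of `u`. -/
def extremizer (u : ℝ → E3 → ℂ) (r e : ℝ) (S : Set (ℝ × E3)) (n : ℝ → ℝ) (t : ℝ) (x : E3) : ℂ :=
  S.indicator (fun z => ((n z.1 ^ e * ‖u z.1 z.2‖ ^ (r - 2) : ℝ) : ℂ) * u z.1 z.2) (t, x)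

theorem norm_extremizer (u : ℝ → E3 → ℂ) {r e : ℝ} (hr : 2 < r) {S : Set (ℝ × E3)} {n : ℝ → ℝ}
    (hn : ∀ t, 0 ≤ n t) (t : ℝ) (x : E3) :
    ‖extremizer u r e S n t x‖ =
      S.indicator (fun z => n z.1 ^ e * ‖u z.1 z.2‖ ^ (r - 1)) (t, x) := by
  unfold extremizer
  by_cases h : (t, x) ∈ S
  · rw [indicator_of_mem h, indicator_of_mem h, norm_mul, Complex.norm_real, norm_mul,
      norm_of_nonneg (rpow_nonneg (hn t) e), norm_of_nonneg (rpow_nonneg (norm_nonneg _) (r - 2)),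
      mul_assoc]
    congr 1
    rcases eq_or_lt_of_le (norm_nonneg (u t x)) with h0 | h0
    · simp only [← h0, mul_zero]
      rw [zero_rpow (by linarith)]
    · rw [← rpow_add_one h0.ne']; congr 1; ring
  · rw [indicator_of_notMem h, indicator_of_notMem h, norm_zero]

theorem mul_conj_extremizer (u : ℝ → E3 → ℂ) {r e : ℝ} (hr : 2 < r) {S : Set (ℝ × E3)}
    {n : ℝ → ℝ} (t : ℝ) (x : E3) :
    u t x * conj (extremizer u r e S n t x) =
      ((S.indicator (fun z => n z.1 ^ e * ‖u z.1 z.2‖ ^ r) (t, x) : ℝ) : ℂ) := by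
  unfold extremizer
  by_cases h : (t, x) ∈ S
  · rw [indicator_of_mem h, indicator_of_mem h, map_mul, Complex.conj_ofReal, mul_left_comm,
      Complex.mul_conj, Complex.normSq_eq_norm_sq, ← Complex.ofReal_mul]
    rcases eq_or_lt_of_le (norm_nonneg (u t x)) with h0 | h0
    · simp only [← h0]
      rw [zero_rpow (by linarith : r ≠ 0)]; simp
    · rw [mul_assoc, ← rpow_natCast ‖u t x‖ 2, ← rpow_add h0]
      congr 3; push_cast; ring
  · rw [indicator_of_notMem h, indicator_of_notMem h]; simp

/-- Truncated form of the duality principle for `L^q_t L^r_x`. -/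
theorem lintegral_trunc_le_of_pairing {q : ℝ} (hq : 2 < q) {u : ℝ → E3 → ℂ} {M : ℝ} {K : ℝ≥0∞}
    (hu : Measurable (Function.uncurry u)) (hM : ∀ t x, ‖u t x‖ ≤ M)
    (hK : ∀ F B N, IsTest F B N → ‖∫ t, ∫ x, u t x * conj (F t x)‖ₑ ≤
      K * (∫⁻ t, ((∫⁻ x, ‖F t x‖ₑ ^ (2 * q / (q + 2))) ^ ((q + 2) / (2 * q))) ^ (q / (q - 1))) ^
            (1 / (q / (q - 1)))) {N : ℝ} (hN : 0 < N) :
    ∫⁻ t, {t | |t| ≤ N ∧ ENNReal.ofReal (1 / N) ≤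
        ∫⁻ x in Metric.closedBall 0 N, ‖u t x‖ₑ ^ (2 * q / (q - 2))}.indicator
      (fun t => (∫⁻ x in Metric.closedBall 0 N, ‖u t x‖ₑ ^ (2 * q / (q - 2))) ^ ((q - 2) / 2)) t
      ≤ K ^ q := by
  set r := 2 * q / (q - 2) with hr
  have hq2 : 0 < q - 2 := by linarith
  have hq1 : 0 < q - 1 := by linarith
  have hr2 : 2 < r := by rw [hr, lt_div_iff₀ hq2]; linarith
  set p := 2 * q / (q + 2) with hp
  have hp0 : 0 < p := by positivity
  have hrp : (r - 1) * p = r := by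
    rw [hr, hp]; field_simp; ring
  set e := (q - 4) / 2 with he
  have hM0 : 0 ≤ M := (norm_nonneg _).trans (hM 0 0)
  set n : ℝ → ℝ≥0∞ := fun t => ∫⁻ x in Metric.closedBall 0 N, ‖u t x‖ₑ ^ r with hn
  set E : Set ℝ := {t | |t| ≤ N ∧ ENNReal.ofReal (1 / N) ≤ n t} with hE
  have hnm : Measurable n := by
    have h1 : Measurable fun z : ℝ × E3 => ‖u z.1 z.2‖ₑ ^ r := hu.enorm.pow_const _
    exact h1.lintegral_prod_right'
  set L : ℝ≥0∞ := ENNReal.ofReal (M ^ r) * volume (Metric.closedBall (0 : E3) N) with hL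
  have hLt : L ≠ ∞ := ENNReal.mul_ne_top ENNReal.ofReal_ne_top
    (isCompact_closedBall (0 : E3) N).measure_lt_top.ne
  have hnL : ∀ t, n t ≤ L := by
    intro t
    calc n t ≤ ∫⁻ x in Metric.closedBall (0 : E3) N, ENNReal.ofReal (M ^ r) := by
          refine lintegral_mono fun x => ?_
          rw [← ofReal_norm, ENNReal.ofReal_rpow_of_nonneg (norm_nonneg _) (by linarith)]
          exact ENNReal.ofReal_le_ofReal (rpow_le_rpow (norm_nonneg _) (hM t x) (by linarith))
      _ = L := by rw [lintegral_const, Measure.restrict_apply_univ]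
  have hnt : ∀ t, n t ≠ ∞ := fun t => ne_top_of_le_ne_top hLt (hnL t)
  have hEm : MeasurableSet E :=
    (measurableSet_le measurable_norm measurable_const).inter
      (measurableSet_le measurable_const hnm)
  set S : Set (ℝ × E3) := E ×ˢ Metric.closedBall 0 N with hS
  have hSm : MeasurableSet S := hEm.prod measurableSet_closedBall
  set F := extremizer u r e S (fun t => (n t).toReal) with hF
  have hn0 : ∀ t, 0 ≤ (n t).toReal := fun t => ENNReal.toReal_nonneg
  have hEn : ∀ t ∈ E, 1 / N ≤ (n t).toReal := by
    intro t ht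
    exact (ENNReal.ofReal_le_iff_le_toReal (hnt t)).1 ht.2
  have hnpow : ∀ t ∈ E, (n t).toReal ^ e ≤ (1 / N) ^ e + L.toReal ^ e := by
    intro t ht
    have h1 := hEn t ht
    have h2 : (n t).toReal ≤ L.toReal := ENNReal.toReal_mono hLt (hnL t)
    have h3 : 0 < 1 / N := by positivity
    rcases le_total 0 e with h | h
    · have := rpow_le_rpow (hn0 t) h2 h
      have := rpow_nonneg h3.le e
      linarith
    · have := rpow_le_rpow_of_nonpos h3 h1 h
      have := rpow_nonneg (h3.le.trans (h1.trans h2)) e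
      linarith
  have hmeasS : Measurable fun z : ℝ × E3 => (n z.1).toReal ^ e :=
    (hnm.ennreal_toReal.comp measurable_fst).pow_const _
  have hunorm : ∀ y : ℝ, Measurable fun z : ℝ × E3 => ‖u z.1 z.2‖ ^ y := fun y =>
    hu.norm.pow_const _
  have hFt : IsTest F (((1 / N) ^ e + L.toReal ^ e) * M ^ (r - 1)) N := by
    refine ⟨?_, ?_, ?_⟩
    · refine Measurable.indicator (f := fun z : ℝ × E3 =>
        (((n z.1).toReal ^ e * ‖u z.1 z.2‖ ^ (r - 2) : ℝ) : ℂ) * u z.1 z.2) ?_ hSm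
      exact (Complex.measurable_ofReal.comp (hmeasS.mul (hunorm (r - 2)))).mul hu
    · intro t x
      rw [hF, norm_extremizer u hr2 hn0]
      by_cases h : (t, x) ∈ S
      · rw [indicator_of_mem h]
        have := hnpow t h.1
        have h4 := rpow_nonneg (hn0 t) e
        exact mul_le_mul this (rpow_le_rpow (norm_nonneg _) (hM t x) (by linarith))
          (by positivity) (h4.trans this)
      · rw [indicator_of_notMem h]; positivity
    · intro t x h
      have : (t, x) ∈ S := by
        by_contra h'
        exact h (indicator_of_notMem h' _)
      exact ⟨this.1.1, by simpa using this.2⟩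
  have hmain := hK F _ N hFt
  have hD : ∀ t, ((∫⁻ x, ‖F t x‖ₑ ^ p) ^ ((q + 2) / (2 * q))) ^ (q / (q - 1)) =
      E.indicator (fun t => n t ^ ((q - 2) / 2)) t := by
    intro t
    by_cases ht : t ∈ E
    · have hpos : n t ≠ 0 := by
        intro h
        have := ht.2
        rw [h] at this
        simp at this; linarith [inv_pos.2 hN]
      have h1 : ∀ x, ‖F t x‖ₑ ^ p = (Metric.closedBall (0 : E3) N).indicator
          (fun x => n t ^ (e * p) * ‖u t x‖ₑ ^ r) x := by
        intro x
        rw [← ofReal_norm, hF, norm_extremizer u hr2 hn0]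
        by_cases hx : x ∈ Metric.closedBall (0 : E3) N
        · rw [indicator_of_mem (show (t, x) ∈ S from ⟨ht, hx⟩), indicator_of_mem hx,
            ENNReal.ofReal_mul (rpow_nonneg (hn0 t) e), ENNReal.mul_rpow_of_nonneg _ _ hp0.le,
            ← ENNReal.ofReal_rpow_of_pos (ENNReal.toReal_pos hpos (hnt t)),
            ENNReal.ofReal_toReal (hnt t), ← ENNReal.rpow_mul,
            ← ENNReal.ofReal_rpow_of_nonneg (norm_nonneg _) (by linarith), ofReal_norm,
            ← ENNReal.rpow_mul, hrp]
        · rw [indicator_of_notMem (show (t, x) ∉ S from fun h => hx h.2), indicator_of_notMem hx]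
          simp [hp0]
      simp only [h1]
      rw [lintegral_indicator measurableSet_closedBall, lintegral_const_mul' _ _
        (ENNReal.rpow_ne_top_of_ne_zero hpos (hnt t)), indicator_of_mem ht]
      change ((n t ^ (e * p) * n t) ^ _) ^ _ = _
      nth_rewrite 2 [← ENNReal.rpow_one (n t)]
      rw [← ENNReal.rpow_add _ _ hpos (hnt t), ← ENNReal.rpow_mul, ← ENNReal.rpow_mul]
      congr 1
      rw [he, hp]; field_simp; ring
    · have h1 : ∀ x, F t x = 0 := fun x => by
        rw [hF]; exact indicator_of_notMem (fun h => ht h.1) _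
      simp only [h1, indicator_of_notMem ht]
      rw [enorm_zero, ENNReal.zero_rpow_of_pos hp0, lintegral_zero,
        ENNReal.zero_rpow_of_pos (by positivity), ENNReal.zero_rpow_of_pos (by positivity)]
  simp only [hD] at hmain
  set I := ∫⁻ t, E.indicator (fun t => n t ^ ((q - 2) / 2)) t with hI
  have hIt : I ≠ ∞ := by
    refine ne_top_of_le_ne_top (b := ∫⁻ t, (Icc (-N) N).indicator (fun _ => L ^ ((q - 2) / 2)) t)
      ?_ ?_
    · rw [lintegral_indicator measurableSet_Icc, lintegral_const, Measure.restrict_apply_univ]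
      exact ENNReal.mul_ne_top (ENNReal.rpow_ne_top_of_nonneg (by linarith) hLt) (by simp)
    · refine lintegral_mono fun t => ?_
      by_cases ht : t ∈ E
      · rw [indicator_of_mem ht, indicator_of_mem (show t ∈ Icc (-N) N from abs_le.1 ht.1)]
        exact ENNReal.rpow_le_rpow (hnL t) (by linarith)
      · rw [indicator_of_notMem ht]; exact zero_le
  have hpairing : ‖∫ t, ∫ x, u t x * conj (F t x)‖ₑ = I := by
    have h2 : ∀ t, ∫ x, u t x * conj (F t x) =
        ((E.indicator (fun t => n t ^ ((q - 2) / 2)) t).toReal : ℂ) := by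
      intro t
      simp only [hF, mul_conj_extremizer u hr2]
      rw [integral_complex_ofReal]
      congr 1
      rw [integral_eq_lintegral_of_nonneg_ae]
      · congr 1
        by_cases ht : t ∈ E
        · have hpos : n t ≠ 0 := by
            intro h
            have := ht.2
            rw [h] at this
            simp at this; linarith [inv_pos.2 hN]
          have h1 : ∀ x, ENNReal.ofReal (S.indicator
              (fun z => (n z.1).toReal ^ e * ‖u z.1 z.2‖ ^ r) (t, x)) =
              (Metric.closedBall (0 : E3) N).indicator (fun x => n t ^ e * ‖u t x‖ₑ ^ r) x := by
            intro x
            by_cases hx : x ∈ Metric.closedBall (0 : E3) N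
            · rw [indicator_of_mem (show (t, x) ∈ S from ⟨ht, hx⟩), indicator_of_mem hx,
                ENNReal.ofReal_mul (rpow_nonneg (hn0 t) e), 
                ← ENNReal.ofReal_rpow_of_pos (ENNReal.toReal_pos hpos (hnt t)),
                ENNReal.ofReal_toReal (hnt t),
                ← ENNReal.ofReal_rpow_of_nonneg (norm_nonneg _) (by linarith), ofReal_norm]
            · rw [indicator_of_notMem (show (t, x) ∉ S from fun h => hx h.2),
                indicator_of_notMem hx, ENNReal.ofReal_zero]
          simp only [h1]
          rw [lintegral_indicator measurableSet_closedBall, lintegral_const_mul' _ _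
            (ENNReal.rpow_ne_top_of_ne_zero hpos (hnt t)), indicator_of_mem ht]
          change n t ^ e * n t = _
          nth_rewrite 2 [← ENNReal.rpow_one (n t)]
          rw [← ENNReal.rpow_add _ _ hpos (hnt t)]
          congr 1; rw [he]; ring
        · rw [indicator_of_notMem ht]
          have : ∀ x, S.indicator (fun z => (n z.1).toReal ^ e * ‖u z.1 z.2‖ ^ r) (t, x) = 0 :=
            fun x => indicator_of_notMem (fun h => ht h.1) _
          simp [this]
      · exact .of_forall fun x => indicator_nonneg
          (fun z _ => mul_nonneg (rpow_nonneg (hn0 _) _) (rpow_nonneg (norm_nonneg _) _)) _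
      · refine Measurable.aestronglyMeasurable ?_
        exact ((hmeasS.mul (hunorm r)).indicator hSm).comp measurable_prodMk_left
    simp only [h2]
    rw [integral_complex_ofReal, integral_toReal, ← ofReal_norm, Complex.norm_real,
      norm_of_nonneg ENNReal.toReal_nonneg, ENNReal.ofReal_toReal hIt]
    · exact ((hnm.pow_const _).indicator hEm).aemeasurable
    · refine .of_forall fun t => ?_
      by_cases ht : t ∈ E
      · rw [indicator_of_mem ht]
        exact (ENNReal.rpow_ne_top_of_nonneg (by linarith) (hnt t)).lt_top
      · rw [indicator_of_notMem ht]; exact ENNReal.zero_lt_top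
  rw [hpairing] at hmain
  by_cases hI0 : I = 0
  · rw [hI0]; exact zero_le
  have h5 : I ^ (1 / q) ≤ K := by
    have h6 : I = I ^ (1 / q) * I ^ (1 / (q / (q - 1))) := by
      rw [← ENNReal.rpow_add _ _ hI0 hIt]
      conv_lhs => rw [← ENNReal.rpow_one I]
      congr 1; field_simp; ring
    have h7 : I ^ (1 / (q / (q - 1))) ≠ 0 := by
      rw [ne_eq, ENNReal.rpow_eq_zero_iff]
      simp [hI0, hIt]
    have h8 : I ^ (1 / (q / (q - 1))) ≠ ∞ :=
      ENNReal.rpow_ne_top_of_ne_zero hI0 hIt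
    nth_rewrite 1 [h6] at hmain
    exact (ENNReal.mul_le_mul_iff_left h7 h8).1 hmain
  calc I = (I ^ (1 / q)) ^ q := by rw [← ENNReal.rpow_mul, one_div_mul_cancel (by linarith),
        ENNReal.rpow_one]
    _ ≤ K ^ q := ENNReal.rpow_le_rpow h5 (by linarith)

/-- Duality principle for `L^q_t L^r_x`. -/
theorem lintegral_rpow_le_of_pairing {q : ℝ} (hq : 2 < q) {u : ℝ → E3 → ℂ} {M : ℝ} {K : ℝ≥0∞}
    (hu : Measurable (Function.uncurry u)) (hM : ∀ t x, ‖u t x‖ ≤ M)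
    (hK : ∀ F B N, IsTest F B N → ‖∫ t, ∫ x, u t x * conj (F t x)‖ₑ ≤
      K * (∫⁻ t, ((∫⁻ x, ‖F t x‖ₑ ^ (2 * q / (q + 2))) ^ ((q + 2) / (2 * q))) ^ (q / (q - 1))) ^
            (1 / (q / (q - 1)))) :
    ∫⁻ t, (∫⁻ x, ‖u t x‖ₑ ^ (2 * q / (q - 2))) ^ ((q - 2) / 2) ≤ K ^ q := by
  set r := 2 * q / (q - 2) with hr
  have hq2 : 0 < (q - 2) / 2 := by linarith
  set n : ℕ → ℝ → ℝ≥0∞ := fun N t => ∫⁻ x in Metric.closedBall 0 ((N : ℝ) + 1), ‖u t x‖ₑ ^ r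
    with hn
  have hmeas : Measurable fun z : ℝ × E3 => ‖u z.1 z.2‖ₑ ^ r := hu.enorm.pow_const _
  have hnm : ∀ N, Measurable (n N) := fun N => hmeas.lintegral_prod_right'
  set f : ℕ → ℝ → ℝ≥0∞ := fun N t => {t | |t| ≤ (N : ℝ) + 1 ∧
    ENNReal.ofReal (1 / ((N : ℝ) + 1)) ≤ n N t}.indicator (fun t => (n N t) ^ ((q - 2) / 2)) t
    with hf
  have hfm : ∀ N, Measurable (f N) := fun N =>
    ((hnm N).pow_const _).indicator ((measurableSet_le measurable_norm measurable_const).inter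
      (measurableSet_le measurable_const (hnm N)))
  have hlim : ∀ t, Filter.Tendsto (fun N => f N t) Filter.atTop
      (nhds ((∫⁻ x, ‖u t x‖ₑ ^ r) ^ ((q - 2) / 2))) := by
    intro t
    have hum : Measurable fun x => ‖u t x‖ₑ ^ r := hmeas.comp measurable_prodMk_left
    have h1 : Filter.Tendsto (fun N => n N t) Filter.atTop (nhds (∫⁻ x, ‖u t x‖ₑ ^ r)) := by
      have h2 := tendsto_measure_iUnion_atTop
        (μ := volume.withDensity fun x => ‖u t x‖ₑ ^ r)
        (s := fun N : ℕ => Metric.closedBall (0 : E3) ((N : ℝ) + 1))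
        (fun a b hab => Metric.closedBall_subset_closedBall (by gcongr))
      have h3 : ⋃ N : ℕ, Metric.closedBall (0 : E3) ((N : ℝ) + 1) = univ := by
        rw [eq_univ_iff_forall]
        intro x
        obtain ⟨N, hN⟩ := exists_nat_ge ‖x‖
        exact mem_iUnion.2 ⟨N, by simp; linarith⟩
      rw [h3, withDensity_apply _ MeasurableSet.univ, Measure.restrict_univ] at h2
      refine h2.congr fun N => ?_
      exact withDensity_apply _ measurableSet_closedBall
    by_cases h0 : ∫⁻ x, ‖u t x‖ₑ ^ r = 0
    · have h4 : ∀ N, f N t = 0 := by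
        intro N
        have : n N t = 0 := le_antisymm ((setLIntegral_le_lintegral _ _).trans h0.le) zero_le
        simp only [hf, indicator_apply]
        split_ifs
        · rw [this, ENNReal.zero_rpow_of_pos hq2]
        · rfl
      rw [h0, ENNReal.zero_rpow_of_pos hq2]
      simp only [h4]
      exact tendsto_const_nhds
    · have h4 : ∀ᶠ N : ℕ in Filter.atTop, ENNReal.ofReal (1 / ((N : ℝ) + 1)) ≤ n N t := by
        have h5 : Filter.Tendsto (fun N : ℕ => ENNReal.ofReal (1 / ((N : ℝ) + 1)))
            Filter.atTop (nhds 0) := by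
          rw [← ENNReal.ofReal_zero]
          exact ENNReal.tendsto_ofReal tendsto_one_div_add_atTop_nhds_zero_nat
        exact (h5.eventually_lt h1 (pos_iff_ne_zero.2 h0 : (0 : ℝ≥0∞) < _)).mono fun N h => h.le
      have h6 : ∀ᶠ N : ℕ in Filter.atTop, |t| ≤ (N : ℝ) + 1 := by
        obtain ⟨N₀, hN₀⟩ := exists_nat_ge |t|
        filter_upwards [Filter.eventually_ge_atTop N₀] with N hN
        have : (N₀ : ℝ) ≤ N := by exact_mod_cast hN
        linarith
      refine (h1.ennrpow_const ((q - 2) / 2)).congr' ?_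
      filter_upwards [h4, h6] with N h h'
      simp only [hf]
      rw [indicator_of_mem (by exact ⟨h', h⟩)]
  calc ∫⁻ t, (∫⁻ x, ‖u t x‖ₑ ^ r) ^ ((q - 2) / 2)
      = ∫⁻ t, Filter.liminf (fun N => f N t) Filter.atTop := by
        congr 1; ext t; exact (hlim t).liminf_eq.symm
    _ ≤ Filter.liminf (fun N => ∫⁻ t, f N t) Filter.atTop := lintegral_liminf_le hfm
    _ ≤ K ^ q := by
        refine Filter.liminf_le_of_frequently_le' (Filter.Frequently.of_forall fun N => ?_)
        exact lintegral_trunc_le_of_pairing hq hu hM hK (by positivity)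

end Extremizer

/-- The abstract Strichartz estimate: a dispersive bound `A / |t|` for a frequency-localized
propagator gives the `L^q_t L^r_x` bound with `2/q + 2/r = 1`. -/
theorem strichartz_of_dispersive {q : ℝ} (hq : 2 < q) : ∃ C : ℝ, 0 < C ∧
    ∀ (Λ χ : E3 → ℝ) (A c₀ : ℝ) (g : E3 → ℂ), Measurable Λ →
      Integrable χ → (∀ ξ, 0 ≤ χ ξ ∧ χ ξ ≤ 1) → 0 < A → 0 < c₀ →
      (∀ t : ℝ, t ≠ 0 → ∀ x, ‖fourierDot
        (fun ξ => χ ξ * Complex.exp (Complex.I * (t * Λ ξ : ℝ))) x‖ ≤ A / |t|) →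
      Integrable g → Measurable g → MemLp g 2 → (∀ᵐ ξ, g ξ ≠ 0 → c₀ ≤ χ ξ) →
      (∫ t : ℝ, ((eLpNorm (fourierDot fun ξ => Complex.exp (Complex.I * (t * Λ ξ : ℝ)) * g ξ)
          (ENNReal.ofReal (2 * q / (q - 2))) volume).toReal) ^ q) ^ (1 / q) ≤
        C * A ^ (1 / q) * c₀ ^ (-(1 / 2) : ℝ) * √(∫ ξ, ‖g ξ‖ ^ 2) := by
  obtain ⟨C, hC, hpair⟩ := enorm_pairing_le hq
  refine ⟨C, hC, fun Λ χ A c₀ g hΛ hχ hχb hA hc₀ hdec hg hgm hg2 hgχ => ?_⟩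
  set u : ℝ → E3 → ℂ := fun t =>
    fourierDot fun ξ => Complex.exp (Complex.I * (t * Λ ξ : ℝ)) * g ξ with hu
  have hum : Measurable (Function.uncurry u) := by
    have : StronglyMeasurable fun z : (ℝ × E3) × E3 =>
        Complex.exp (Complex.I * (dot3 z.1.2 z.2 : ℝ)) *
          (Complex.exp (Complex.I * (z.1.1 * Λ z.2 : ℝ)) * g z.2) := by
      apply Measurable.stronglyMeasurable
      unfold dot3
      fun_prop
    exact this.integral_prod_right'.measurable
  have hM : ∀ t x, ‖u t x‖ ≤ ∫ ξ, ‖g ξ‖ := by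
    intro t x
    refine (norm_fourierDot_le _ _).trans_eq ?_
    congr 1; ext ξ
    rw [norm_mul, norm_exp_I_mul, one_mul]
  have hmain := lintegral_rpow_le_of_pairing hq hum hM (K := ENNReal.ofReal
    (C * A ^ (1 / q) * c₀ ^ (-(1 / 2) : ℝ)) * (∫⁻ ξ, ‖g ξ‖ₑ ^ 2) ^ (1 / 2 : ℝ))
    (fun F B N hF => hpair Λ χ A c₀ g F B N hΛ hχ hχb hA hc₀ hdec hg hgχ hF)
  have hq2 : 0 < q - 2 := by linarith
  have hL2 : (∫⁻ ξ, ‖g ξ‖ₑ ^ 2) ^ (1 / 2 : ℝ) = ENNReal.ofReal √(∫ ξ, ‖g ξ‖ ^ 2) := by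
    rw [sqrt_eq_rpow, ← ENNReal.ofReal_rpow_of_nonneg (integral_nonneg fun _ => by positivity)
      (by norm_num), ofReal_integral_eq_lintegral_ofReal]
    · congr 2; ext ξ
      rw [ENNReal.ofReal_pow (norm_nonneg _), ofReal_norm]
    · exact hg2.integrable_norm_pow (by norm_num)
    · exact .of_forall fun _ => by positivity
  rw [hL2, ← ENNReal.ofReal_mul (by positivity)] at hmain
  set R := C * A ^ (1 / q) * c₀ ^ (-(1 / 2) : ℝ) * √(∫ ξ, ‖g ξ‖ ^ 2) with hR
  have hR0 : 0 ≤ R := by positivity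
  have hnorm : ∀ t, ENNReal.ofReal ((eLpNorm (u t) (ENNReal.ofReal (2 * q / (q - 2)))
      volume).toReal ^ q) ≤ (∫⁻ x, ‖u t x‖ₑ ^ (2 * q / (q - 2))) ^ ((q - 2) / 2) := by
    intro t
    have hr0 : 0 < 2 * q / (q - 2) := by positivity
    rw [eLpNorm_eq_lintegral_rpow_enorm_toReal (by simpa using hr0) ENNReal.ofReal_ne_top,
      ENNReal.toReal_ofReal hr0.le, ← ENNReal.ofReal_rpow_of_nonneg ENNReal.toReal_nonneg
        (by linarith)]
    refine (ENNReal.rpow_le_rpow ENNReal.ofReal_toReal_le (by linarith)).trans_eq ?_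
    rw [← ENNReal.rpow_mul]
    congr 1; field_simp
  have hint : ∫ t : ℝ, ((eLpNorm (u t) (ENNReal.ofReal (2 * q / (q - 2))) volume).toReal) ^ q ≤
      R ^ q := by
    by_cases hi : Integrable fun t : ℝ =>
        ((eLpNorm (u t) (ENNReal.ofReal (2 * q / (q - 2))) volume).toReal) ^ q
    · rw [integral_eq_lintegral_of_nonneg_ae (.of_forall fun t => by positivity) hi.1]
      refine ENNReal.toReal_le_of_le_ofReal (by positivity) ?_
      rw [← ENNReal.ofReal_rpow_of_nonneg hR0 (by linarith)]
      exact (lintegral_mono hnorm).trans hmain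
    · rw [integral_undef hi]; positivity
  calc _ ≤ (R ^ q) ^ (1 / q) :=
        rpow_le_rpow (integral_nonneg fun t => by positivity) hint (by positivity)
    _ = R := by rw [← rpow_mul hR0, mul_one_div_cancel (by linarith), rpow_one]

section Coordinates

theorem lintegral_E3 {f : E3 → ℝ≥0∞} (hf : Measurable f) :
    ∫⁻ ξ, f ξ = ∫⁻ z : ℝ, ∫⁻ p : ℝ × ℝ, f !₂[p.1, p.2, z] := by
  have h1 := (EuclideanSpace.volume_preserving_symm_measurableEquiv_toLp (Fin 3)).symm
  have h2 := (volume_preserving_piFinSuccAbove (fun _ : Fin 3 => ℝ) 2).symm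
  have h3 := (volume_preserving_finTwoArrow ℝ).symm
  have hg : Measurable fun v => f ((MeasurableEquiv.toLp 2 (Fin 3 → ℝ)).symm.symm v) :=
    hf.comp (MeasurableEquiv.measurable _)
  have hg' : Measurable fun v => f ((MeasurableEquiv.toLp 2 (Fin 3 → ℝ)).symm.symm
      ((MeasurableEquiv.piFinSuccAbove (fun _ : Fin 3 => ℝ) 2).symm v)) :=
    hg.comp (MeasurableEquiv.measurable _)
  rw [← h1.lintegral_comp hf, ← h2.lintegral_comp hg, Measure.volume_eq_prod,
    lintegral_prod _ hg'.aemeasurable]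
  congr 1; ext z
  refine (h3.lintegral_comp (hg'.comp measurable_prodMk_left)).symm.trans ?_
  refine lintegral_congr fun p => congrArg f ?_
  ext i
  fin_cases i <;> rfl

/-- The substitution `ρ² = (s² - b²)(1 - z²/s²)` in the distance to the axis. -/
theorem lintegral_radial {b z : ℝ} (hb : 0 ≤ b) (hz : z ≠ 0) (f : ℝ → ℝ≥0∞) :
    ∫⁻ ρ in Ioi 0, ENNReal.ofReal ρ * f ρ =
      ∫⁻ s in Ioi (max b |z|), ENNReal.ofReal (s - b ^ 2 * z ^ 2 / s ^ 3) *
        f (√(s ^ 2 - b ^ 2) * √(1 - (z / s) ^ 2)) := by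
  set m := max b |z| with hm
  have hz0 : 0 < |z| := abs_pos.2 hz
  have hm0 : 0 < m := lt_max_of_lt_right hz0
  have hbm : b ≤ m := le_max_left _ _
  have hzm : |z| ≤ m := le_max_right _ _
  set H : ℝ → ℝ := fun s => (s ^ 2 - b ^ 2) * (1 - (z / s) ^ 2) with hH
  have hfac1 : ∀ s, m < s → 0 < s ^ 2 - b ^ 2 := fun s hs => by nlinarith
  have hfac2 : ∀ s, m < s → 0 < 1 - (z / s) ^ 2 := fun s hs => by
    have hs0 : 0 < s := hm0.trans hs
    rw [div_pow, sub_pos, div_lt_one (by positivity), ← sq_abs z]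
    nlinarith
  have hHpos : ∀ s, m < s → 0 < H s := fun s hs => mul_pos (hfac1 s hs) (hfac2 s hs)
  have hHd : ∀ s, m < s → HasDerivAt H (2 * (s - b ^ 2 * z ^ 2 / s ^ 3)) s := by
    intro s hs
    have hs0 : s ≠ 0 := (hm0.trans hs).ne'
    have h1 : HasDerivAt (fun s : ℝ => s ^ 2 - b ^ 2) (2 * s) s := by
      simpa using (hasDerivAt_pow 2 s).sub_const (b ^ 2)
    have h2 : HasDerivAt (fun s : ℝ => 1 - (z / s) ^ 2)
        (-(2 * (z / s) * (z * (-(s ^ 2)⁻¹)))) s := by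
      have h3 : HasDerivAt (fun s : ℝ => z / s) (z * (-(s ^ 2)⁻¹)) s := by
        simpa [div_eq_mul_inv] using (hasDerivAt_inv hs0).const_mul z
      simpa using (h3.pow 2).const_sub 1
    refine (h1.mul h2).congr_deriv ?_
    field_simp; ring
  have hJ : ∀ s, m < s → 0 < s - b ^ 2 * z ^ 2 / s ^ 3 := by
    intro s hs
    have hs0 : 0 < s := hm0.trans hs
    rw [sub_pos, div_lt_iff₀ (by positivity)]
    have h1 := hfac1 s hs
    have h2 : z ^ 2 ≤ s ^ 2 := by rw [← sq_abs z]; nlinarith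
    have h3 : 0 < z ^ 2 := by positivity
    calc b ^ 2 * z ^ 2 < s ^ 2 * z ^ 2 := by nlinarith
      _ ≤ s ^ 2 * s ^ 2 := by nlinarith
      _ = s * s ^ 3 := by ring
  have hmono : StrictMonoOn (fun s => √(H s)) (Ioi m) := by
    intro s hs t ht hst
    refine sqrt_lt_sqrt (hHpos s hs).le ?_
    have hs0 : 0 < s := hm0.trans hs
    have h1 : s ^ 2 - b ^ 2 < t ^ 2 - b ^ 2 := by nlinarith
    have h2 : 1 - (z / s) ^ 2 ≤ 1 - (z / t) ^ 2 := by
      rw [div_pow, div_pow]; gcongr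
    exact mul_lt_mul h1 h2 (hfac2 s hs) (hfac1 t ht).le
  have himage : (fun s => √(H s)) '' Ioi m = Ioi 0 := by
    ext ρ
    constructor
    · rintro ⟨s, hs, rfl⟩
      exact sqrt_pos.2 (hHpos s hs)
    · intro hρ
      have hρ0 : 0 < ρ := hρ
      have hHc : ContinuousOn H (Icc m (b + |z| + ρ)) := by
        have : ∀ s ∈ Icc m (b + |z| + ρ), s ≠ 0 := fun s hs => (hm0.trans_le hs.1).ne'
        simp only [hH]; fun_prop (disch := assumption)
      have hHm : H m = 0 := by
        rcases max_cases b |z| with h | h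
        · have : m = b := h.1
          simp [hH, this]
        · have : m = |z| := h.1
          simp [hH, this, div_pow, hz]
      have hHS : ρ ^ 2 ≤ H (b + |z| + ρ) := by
        have e1 : H (b + |z| + ρ) = (b + |z| + ρ) ^ 2 - b ^ 2 - z ^ 2 +
            b ^ 2 * z ^ 2 / (b + |z| + ρ) ^ 2 := by
          simp only [hH]; field_simp; ring
        have h4 : 0 ≤ b ^ 2 * z ^ 2 / (b + |z| + ρ) ^ 2 := by positivity
        rw [e1]
        nlinarith [sq_abs z, mul_nonneg hb hz0.le, mul_nonneg hb hρ0.le, mul_pos hz0 hρ0]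
      obtain ⟨s, hs, hsρ⟩ := intermediate_value_Icc (max_le (by linarith) (by linarith)) hHc
        (show ρ ^ 2 ∈ Icc (H m) (H (b + |z| + ρ)) from ⟨by rw [hHm]; positivity, hHS⟩)
      have hsm : s ≠ m := by
        rintro rfl
        rw [hHm] at hsρ
        exact hρ0.ne' (by simpa using hsρ.symm)
      exact ⟨s, lt_of_le_of_ne hs.1 hsm.symm, by simp only [hsρ]; exact sqrt_sq hρ0.le⟩
  have hd : ∀ s ∈ Ioi m, HasDerivWithinAt (fun s => √(H s))
      (2 * (s - b ^ 2 * z ^ 2 / s ^ 3) / (2 * √(H s))) (Ioi m) s := fun s hs =>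
    ((hHd s hs).sqrt (hHpos s hs).ne').hasDerivWithinAt
  rw [← himage, lintegral_image_eq_lintegral_abs_deriv_mul measurableSet_Ioi hd hmono.injOn]
  refine setLIntegral_congr_fun measurableSet_Ioi fun s hs => ?_
  have h1 : 0 < √(H s) := sqrt_pos.2 (hHpos s hs)
  have h2 := hJ s hs
  change _ * (ENNReal.ofReal √(H s) * f √(H s)) = _
  rw [← mul_assoc, ← ENNReal.ofReal_mul (abs_nonneg _), abs_of_pos (by positivity)]
  congr 2
  · field_simp
  · simp only [hH]; rw [sqrt_mul (hfac1 s hs).le]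

/-- The point of the unit sphere with height `w` and longitude `φ`. -/
def spherePt (w φ : ℝ) : E3 := !₂[√(1 - w ^ 2) * cos φ, √(1 - w ^ 2) * sin φ, w]

/-- The surface measure of the unit sphere of `ℝ³`, in Archimedes' coordinates. -/
def sph : Measure E3 := Measure.map (fun p : ℝ × ℝ => spherePt p.1 p.2)
  ((volume.restrict (Ioo (-1) 1)).prod (volume.restrict (Ioo (-π) π)))

/-- The spheroid with foci at distance `b` from the origin and semi-major axis `s`,
parametrized by the unit sphere. -/
def spheroid (b s : ℝ) (y : E3) : E3 := !₂[√(s ^ 2 - b ^ 2) * y 0, √(s ^ 2 - b ^ 2) * y 1, s * y 2]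

theorem continuous_spherePt : Continuous fun p : ℝ × ℝ => spherePt p.1 p.2 := by
  unfold spherePt
  refine (PiLp.continuous_toLp 2 _).comp (continuous_pi fun i => ?_)
  fin_cases i <;> simp <;> fun_prop

theorem continuous_spheroid (b : ℝ) : Continuous fun p : ℝ × E3 => spheroid b p.1 p.2 := by
  unfold spheroid
  refine (PiLp.continuous_toLp 2 _).comp (continuous_pi fun i => ?_)
  fin_cases i <;> simp <;> fun_prop

instance : IsFiniteMeasure sph := by unfold sph; infer_instance

theorem lintegral_sph {f : E3 → ℝ≥0∞} (hf : Measurable f) :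
    ∫⁻ y, f y ∂sph = ∫⁻ w in Ioo (-1) 1, ∫⁻ φ in Ioo (-π) π, f (spherePt w φ) := by
  have hm := continuous_spherePt.measurable
  rw [sph, lintegral_map hf hm]
  exact lintegral_prod _ (hf.comp hm).aemeasurable

theorem ae_sph_of_forall {p : E3 → Prop} (hp : MeasurableSet {y | p y})
    (h : ∀ w ∈ Ioo (-1 : ℝ) 1, ∀ φ, p (spherePt w φ)) : ∀ᵐ y ∂sph, p y := by
  rw [sph, ae_map_iff continuous_spherePt.measurable.aemeasurable hp, Measure.prod_restrict]
  exact ae_restrict_of_forall_mem (measurableSet_Ioo.prod measurableSet_Ioo)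
    fun z hz => h _ hz.1 _

theorem lintegral_spheroid {b : ℝ} (hb : 0 ≤ b) {f : E3 → ℝ≥0∞} (hf : Measurable f) :
    ∫⁻ ξ, f ξ = ∫⁻ s in Ioi b, ∫⁻ y, ENNReal.ofReal (s ^ 2 - b ^ 2 * y 2 ^ 2) *
      f (spheroid b s y) ∂sph := by
  have hc : Continuous fun v : ℝ × ℝ × ℝ => (!₂[v.2.1 * cos v.2.2, v.2.1 * sin v.2.2, v.1] : E3) := by
    refine (PiLp.continuous_toLp 2 _).comp (continuous_pi fun i => ?_)
    fin_cases i <;> simp <;> fun_prop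
  have hfm : Measurable fun v : ℝ × ℝ × ℝ =>
    f !₂[v.2.1 * cos v.2.2, v.2.1 * sin v.2.2, v.1] := hf.comp hc.measurable
  set F : ℝ → ℝ → ℝ≥0∞ := fun z ρ => ∫⁻ φ in Ioo (-π) π, f !₂[ρ * cos φ, ρ * sin φ, z] with hF
  have hFm : Measurable fun v : ℝ × ℝ => F v.1 v.2 := by
    have : Measurable fun v : (ℝ × ℝ) × ℝ =>
        f !₂[v.1.2 * cos v.2, v.1.2 * sin v.2, v.1.1] := 
      hfm.comp (show Measurable fun v : (ℝ × ℝ) × ℝ => (v.1.1, v.1.2, v.2) by fun_prop)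
    exact this.lintegral_prod_right'
  set G : ℝ → ℝ → ℝ≥0∞ := fun z s => ENNReal.ofReal (s - b ^ 2 * z ^ 2 / s ^ 3) *
        F z (√(s ^ 2 - b ^ 2) * √(1 - (z / s) ^ 2)) with hG
  have hGm : Measurable fun v : ℝ × ℝ => G v.1 v.2 := by
    refine Measurable.mul (by fun_prop) ?_
    exact hFm.comp (show Measurable fun v : ℝ × ℝ =>
      (v.1, √(v.2 ^ 2 - b ^ 2) * √(1 - (v.1 / v.2) ^ 2)) by fun_prop)
  set U : Set (ℝ × ℝ) := {v | max b |v.1| < v.2} with hU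
  have hUm : MeasurableSet U := measurableSet_lt (by fun_prop) (by fun_prop)
  have hstep : ∀ z : ℝ, z ≠ 0 → ∫⁻ p : ℝ × ℝ, f !₂[p.1, p.2, z] =
      ∫⁻ s, U.indicator (fun v => G v.1 v.2) (z, s) := by
    intro z hz
    rw [← lintegral_comp_polarCoord_symm]
    simp only [polarCoord_symm_apply, polarCoord_target, smul_eq_mul]
    rw [Measure.volume_eq_prod, ← Measure.prod_restrict, lintegral_prod]
    · calc _ = ∫⁻ ρ in Ioi 0, ENNReal.ofReal ρ * F z ρ := by
            congr 1; ext ρ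
            exact lintegral_const_mul' _ _ ENNReal.ofReal_ne_top
        _ = ∫⁻ s in Ioi (max b |z|), G z s := lintegral_radial hb hz _
        _ = _ := by
            rw [← lintegral_indicator measurableSet_Ioi]
            rfl
    · refine Measurable.aemeasurable (Measurable.mul (by fun_prop) ?_)
      exact hfm.comp measurable_prodMk_left
  have hne : ∀ᵐ z : ℝ, z ≠ 0 := by simp [ae_iff]
  rw [lintegral_E3 hf, lintegral_congr_ae (hne.mono fun z hz => hstep z hz),
    lintegral_lintegral_swap (f := fun z s => U.indicator (fun v => G v.1 v.2) (z, s))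
      (show AEMeasurable (U.indicator fun v => G v.1 v.2) _ from
        (hGm.indicator hUm).aemeasurable),
    ← lintegral_indicator measurableSet_Ioi]
  congr 1; ext s
  by_cases hs : s ∈ Ioi b
  · have hs0 : 0 < s := hb.trans_lt hs
    rw [indicator_of_mem hs, lintegral_sph]
    · have h1 : ∀ z, U.indicator (fun v => G v.1 v.2) (z, s) =
          ((fun w => s * w) '' Ioo (-1) 1).indicator (fun z => G z s) z := by
        intro z
        rw [image_mul_left_Ioo hs0]
        have : (z, s) ∈ U ↔ z ∈ Ioo (s * -1) (s * 1) := by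
          have hs' : b < s := hs
          simp [hU, hs', abs_lt]
        simp only [indicator_apply, this]
      simp only [h1]
      rw [lintegral_indicator (by rw [image_mul_left_Ioo hs0]; exact measurableSet_Ioo),
        lintegral_image_eq_lintegral_abs_deriv_mul measurableSet_Ioo
          (fun w _ => by simpa using ((hasDerivAt_id w).const_mul s).hasDerivWithinAt)
          (fun x _ y _ h => mul_left_cancel₀ hs0.ne' h)]
      refine setLIntegral_congr_fun measurableSet_Ioo fun w hw => ?_
      have e1 : (spherePt w 0) 2 = w := rfl
      calc _ = ENNReal.ofReal (s ^ 2 - b ^ 2 * w ^ 2) *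
            F (s * w) (√(s ^ 2 - b ^ 2) * √(1 - w ^ 2)) := by
            simp only [hG]
            rw [← mul_assoc, ← ENNReal.ofReal_mul (abs_nonneg _), abs_of_pos hs0]
            congr 2
            · field_simp
            · field_simp
        _ = ∫⁻ φ in Ioo (-π) π, ENNReal.ofReal (s ^ 2 - b ^ 2 * w ^ 2) *
            f !₂[√(s ^ 2 - b ^ 2) * √(1 - w ^ 2) * cos φ,
              √(s ^ 2 - b ^ 2) * √(1 - w ^ 2) * sin φ, s * w] := by
            rw [lintegral_const_mul' _ _ ENNReal.ofReal_ne_top]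
        _ = _ := by
            congr 1; ext φ
            simp [spheroid, spherePt, mul_assoc]
    · refine Measurable.mul (by fun_prop) (hf.comp ?_)
      exact (continuous_spheroid b).measurable.comp measurable_prodMk_left
  · rw [indicator_of_notMem hs]
    refine (lintegral_congr fun z => indicator_of_notMem (fun h => hs ?_) _).trans lintegral_zero
    exact (le_max_left b |z|).trans_lt h

end Coordinates

section SphereMeasure

theorem norm_sq_E3 (y : E3) : ‖y‖ ^ 2 = y 0 ^ 2 + y 1 ^ 2 + y 2 ^ 2 := by
  simp [EuclideanSpace.norm_sq_eq, Fin.sum_univ_three]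

theorem norm_spherePt {w : ℝ} (hw : w ∈ Ioo (-1 : ℝ) 1) (φ : ℝ) : ‖spherePt w φ‖ = 1 := by
  have h1 : 0 ≤ 1 - w ^ 2 := by nlinarith [hw.1, hw.2]
  have h2 : ‖spherePt w φ‖ ^ 2 = 1 := by
    rw [norm_sq_E3]
    simp only [spherePt, PiLp.toLp_apply, Matrix.cons_val]
    rw [mul_pow, mul_pow, sq_sqrt h1]
    linear_combination (1 - w ^ 2) * sin_sq_add_cos_sq φ
  nlinarith [norm_nonneg (spherePt w φ)]

theorem ae_sph_norm : ∀ᵐ y ∂sph, ‖y‖ = 1 :=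
  ae_sph_of_forall (measurableSet_eq_fun (by fun_prop) (by fun_prop))
    fun _ hw φ => norm_spherePt hw φ

theorem ae_sph_height : ∀ᵐ y ∂sph, y 2 ∈ Ioo (-1 : ℝ) 1 :=
  ae_sph_of_forall (measurableSet_Ioo.preimage (by fun_prop)) fun _ hw _ => hw

theorem spheroid_zero {s : ℝ} (hs : 0 < s) (y : E3) : spheroid 0 s y = s • y := by
  ext i
  fin_cases i <;> simp [spheroid, sqrt_sq hs.le]

theorem lintegral_radialExtension {f : E3 → ℝ≥0∞} (hf : Measurable f) :
    ∫⁻ ξ : E3, (Iio 1).indicator (fun _ => f (‖ξ‖⁻¹ • ξ)) ‖ξ‖ =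
      (∫⁻ s in Ioi 0, (Iio (1 : ℝ)).indicator (fun s => ENNReal.ofReal (s ^ 2)) s) *
        ∫⁻ y, f y ∂sph := by
  have hm : Measurable fun ξ : E3 => (Iio 1).indicator (fun _ => f (‖ξ‖⁻¹ • ξ)) ‖ξ‖ := by
    have : MeasurableSet ((fun ξ : E3 => ‖ξ‖) ⁻¹' Iio (1 : ℝ)) := measurableSet_Iio.preimage (by fun_prop)
    exact Measurable.indicator (hf.comp (by fun_prop)) this
  rw [lintegral_spheroid le_rfl hm, ← lintegral_mul_const _
    (Measurable.indicator (by fun_prop) measurableSet_Iio)]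
  refine setLIntegral_congr_fun measurableSet_Ioi fun s hs => ?_
  have hs0 : 0 < s := hs
  rw [← lintegral_const_mul _ hf]
  refine lintegral_congr_ae ?_
  filter_upwards [ae_sph_norm] with y hy
  have e1 : ‖s • y‖ = s := by rw [norm_smul, hy, mul_one, norm_of_nonneg hs0.le]
  rw [spheroid_zero hs0, e1, smul_smul, inv_mul_cancel₀ hs0.ne', one_smul]
  by_cases h : s < 1
  · simp [h]
  · simp [h]

theorem lintegral_sph_comp_isometry (e : E3 ≃ₗᵢ[ℝ] E3) {f : E3 → ℝ≥0∞} (hf : Measurable f) :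
    ∫⁻ y, f (e y) ∂sph = ∫⁻ y, f y ∂sph := by
  have h1 := lintegral_radialExtension hf
  have h2 := lintegral_radialExtension (f := fun y => f (e y))
    (hf.comp e.continuous.measurable)
  have hm : Measurable fun ξ : E3 => (Iio 1).indicator (fun _ => f (‖ξ‖⁻¹ • ξ)) ‖ξ‖ := by
    have : MeasurableSet ((fun ξ : E3 => ‖ξ‖) ⁻¹' Iio (1 : ℝ)) := measurableSet_Iio.preimage (by fun_prop)
    exact Measurable.indicator (hf.comp (by fun_prop)) this
  have h3 := e.measurePreserving.lintegral_comp hm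
  simp only [e.norm_map] at h3
  simp only [map_smul] at h2
  rw [h2, h1] at h3
  have e1 : (∫⁻ s in Ioi 0, (Iio (1 : ℝ)).indicator (fun s => ENNReal.ofReal (s ^ 2)) s) =
      ∫⁻ s in Ioo (0 : ℝ) 1, ENNReal.ofReal (s ^ 2) := by
    rw [← lintegral_indicator measurableSet_Ioi, ← lintegral_indicator measurableSet_Ioo]
    congr 1; ext s
    by_cases h : 0 < s <;> by_cases h' : s < 1 <;> simp [indicator, h, h']
  refine (ENNReal.mul_right_inj ?_ ?_).1 h3
  · rw [e1]
    refine (setLIntegral_pos_iff (by fun_prop)).2 ?_ |>.ne'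
    refine lt_of_lt_of_le (b := volume (Ioo (0 : ℝ) 1)) (by simp) (measure_mono fun s hs => ⟨?_, hs⟩)
    have : 0 < s := hs.1
    simp [this.ne']
  · rw [e1]
    refine ne_top_of_le_ne_top (b := ∫⁻ s in Ioo (0 : ℝ) 1, 1) (by simp) ?_
    refine setLIntegral_mono measurable_const fun s hs => ?_
    rw [ENNReal.ofReal_le_one]
    nlinarith [hs.1, hs.2]

theorem measurePreserving_sph (e : E3 ≃ₗᵢ[ℝ] E3) : MeasurePreserving e sph sph := by
  refine ⟨e.continuous.measurable, Measure.ext fun A hA => ?_⟩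
  rw [Measure.map_apply e.continuous.measurable hA]
  have := lintegral_sph_comp_isometry e (f := A.indicator 1) (measurable_one.indicator hA)
  rw [lintegral_indicator_one hA] at this
  rw [← this, ← lintegral_indicator_one (hA.preimage e.continuous.measurable)]
  rfl

theorem integral_sph_comp_isometry (e : E3 ≃ₗᵢ[ℝ] E3) (f : E3 → ℂ) :
    ∫ y, f (e y) ∂sph = ∫ y, f y ∂sph :=
  (measurePreserving_sph e).integral_comp e.toHomeomorph.measurableEmbedding f

theorem exists_isometry_dot3 (V : E3) :
    ∃ e : E3 ≃ₗᵢ[ℝ] E3, ∀ y, dot3 V (e y) = ‖V‖ * y 2 := by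
  set n : E3 := !₂[0, 0, 1]
  have hn : ‖‖V‖ • n‖ = ‖V‖ := by
    have : ‖n‖ ^ 2 = 1 := by rw [norm_sq_E3]; simp [n]
    have : ‖n‖ = 1 := by nlinarith [norm_nonneg n]
    rw [norm_smul, this]; simp
  refine ⟨(ℝ ∙ (‖V‖ • n - V))ᗮ.reflection, fun y => ?_⟩
  have h := LinearIsometryEquiv.inner_map_map (ℝ ∙ (‖V‖ • n - V))ᗮ.reflection y (‖V‖ • n)
  rw [Submodule.reflection_sub hn] at h
  rw [dot3_eq_inner, h, ← dot3_eq_inner]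
  simp [dot3, n]

theorem integral_sph {f : E3 → ℂ} (hf : Integrable f sph) :
    ∫ y, f y ∂sph = ∫ w in Ioo (-1) 1, ∫ φ in Ioo (-π) π, f (spherePt w φ) := by
  have hm := continuous_spherePt.measurable
  rw [sph, integral_map hm.aemeasurable (by simpa [sph] using hf.1)]
  refine integral_prod (fun p : ℝ × ℝ => f (spherePt p.1 p.2)) ?_
  rw [sph, integrable_map_measure (by simpa [sph] using hf.1) hm.aemeasurable] at hf
  exact hf

theorem continuous_dot3 (V : E3) : Continuous (dot3 V) := by
  unfold dot3; fun_prop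

theorem integral_exp_dot3_sph (V : E3) :
    ∫ y, Complex.exp (Complex.I * (dot3 V y : ℝ)) ∂sph = 4 * π * sinc ‖V‖ := by
  obtain ⟨e, he⟩ := exists_isometry_dot3 V
  rw [← integral_sph_comp_isometry e]
  simp only [he]
  rw [integral_sph]
  · simp only [spherePt, PiLp.toLp_apply, Matrix.cons_val]
    simp only [integral_const, measureReal_restrict_apply_univ]
    have h1 : (volume : Measure ℝ).real (Ioo (-π) π) = 2 * π := by
      rw [measureReal_def, Real.volume_Ioo, ENNReal.toReal_ofReal] <;> linarith [pi_pos]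
    rw [h1, integral_smul, ← integral_Ioc_eq_integral_Ioo,
      ← intervalIntegral.integral_of_le (by norm_num)]
    by_cases hV : ‖V‖ = 0
    · simp [hV]; ring
    · have h2 := integral_exp_mul_I_eq_sinc ‖V‖
      have h3 := intervalIntegral.integral_comp_mul_left
        (fun x : ℝ => Complex.exp (x * Complex.I)) hV (a := -1) (b := 1)
      simp only [mul_neg, mul_one, h2] at h3
      have h4 : ∀ w : ℝ, Complex.exp (Complex.I * ((‖V‖ * w : ℝ) : ℂ)) =
          Complex.exp (((‖V‖ * w : ℝ) : ℂ) * Complex.I) := fun w => by rw [mul_comm]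
      simp only [h4]
      rw [h3]
      have : (‖V‖ : ℂ) ≠ 0 := by exact_mod_cast hV
      simp only [Complex.real_smul]
      push_cast
      field_simp
      ring
  · refine Integrable.of_bound (by fun_prop) 1 (ae_of_all _ fun y => ?_)
    rw [norm_exp_I_mul]

end SphereMeasure

section Oscillation

theorem norm_setIntegral_ordConnected_le {f : ℝ → ℂ} {S : Set ℝ} {M : ℝ} (hS : S.OrdConnected)
    (hvol : volume S ≠ ∞)
    (hf : ∀ a b, a ≤ b → Ioo a b ⊆ S → ‖∫ s in Ioo a b, f s‖ ≤ M) :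
    ‖∫ s in S, f s‖ ≤ M := by
  rcases S.eq_empty_or_nonempty with rfl | ⟨z, hz⟩
  · simpa using hf 0 0 le_rfl (by simp)
  have hA : BddAbove S := by
    by_contra h
    refine hvol (top_le_iff.1 ?_)
    rw [← Real.volume_Ici (a := z)]
    refine measure_mono fun s hs => ?_
    obtain ⟨y, hy, hsy⟩ := not_bddAbove_iff.1 h s
    exact hS.out hz hy ⟨hs, hsy.le⟩
  have hB : BddBelow S := by
    by_contra h
    refine hvol (top_le_iff.1 ?_)
    rw [← Real.volume_Iic (a := z)]
    refine measure_mono fun s hs => ?_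
    obtain ⟨y, hy, hsy⟩ := not_bddBelow_iff.1 h s
    exact hS.out hy hz ⟨hsy.le, hs⟩
  have h1 : Ioo (sInf S) (sSup S) ⊆ S := fun s hs => by
    obtain ⟨y, hy, hys⟩ := exists_lt_of_csInf_lt ⟨z, hz⟩ hs.1
    obtain ⟨y', hy', hys'⟩ := exists_lt_of_lt_csSup ⟨z, hz⟩ hs.2
    exact hS.out hy hy' ⟨hys.le, hys'.le⟩
  have h2 : S ⊆ Icc (sInf S) (sSup S) := fun s hs => ⟨csInf_le hB hs, le_csSup hA hs⟩
  have h3 : S =ᵐ[volume] Ioo (sInf S) (sSup S) :=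
    (h2.eventuallyLE.trans Ioo_ae_eq_Icc.symm.le).antisymm h1.eventuallyLE
  rw [setIntegral_congr_set h3]
  exact hf _ _ (h2 hz |>.1.trans (h2 hz).2) h1

/-- The integral of an amplitude with interval superlevel sets against a function with bounded
integrals over intervals. -/
theorem norm_integral_mul_le_of_superlevel {f : ℝ → ℂ} {A : ℝ → ℝ} {T : Set ℝ} {K M : ℝ}
    (hT : MeasurableSet T) (hK : 0 ≤ K) (hfm : Measurable f) (hf1 : ∀ s, ‖f s‖ ≤ 1)
    (hAm : Measurable A) (hA : IntegrableOn A T) (hA0 : ∀ s ∈ T, 0 ≤ A s)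
    (hAK : ∀ s ∈ T, A s ≤ K) (hlev : ∀ l, 0 < l → {s ∈ T | l < A s}.OrdConnected)
    (hf : ∀ a b, a ≤ b → Ioo a b ⊆ T → ‖∫ s in Ioo a b, f s‖ ≤ M) :
    ‖∫ s in T, (A s : ℂ) * f s‖ ≤ K * M := by
  set G : ℝ × ℝ → ℂ := {p : ℝ × ℝ | p.2 < A p.1}.indicator fun p => f p.1 with hG
  have hset : MeasurableSet {p : ℝ × ℝ | p.2 < A p.1} :=
    measurableSet_lt measurable_snd (hAm.comp measurable_fst)
  have hGm : Measurable G := (hfm.comp measurable_fst).indicator hset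
  have hslice : ∀ s ∈ T, ∀ F : ℝ → ℂ, (F = fun l => G (s, l)) →
      F = (Iio (A s)).indicator fun _ => f s := by
    rintro s hs F rfl
    ext l
    simp [hG, indicator]
  have hinter : ∀ s ∈ T, Iio (A s) ∩ Ioo 0 K = Ioo 0 (A s) := fun s hs => by
    ext l; constructor
    · rintro ⟨h1, h2⟩; exact ⟨h2.1, h1⟩
    · rintro ⟨h1, h2⟩; exact ⟨h2, h1, lt_of_lt_of_le h2 (hAK s hs)⟩
  have hGi : Integrable G ((volume.restrict T).prod (volume.restrict (Ioo 0 K))) := by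
    rw [integrable_prod_iff hGm.aestronglyMeasurable]
    constructor
    · refine ae_of_all _ fun s => ?_
      refine Integrable.of_bound (hGm.comp measurable_prodMk_left).aestronglyMeasurable 1
        (ae_of_all _ fun l => ?_)
      simp only [hG, indicator]; split_ifs
      · exact hf1 s
      · simp
    · refine Integrable.mono' hA hGm.norm.stronglyMeasurable.integral_prod_right'.aestronglyMeasurable ?_
      refine (ae_restrict_iff' hT).2 (ae_of_all _ fun s hs => ?_)
      have e : ∀ l, ‖G (s, l)‖ = (Iio (A s)).indicator (fun _ => ‖f s‖) l := fun l => by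
        rw [congrFun (hslice s hs _ rfl) l, norm_indicator_eq_indicator_norm]
      simp only [e]
      rw [integral_indicator measurableSet_Iio, Measure.restrict_restrict measurableSet_Iio,
        hinter s hs, setIntegral_const, smul_eq_mul, measureReal_def, Real.volume_Ioo, sub_zero,
        ENNReal.toReal_ofReal (hA0 s hs), norm_mul, norm_norm, norm_of_nonneg (hA0 s hs)]
      exact mul_le_of_le_one_right (hA0 s hs) (hf1 s)
  have h1 : ∫ s in T, (A s : ℂ) * f s = ∫ s in T, ∫ l in Ioo 0 K, G (s, l) := by
    refine setIntegral_congr_fun hT fun s hs => ?_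
    rw [hslice s hs _ rfl, integral_indicator measurableSet_Iio,
      Measure.restrict_restrict measurableSet_Iio,
      hinter s hs, setIntegral_const, measureReal_def, Real.volume_Ioo, sub_zero,
      ENNReal.toReal_ofReal (hA0 s hs), Complex.real_smul]
  rw [h1, integral_integral_swap (f := fun s l => G (s, l)) hGi]
  refine (norm_setIntegral_le_of_norm_le_const (C := M) (by simp) fun l hl => ?_).trans_eq ?_
  · have e : (fun s => G (s, l)) = {s | l < A s}.indicator f := by
      ext s; simp [hG, indicator]
    rw [e, integral_indicator (measurableSet_lt measurable_const hAm),
      Measure.restrict_restrict (measurableSet_lt measurable_const hAm)]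
    have e2 : {s | l < A s} ∩ T = {s ∈ T | l < A s} := by ext s; exact and_comm
    rw [e2]
    refine norm_setIntegral_ordConnected_le (hlev l hl.1) ?_ fun a b hab h =>
      hf a b hab (h.trans (sep_subset _ _))
    have := hA.measure_gt_lt_top hl.1
    rw [Measure.restrict_apply (measurableSet_lt measurable_const hAm)] at this
    rw [← e2]; exact this.ne
  · rw [measureReal_def, Real.volume_Ioo, sub_zero, ENNReal.toReal_ofReal hK, mul_comm]

theorem norm_setIntegral_Ioo_exp_le {R : ℝ} (hR : R ≠ 0) {a b : ℝ} (hab : a ≤ b) :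
    ‖∫ s in Ioo a b, Complex.exp (Complex.I * (R * s : ℝ))‖ ≤ 2 / |R| := by
  rw [← integral_Ioc_eq_integral_Ioo, ← intervalIntegral.integral_of_le hab]
  have hc : Complex.I * R ≠ 0 := mul_ne_zero Complex.I_ne_zero (by exact_mod_cast hR)
  have := integral_exp_mul_complex (a := a) (b := b) hc
  simp only [Complex.ofReal_mul, ← mul_assoc]
  rw [this, norm_div, norm_mul, Complex.norm_I, one_mul, Complex.norm_real, norm_eq_abs]
  gcongr
  refine (norm_sub_le _ _).trans ?_
  have h : ∀ s : ℝ, ‖Complex.exp (Complex.I * R * s)‖ = 1 := fun s => by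
    rw [mul_assoc, ← Complex.ofReal_mul, norm_exp_I_mul]
  rw [h, h]; norm_num

end Oscillation

section SincIntegrals

theorem abs_integral_sinc_le_of_far {X p m a b : ℝ} (hX : 0 < X) (hab : a ≤ b)
    (hQ : ∀ s ∈ Ioo a b, 0 ≤ X ^ 2 * (s - p) ^ 2 + m) (hp : ∀ s ∈ Icc a b, 1 / X ≤ |s - p|) :
    |∫ s in a..b, sinc √(X ^ 2 * (s - p) ^ 2 + m)| ≤ 4 / X := by
  set Q : ℝ → ℝ := fun s => X ^ 2 * (s - p) ^ 2 + m with hQd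
  have hX1 : 0 < 1 / X := by positivity
  have hne : ∀ s ∈ Icc a b, s - p ≠ 0 := fun s hs h => by
    have := hp s hs; rw [h, abs_zero] at this; linarith
  have hinv : ∀ s ∈ Icc a b, |(s - p)⁻¹| ≤ X := fun s hs => by
    rw [abs_inv]; exact inv_le_of_inv_le₀ hX (by simpa using hp s hs)
  have huIcc : uIcc a b = Icc a b := uIcc_of_le hab
  have hci : ContinuousOn (fun s => (s - p)⁻¹) (Icc a b) :=
    ContinuousOn.inv₀ (by fun_prop) hne
  have hcos : Continuous fun s => cos √(Q s) := by fun_prop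
  have hsinc : Continuous fun s => sinc √(Q s) := continuous_sinc.comp (by fun_prop)
  have hcd : ContinuousOn (fun s => cos √(Q s) * ((s - p)⁻¹) ^ 2) (Icc a b) :=
    hcos.continuousOn.mul (hci.pow 2)
  have hi1 : IntervalIntegrable (fun s => X ^ 2 * sinc √(Q s)) volume a b :=
    (hsinc.const_mul _).intervalIntegrable _ _
  have hi2 : IntervalIntegrable (fun s => cos √(Q s) * ((s - p)⁻¹) ^ 2) volume a b :=
    (huIcc ▸ hcd).intervalIntegrable
  have hcount : {s | Q s = 0}.Countable := by
    have : {s | Q s = 0} ⊆ {p + √(-m / X ^ 2), p - √(-m / X ^ 2)} := by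
      intro s hs
      have h1 : (s - p) ^ 2 = -m / X ^ 2 := by
        have : X ^ 2 * (s - p) ^ 2 + m = 0 := hs
        field_simp; linarith
      have h2 : √(-m / X ^ 2) = |s - p| := by rw [← h1, sqrt_sq_eq_abs]
      rw [h2]
      rcases abs_cases (s - p) with h | h
      · left; rw [h.1]; ring
      · right; simp only [mem_singleton_iff]; rw [h.1]; ring
    exact (Set.toFinite _).countable.mono this
  have hF := MeasureTheory.integral_eq_of_hasDerivAt_off_countable
    (fun s => cos √(Q s) * (s - p)⁻¹)
    (fun s => -(X ^ 2 * sinc √(Q s)) - cos √(Q s) * ((s - p)⁻¹) ^ 2)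
    (a := a) (b := b) hcount
    (huIcc ▸ hcos.continuousOn.mul hci) (fun s hs => by
      rw [min_eq_left hab, max_eq_right hab] at hs
      have hs' : s - p ≠ 0 := hne s (Ioo_subset_Icc_self hs.1)
      have hQs : 0 < Q s := lt_of_le_of_ne (hQ s hs.1) (Ne.symm hs.2)
      have h1 : HasDerivAt Q (X ^ 2 * (2 * (s - p))) s :=
        (((((hasDerivAt_id s).sub_const p).pow 2).const_mul (X ^ 2)).add_const m).congr_deriv
          (by simp)
      have h2 := (h1.sqrt hQs.ne').cos.mul (((hasDerivAt_id s).sub_const p).inv hs')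
      refine h2.congr_deriv ?_
      have h3 : √(Q s) ≠ 0 := (sqrt_pos.2 hQs).ne'
      rw [sinc_of_ne_zero h3]
      simp only [id, Pi.inv_apply]
      field_simp
      ring) (hi1.neg.sub hi2)
  have hG : ∫ s in a..b, ((s - p)⁻¹) ^ 2 = (a - p)⁻¹ - (b - p)⁻¹ := by
    rw [intervalIntegral.integral_eq_sub_of_hasDerivAt (f := fun s => -(s - p)⁻¹)]
    · ring
    · intro s hs
      rw [huIcc] at hs
      refine (((hasDerivAt_id s).sub_const p).inv (hne s hs)).neg.congr_deriv ?_
      have := hne s hs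
      simp only [id]
      field_simp
    · exact (huIcc ▸ hci.pow 2).intervalIntegrable
  have hb2 : |∫ s in a..b, cos √(Q s) * ((s - p)⁻¹) ^ 2| ≤ (a - p)⁻¹ - (b - p)⁻¹ := by
    rw [← hG, ← norm_eq_abs]
    refine intervalIntegral.norm_integral_le_of_norm_le hab (ae_of_all _ fun s _ => ?_)
      (huIcc ▸ hci.pow 2).intervalIntegrable
    rw [norm_mul, norm_pow, norm_eq_abs, norm_eq_abs, sq_abs]
    exact mul_le_of_le_one_left (sq_nonneg _) (abs_cos_le_one _)
  rw [intervalIntegral.integral_sub (f := fun s => -(X ^ 2 * sinc √(Q s))) hi1.neg hi2,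
    intervalIntegral.integral_neg,
    intervalIntegral.integral_const_mul] at hF
  have hga : ∀ s ∈ Icc a b, |cos √(Q s) * (s - p)⁻¹| ≤ X := fun s hs => by
    rw [abs_mul]
    exact (mul_le_of_le_one_left (abs_nonneg _) (abs_cos_le_one _)).trans (hinv s hs)
  have ha := left_mem_Icc.2 hab
  have hb := right_mem_Icc.2 hab
  have k1 := abs_le.1 (hga a ha)
  have k2 := abs_le.1 (hga b hb)
  have k3 := abs_le.1 (hinv a ha)
  have k4 := abs_le.1 (hinv b hb)
  have k5 := abs_le.1 hb2
  have : |X ^ 2 * ∫ s in a..b, sinc √(Q s)| ≤ 4 * X := by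
    rw [abs_le]; constructor <;> linarith
  rw [abs_mul, abs_of_pos (by positivity)] at this
  rw [le_div_iff₀ hX]
  nlinarith

theorem abs_integral_sinc_le {X p m a b : ℝ} (hX : 0 < X) (hab : a ≤ b)
    (hQ : ∀ s ∈ Ioo a b, 0 ≤ X ^ 2 * (s - p) ^ 2 + m) :
    |∫ s in a..b, sinc √(X ^ 2 * (s - p) ^ 2 + m)| ≤ 10 / X := by
  have hX1 : 0 < 1 / X := by positivity
  have hX4 : 0 < 4 / X := by positivity
  set c₁ := max a (min b (p - 1 / X)) with hc1
  set c₂ := max a (min b (p + 1 / X)) with hc2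
  have h1 : a ≤ c₁ := le_max_left _ _
  have h2 : c₁ ≤ c₂ := max_le_max le_rfl (min_le_min le_rfl (by linarith))
  have h3 : c₂ ≤ b := max_le hab (min_le_left _ _)
  have hsinc : Continuous fun s => sinc √(X ^ 2 * (s - p) ^ 2 + m) :=
    continuous_sinc.comp (by fun_prop)
  have hi := fun u v => hsinc.intervalIntegrable (μ := volume) u v
  rw [← intervalIntegral.integral_add_adjacent_intervals (hi a c₁) (hi c₁ b),
    ← intervalIntegral.integral_add_adjacent_intervals (hi c₁ c₂) (hi c₂ b)]
  have e1 : |∫ s in a..c₁, sinc √(X ^ 2 * (s - p) ^ 2 + m)| ≤ 4 / X := by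
    rcases h1.eq_or_lt with h | h
    · rw [← h]; simp [hX4.le]
    · have h5 : c₁ ≤ p - 1 / X := by
        rcases lt_max_iff.1 h with h' | h'
        · exact absurd h' (lt_irrefl _)
        · rw [hc1, max_eq_right h'.le]; exact min_le_right _ _
      refine abs_integral_sinc_le_of_far hX h1 (fun s hs => hQ s ⟨hs.1, hs.2.trans_le (h2.trans h3)⟩)
        fun s hs => ?_
      rw [abs_of_nonpos (by linarith [hs.2])]; linarith [hs.2]
  have e3 : |∫ s in c₂..b, sinc √(X ^ 2 * (s - p) ^ 2 + m)| ≤ 4 / X := by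
    rcases h3.eq_or_lt with h | h
    · rw [h]; simp [hX4.le]
    · have h5 : p + 1 / X ≤ c₂ := by
        rcases min_lt_iff.1 ((le_max_right _ _).trans_lt h) with h' | h'
        · exact absurd h' (lt_irrefl _)
        · rw [hc2, min_eq_right h'.le]; exact le_max_right _ _
      refine abs_integral_sinc_le_of_far hX h3 (fun s hs => hQ s ⟨(h1.trans h2).trans_lt hs.1, hs.2⟩)
        fun s hs => ?_
      rw [abs_of_nonneg (by linarith [hs.1])]; linarith [hs.1]
  have e2 : |∫ s in c₁..c₂, sinc √(X ^ 2 * (s - p) ^ 2 + m)| ≤ 2 / X := by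
    have hlen : c₂ - c₁ ≤ 2 / X := by
      have : min b (p + 1 / X) ≤ min b (p - 1 / X) + 2 / X := by
        rcases min_cases b (p - 1 / X) with h | h
        · rw [h.1]; exact (min_le_left _ _).trans (by linarith [show 0 < 2 / X by positivity])
        · rw [h.1]; refine (min_le_right _ _).trans_eq ?_; ring
      have h6 : c₂ ≤ c₁ + 2 / X := max_le (by linarith [show 0 < 2 / X by positivity])
        (this.trans (by gcongr; exact le_max_right _ _))
      linarith
    have := intervalIntegral.norm_integral_le_of_norm_le_const (a := c₁) (b := c₂) (C := 1)
      (f := fun s => sinc √(X ^ 2 * (s - p) ^ 2 + m)) fun s _ => abs_sinc_le_one _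
    rw [one_mul, abs_of_nonneg (by linarith)] at this
    exact this.trans hlen
  calc _ ≤ 4 / X + (2 / X + 4 / X) :=
        (abs_add_le _ _).trans (add_le_add e1 ((abs_add_le _ _).trans (add_le_add e2 e3)))
    _ = 10 / X := by ring

theorem integrableOn_exp_decay {δ : ℝ} (hδ : 0 < δ) (a : ℝ) :
    IntegrableOn (fun s => rexp (-δ * (s - 1))) (Ioi a) := by
  have := (integrableOn_exp_mul_Ioi (neg_lt_zero.2 hδ) a).mul_const (rexp δ)
  refine this.congr (ae_of_all _ fun s => ?_)
  simp only [← exp_add]; congr 1; ring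

theorem integral_exp_decay {δ : ℝ} (hδ : 0 < δ) :
    ∫ s in Ioi 1, rexp (-δ * (s - 1)) = 1 / δ := by
  have h : ∀ s, rexp (-δ * (s - 1)) = rexp (-δ * s) * rexp δ := fun s => by
    rw [← exp_add]; congr 1; ring
  simp only [h]
  rw [integral_mul_const, integral_exp_mul_Ioi (neg_lt_zero.2 hδ)]
  rw [div_mul_eq_mul_div, neg_mul, ← exp_add]; simp

theorem norm_integral_exp_sinc_tail_le {δ h z t : ℝ} (hδ : 0 < δ) (hX : 0 < h ^ 2 + z ^ 2)
    {s₀ : ℝ} (hs₀ : 1 ≤ s₀) :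
    ‖∫ s in Ioi s₀, ((rexp (-δ * (s - 1)) : ℝ) : ℂ) *
      (sinc √(h ^ 2 * (s ^ 2 - 1) + (t + z * s) ^ 2) : ℂ)‖ ≤
      rexp (-δ * (s₀ - 1)) * (10 / √(h ^ 2 + z ^ 2)) := by
  have hX' : 0 < √(h ^ 2 + z ^ 2) := sqrt_pos.2 hX
  set X := √(h ^ 2 + z ^ 2) with hXd
  have hX2 : X ^ 2 = h ^ 2 + z ^ 2 := sq_sqrt hX.le
  have hP : ∀ s, h ^ 2 * (s ^ 2 - 1) + (t + z * s) ^ 2 =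
      X ^ 2 * (s - -(t * z / X ^ 2)) ^ 2 + (t ^ 2 - h ^ 2 - t ^ 2 * z ^ 2 / X ^ 2) := fun s => by
    have : z ^ 2 = X ^ 2 - h ^ 2 := by linarith
    field_simp
    linear_combination (-X ^ 2 * s ^ 2) * hX2
  refine norm_integral_mul_le_of_superlevel measurableSet_Ioi (exp_pos _).le
    ?_ (fun s => ?_) (by fun_prop) (integrableOn_exp_decay hδ _) (fun _ _ => (exp_pos _).le)
    (fun s hs => ?_) (fun l _ => ?_) (fun a b hab hsub => ?_)
  · exact Complex.measurable_ofReal.comp (measurable_sinc.comp (by fun_prop))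
  · rw [Complex.norm_real]; exact abs_sinc_le_one _
  · have : s₀ < s := hs
    exact exp_le_exp.2 (by nlinarith)
  · refine ⟨fun u hu v hv w hw => ⟨lt_of_lt_of_le hu.1 hw.1, hv.2.trans_le ?_⟩⟩
    exact exp_le_exp.2 (by nlinarith [hw.2])
  · rw [integral_complex_ofReal, Complex.norm_real, norm_eq_abs, ← integral_Ioc_eq_integral_Ioo,
      ← intervalIntegral.integral_of_le hab]
    simp only [hP]
    refine abs_integral_sinc_le hX' hab fun s hs => ?_
    rw [← hP]
    have : s₀ < s := hsub hs
    have : 0 ≤ s ^ 2 - 1 := by nlinarith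
    positivity

/-- The radial integral of the kernel of the inertial waves. -/
theorem norm_integral_exp_sinc_le {δ h z t : ℝ} (hδ : 0 < δ) (hδ2 : δ ≤ 2) (ht : t ≠ 0) :
    ‖∫ s in Ioi 1, ((rexp (-δ * (s - 1)) : ℝ) : ℂ) *
      (sinc √(h ^ 2 * (s ^ 2 - 1) + (t + z * s) ^ 2) : ℂ)‖ ≤ 200 / (δ * |t|) := by
  have ht' : 0 < |t| := abs_pos.2 ht
  set F : ℝ → ℂ := fun s => ((rexp (-δ * (s - 1)) : ℝ) : ℂ) *
      (sinc √(h ^ 2 * (s ^ 2 - 1) + (t + z * s) ^ 2) : ℂ) with hF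
  have hFm : Measurable F := by
    refine Measurable.mul (by fun_prop) ?_
    exact Complex.measurable_ofReal.comp (measurable_sinc.comp (by fun_prop))
  have hFi : IntegrableOn F (Ioi 1) := by
    refine (integrableOn_exp_decay hδ 1).mono' hFm.aestronglyMeasurable (ae_of_all _ fun s => ?_)
    rw [hF, norm_mul, Complex.norm_real, Complex.norm_real, norm_of_nonneg (exp_pos _).le]
    exact mul_le_of_le_one_right (exp_pos _).le (abs_sinc_le_one _)
  set X := √(h ^ 2 + z ^ 2) with hXd
  have hX0 : 0 ≤ X := sqrt_nonneg _
  have hzX : |z| ≤ X := by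
    rw [← sqrt_sq_eq_abs]; exact sqrt_le_sqrt (by nlinarith [sq_nonneg h])
  -- the part where the phase is nearly constant
  have hnear : ∀ s, 1 < s → X * s ≤ |t| / 2 → ‖F s‖ ≤ 2 / |t| * rexp (-δ * (s - 1)) := by
    intro s hs hXs
    rw [hF, norm_mul, Complex.norm_real, Complex.norm_real, norm_of_nonneg (exp_pos _).le, mul_comm]
    gcongr
    have h1 : |t| / 2 ≤ √(h ^ 2 * (s ^ 2 - 1) + (t + z * s) ^ 2) := by
      refine le_sqrt_of_sq_le ?_
      have h2 : |t| / 2 ≤ |t + z * s| := by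
        have := abs_sub_abs_le_abs_sub t (-(z * s))
        rw [abs_neg, abs_mul, abs_of_pos (by linarith : (0:ℝ) < s), sub_neg_eq_add] at this
        nlinarith
      have h3 : (|t| / 2) ^ 2 ≤ (t + z * s) ^ 2 := by rw [← sq_abs (t + z * s)]; gcongr
      have : 0 ≤ s ^ 2 - 1 := by nlinarith
      nlinarith [mul_nonneg (sq_nonneg h) this]
    have h4 : 0 < √(h ^ 2 * (s ^ 2 - 1) + (t + z * s) ^ 2) := lt_of_lt_of_le (by positivity) h1
    rw [sinc_of_ne_zero h4.ne', norm_div, norm_eq_abs, norm_eq_abs, abs_of_pos h4]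
    calc _ ≤ 1 / (|t| / 2) := by gcongr; exact abs_sin_le_one _
      _ = 2 / |t| := by field_simp
  rcases hX0.eq_or_lt with hX | hX
  · refine (norm_integral_le_of_norm_le ((integrableOn_exp_decay hδ 1).const_mul (2 / |t|))
      ((ae_restrict_iff' measurableSet_Ioi).2 (ae_of_all _ fun s hs => hnear s hs ?_))).trans ?_
    · rw [← hX, zero_mul]; positivity
    · rw [integral_const_mul, integral_exp_decay hδ]
      rw [div_mul_div_comm, mul_comm δ]; gcongr; norm_num
  have hX2 : 0 < h ^ 2 + z ^ 2 := sqrt_pos.1 hX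
  by_cases hcase : |t| ≤ 2 * X
  · refine (norm_integral_exp_sinc_tail_le hδ hX2 le_rfl).trans ?_
    rw [← hXd]
    simp only [sub_self, mul_zero, exp_zero, one_mul]
    rw [div_le_div_iff₀ hX (by positivity)]
    nlinarith [mul_le_mul hδ2 hcase ht'.le (by norm_num : (0:ℝ) ≤ 2)]
  · push Not at hcase
    set s₀ := |t| / (2 * X) with hs₀
    have hs1 : 1 < s₀ := by rw [hs₀, one_lt_div (by positivity)]; exact hcase
    have hsplit : ∫ s in Ioi 1, F s = (∫ s in Ioc 1 s₀, F s) + ∫ s in Ioi s₀, F s := by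
      rw [← setIntegral_union (by
        rw [disjoint_left]; exact fun s hs hs' => not_lt.2 hs.2 hs') measurableSet_Ioi
        (hFi.mono_set Ioc_subset_Ioi_self) (hFi.mono_set (Ioi_subset_Ioi hs1.le)),
        Ioc_union_Ioi_eq_Ioi hs1.le]
    have hp1 : ‖∫ s in Ioc 1 s₀, F s‖ ≤ 2 / |t| * (1 / δ) := by
      refine (norm_integral_le_of_norm_le (((integrableOn_exp_decay hδ 1).mono_set
        Ioc_subset_Ioi_self).const_mul (2 / |t|))
        ((ae_restrict_iff' measurableSet_Ioc).2 (ae_of_all _ fun s hs => hnear s hs.1 ?_))).trans ?_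
      · have : s ≤ |t| / (2 * X) := hs.2
        rw [le_div_iff₀ (by positivity)] at this
        linarith
      · rw [integral_const_mul, ← integral_exp_decay hδ]
        gcongr
        · exact ae_of_all _ fun s => (exp_pos _).le
        · exact integrableOn_exp_decay hδ 1
        · exact Ioc_subset_Ioi_self
    have hp2 := norm_integral_exp_sinc_tail_le (t := t) hδ hX2 hs1.le
    rw [← hXd] at hp2
    have hp3 : rexp (-δ * (s₀ - 1)) * (10 / X) ≤ 180 / (δ * |t|) := by
      have h1 : δ * s₀ * rexp (-(δ * s₀)) ≤ 1 := by
        have := add_one_le_exp (δ * s₀)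
        rw [exp_neg, ← div_eq_mul_inv, div_le_one (exp_pos _)]; linarith
      have h2 : rexp δ ≤ 9 := by
        have h3 : rexp δ ≤ rexp (1 + 1) := exp_le_exp.2 (by linarith)
        rw [exp_add] at h3
        nlinarith [exp_one_lt_d9, exp_pos 1]
      have h4 : rexp (-δ * (s₀ - 1)) = rexp (-(δ * s₀)) * rexp δ := by
        rw [← exp_add]; congr 1; ring
      have h5 : 10 / X = 20 * (δ * s₀) / (δ * |t|) := by
        rw [hs₀]; field_simp; ring
      rw [h4, h5, ← mul_div_assoc]
      gcongr
      nlinarith [mul_le_mul h1 h2 (exp_pos _).le zero_le_one]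
    rw [hsplit]
    calc _ ≤ 2 / |t| * (1 / δ) + 180 / (δ * |t|) :=
          (norm_add_le _ _).trans (add_le_add hp1 (hp2.trans hp3))
      _ = 182 / (δ * |t|) := by field_simp; norm_num
      _ ≤ _ := by gcongr; norm_num

end SincIntegrals

section SpheroidalCoordinates

/-- The parameter space of confocal spheroidal coordinates. -/
def spheroidal : Measure (ℝ × E3) := (volume.restrict (Ioi 1)).prod sph

instance : SFinite spheroidal := by unfold spheroidal; infer_instance

theorem volume_eq_map_spheroid :
    (volume : Measure E3) = Measure.map (fun p : ℝ × E3 => spheroid 1 p.1 p.2)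
      (spheroidal.withDensity fun p => ENNReal.ofReal (p.1 ^ 2 - p.2 2 ^ 2)) := by
  have hΦ := (continuous_spheroid 1).measurable
  have hρ : Measurable fun p : ℝ × E3 => ENNReal.ofReal (p.1 ^ 2 - p.2 2 ^ 2) := by fun_prop
  refine Measure.ext_of_lintegral _ fun f hf => ?_
  have hfΦ : Measurable fun p : ℝ × E3 => f (spheroid 1 p.1 p.2) := hf.comp hΦ
  rw [lintegral_map hf hΦ, lintegral_withDensity_eq_lintegral_mul _ hρ hfΦ,
    spheroidal, lintegral_prod _ (hρ.mul hfΦ).aemeasurable,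
    lintegral_spheroid zero_le_one hf]
  simp

theorem integral_spheroid {f : E3 → ℂ} (hf : Measurable f) :
    ∫ ξ, f ξ = ∫ p, ((max (p.1 ^ 2 - p.2 2 ^ 2) 0 : ℝ) : ℂ) * f (spheroid 1 p.1 p.2)
      ∂spheroidal := by
  have hΦ := (continuous_spheroid 1).measurable
  nth_rewrite 1 [volume_eq_map_spheroid]
  rw [integral_map hΦ.aemeasurable hf.aestronglyMeasurable,
    integral_withDensity_eq_integral_toReal_smul (by fun_prop) (ae_of_all _ fun _ => by simp)]
  simp [ENNReal.toReal_ofReal']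

theorem integrable_spheroid_iff {f : E3 → ℝ} (hf : Measurable f) :
    Integrable f ↔ Integrable (fun p : ℝ × E3 => max (p.1 ^ 2 - p.2 2 ^ 2) 0 *
      f (spheroid 1 p.1 p.2)) spheroidal := by
  have hΦ := (continuous_spheroid 1).measurable
  nth_rewrite 1 [volume_eq_map_spheroid]
  rw [integrable_map_measure hf.aestronglyMeasurable hΦ.aemeasurable,
    integrable_withDensity_iff_integrable_smul' (by fun_prop) (ae_of_all _ fun _ => by simp)]
  simp [ENNReal.toReal_ofReal']

theorem ae_spheroidal : ∀ᵐ p ∂spheroidal, 1 < p.1 ∧ ‖p.2‖ = 1 ∧ p.2 2 ∈ Ioo (-1 : ℝ) 1 := by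
  unfold spheroidal
  have h1 : ∀ᵐ p ∂(volume.restrict (Ioi (1 : ℝ))).prod sph, 1 < p.1 :=
    Measure.quasiMeasurePreserving_fst.ae (ae_restrict_mem measurableSet_Ioi)
  have h2 := Measure.quasiMeasurePreserving_snd (μ := volume.restrict (Ioi (1 : ℝ))).ae
    (ae_sph_norm.and ae_sph_height)
  filter_upwards [h1, h2] with p hp1 hp2 using ⟨hp1, hp2⟩

theorem d1_spheroid {s : ℝ} {y : E3} (hs : 1 < s) (hy : ‖y‖ = 1) (hw : y 2 ∈ Ioo (-1 : ℝ) 1) :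
    d1 1 (spheroid 1 s y) = s - y 2 := by
  rw [d1, ← sqrt_sq (by linarith [hw.2] : 0 ≤ s - y 2)]
  congr 1
  have h := norm_sq_E3 y
  have h2 : √(s ^ 2 - 1 ^ 2) ^ 2 = s ^ 2 - 1 ^ 2 := sq_sqrt (by nlinarith)
  simp only [spheroid, PiLp.toLp_apply, Matrix.cons_val, mul_pow, h2]
  rw [hy] at h
  linear_combination (1 - s ^ 2) * h

theorem d2_spheroid {s : ℝ} {y : E3} (hs : 1 < s) (hy : ‖y‖ = 1) (hw : y 2 ∈ Ioo (-1 : ℝ) 1) :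
    d2 1 (spheroid 1 s y) = s + y 2 := by
  rw [d2, ← sqrt_sq (by linarith [hw.1] : 0 ≤ s + y 2)]
  congr 1
  have h := norm_sq_E3 y
  have h2 : √(s ^ 2 - 1 ^ 2) ^ 2 = s ^ 2 - 1 ^ 2 := sq_sqrt (by nlinarith)
  simp only [spheroid, PiLp.toLp_apply, Matrix.cons_val, mul_pow, h2]
  rw [hy] at h
  linear_combination (1 - s ^ 2) * h

theorem Sig_spheroid {s : ℝ} {y : E3} (hs : 1 < s) (hy : ‖y‖ = 1) (hw : y 2 ∈ Ioo (-1 : ℝ) 1) :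
    Sig 1 (spheroid 1 s y) = s := by
  rw [Sig, d1_spheroid hs hy hw, d2_spheroid hs hy hw]; ring

theorem Om_spheroid {s : ℝ} {y : E3} (hs : 1 < s) (hy : ‖y‖ = 1) (hw : y 2 ∈ Ioo (-1 : ℝ) 1) :
    Om 1 (spheroid 1 s y) = y 2 := by
  rw [Om, d1_spheroid hs hy hw, d2_spheroid hs hy hw]; ring

theorem continuous_Sig (κ : ℝ) : Continuous (Sig κ) := by
  unfold Sig d1 d2; fun_prop

theorem continuous_Om (κ : ℝ) : Continuous (Om κ) := by
  unfold Om d1 d2; fun_prop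

/-- The symbol with spheroidal amplitude `N`. -/
def spheroidalSymbol (N : ℝ → ℝ → ℝ) (ξ : E3) : ℝ :=
  N (Sig 1 ξ) (Om 1 ξ) / (Sig 1 ξ ^ 2 - Om 1 ξ ^ 2)

/-- The kernel with spheroidal amplitude `N` and phase `L`. -/
def spheroidalKernel (N L : ℝ → ℝ → ℝ) (t : ℝ) (x : E3) : ℂ :=
  ∫ p, (N p.1 (p.2 2) : ℂ) *
    Complex.exp (Complex.I * (t * L p.1 (p.2 2) + dot3 x (spheroid 1 p.1 p.2) : ℝ)) ∂spheroidal

theorem measurable_spheroidalSymbol {N : ℝ → ℝ → ℝ} (hN : Measurable fun p : ℝ × ℝ => N p.1 p.2) :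
    Measurable (spheroidalSymbol N) := by
  have h1 := (continuous_Sig 1).measurable
  have h2 := (continuous_Om 1).measurable
  exact (hN.comp (h1.prodMk h2)).div ((h1.pow_const 2).sub (h2.pow_const 2))

theorem weight_mul_spheroidalSymbol (N : ℝ → ℝ → ℝ) {s : ℝ} {y : E3} (hs : 1 < s) (hy : ‖y‖ = 1)
    (hw : y 2 ∈ Ioo (-1 : ℝ) 1) :
    max (s ^ 2 - y 2 ^ 2) 0 * spheroidalSymbol N (spheroid 1 s y) = N s (y 2) := by
  have : 0 < s ^ 2 - y 2 ^ 2 := by nlinarith [hw.1, hw.2]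
  rw [spheroidalSymbol, Sig_spheroid hs hy hw, Om_spheroid hs hy hw, max_eq_left this.le]
  field_simp

theorem integrable_spheroidalSymbol {N : ℝ → ℝ → ℝ} (hN : Measurable fun p : ℝ × ℝ => N p.1 p.2)
    (hNi : Integrable (fun p : ℝ × E3 => N p.1 (p.2 2)) spheroidal) :
    Integrable (spheroidalSymbol N) := by
  rw [integrable_spheroid_iff (measurable_spheroidalSymbol hN)]
  refine hNi.congr ?_
  filter_upwards [ae_spheroidal] with p hp
  rw [weight_mul_spheroidalSymbol N hp.1 hp.2.1 hp.2.2]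

theorem fourierDot_spheroidalSymbol {N L : ℝ → ℝ → ℝ}
    (hN : Measurable fun p : ℝ × ℝ => N p.1 p.2) (hL : Measurable fun p : ℝ × ℝ => L p.1 p.2)
    (t : ℝ) (x : E3) :
    fourierDot (fun ξ => spheroidalSymbol N ξ *
      Complex.exp (Complex.I * (t * L (Sig 1 ξ) (Om 1 ξ) : ℝ))) x = spheroidalKernel N L t x := by
  have h1 := (continuous_Sig 1).measurable
  have h2 := (continuous_Om 1).measurable
  have hd := (continuous_dot3 x).measurable
  have hL' : Measurable fun ξ => L (Sig 1 ξ) (Om 1 ξ) := hL.comp (h1.prodMk h2)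
  rw [fourierDot, integral_spheroid, spheroidalKernel]
  · refine integral_congr_ae ?_
    filter_upwards [ae_spheroidal] with p hp
    rw [← weight_mul_spheroidalSymbol N hp.1 hp.2.1 hp.2.2, Sig_spheroid hp.1 hp.2.1 hp.2.2,
      Om_spheroid hp.1 hp.2.1 hp.2.2]
    push_cast
    rw [mul_add, Complex.exp_add]
    ring
  · refine Measurable.mul (by fun_prop) (Measurable.mul ?_ (by fun_prop))
    exact Complex.measurable_ofReal.comp (measurable_spheroidalSymbol hN)

theorem norm_spheroidalKernel_integrand (N L : ℝ → ℝ → ℝ) (t : ℝ) (x : E3) (p : ℝ × E3) :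
    ‖(N p.1 (p.2 2) : ℂ) * Complex.exp (Complex.I *
      (t * L p.1 (p.2 2) + dot3 x (spheroid 1 p.1 p.2) : ℝ))‖ = ‖N p.1 (p.2 2)‖ := by
  rw [norm_mul, norm_exp_I_mul, mul_one, Complex.norm_real]

theorem integrable_spheroidalKernel {N L : ℝ → ℝ → ℝ} (hL : Measurable fun p : ℝ × ℝ => L p.1 p.2)
    (hNi : Integrable (fun p : ℝ × E3 => N p.1 (p.2 2)) spheroidal) (t : ℝ) (x : E3) :
    Integrable (fun p : ℝ × E3 => (N p.1 (p.2 2) : ℂ) * Complex.exp (Complex.I *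
      (t * L p.1 (p.2 2) + dot3 x (spheroid 1 p.1 p.2) : ℝ))) spheroidal := by
  refine hNi.norm.mono' ?_ (ae_of_all _ fun p => (norm_spheroidalKernel_integrand N L t x p).le)
  refine (Complex.continuous_ofReal.comp_aestronglyMeasurable hNi.1).mul
    (Measurable.aestronglyMeasurable ?_)
  have h1 : Measurable fun p : ℝ × E3 => L p.1 (p.2 2) :=
    hL.comp (f := fun p : ℝ × E3 => (p.1, p.2 2)) (by fun_prop)
  have h2 : Measurable fun p : ℝ × E3 => dot3 x (spheroid 1 p.1 p.2) :=
    ((continuous_dot3 x).comp (continuous_spheroid 1)).measurable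
  fun_prop

theorem integrable_exp_decay_spheroidal {δ : ℝ} (hδ : 0 < δ) :
    Integrable (fun p : ℝ × E3 => rexp (-δ * (p.1 - 1))) spheroidal := by
  have : Integrable (fun s => rexp (-δ * (s - 1))) (volume.restrict (Ioi (1 : ℝ))) :=
    integrableOn_exp_decay hδ 1
  exact this.comp_fst sph

/-- Dispersion of the inertial waves with an exponential amplitude. -/
theorem norm_kernel_Om_exp_le {δ : ℝ} (hδ : 0 < δ) (hδ2 : δ ≤ 2) {t : ℝ} (ht : t ≠ 0) (x : E3) :
    ‖spheroidalKernel (fun s _ => rexp (-δ * (s - 1))) (fun _ w => w) t x‖ ≤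
      800 * π / (δ * |t|) := by
  have hi := integrable_spheroidalKernel (N := fun s _ => rexp (-δ * (s - 1)))
    (L := fun _ w => w) measurable_snd
    (integrable_exp_decay_spheroidal hδ) t x
  rw [spheroidalKernel, spheroidal, integral_prod _ hi]
  have h : ∀ s ∈ Ioi (1 : ℝ), ∫ y, ((rexp (-δ * (s - 1)) : ℝ) : ℂ) * Complex.exp (Complex.I *
      (t * y 2 + dot3 x (spheroid 1 s y) : ℝ)) ∂sph = (4 * π : ℂ) * (((rexp (-δ * (s - 1)) : ℝ) : ℂ) *
      (sinc √(√(x 0 ^ 2 + x 1 ^ 2) ^ 2 * (s ^ 2 - 1) + (t + x 2 * s) ^ 2) : ℂ)) := by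
    intro s hs
    have hs1 : 1 < s := hs
    have hV : ∀ y, t * y 2 + dot3 x (spheroid 1 s y) =
        dot3 !₂[x 0 * √(s ^ 2 - 1 ^ 2), x 1 * √(s ^ 2 - 1 ^ 2), t + x 2 * s] y := by
      intro y; simp [dot3, spheroid]; ring
    simp only [hV]
    rw [integral_const_mul, integral_exp_dot3_sph, ← sqrt_sq (norm_nonneg _), norm_sq_E3]
    have h2 : √(s ^ 2 - 1 ^ 2) ^ 2 = s ^ 2 - 1 ^ 2 := sq_sqrt (by nlinarith)
    have h3 : √(x 0 ^ 2 + x 1 ^ 2) ^ 2 = x 0 ^ 2 + x 1 ^ 2 := sq_sqrt (by positivity)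
    simp only [Matrix.cons_val, mul_pow, h2, h3]
    rw [show x 0 ^ 2 * (s ^ 2 - 1 ^ 2) + x 1 ^ 2 * (s ^ 2 - 1 ^ 2) + (t + x 2 * s) ^ 2 =
      (x 0 ^ 2 + x 1 ^ 2) * (s ^ 2 - 1) + (t + x 2 * s) ^ 2 by ring]
    ring
  rw [setIntegral_congr_fun measurableSet_Ioi h, integral_const_mul, norm_mul]
  have := norm_integral_exp_sinc_le (h := √(x 0 ^ 2 + x 1 ^ 2)) (z := x 2) hδ hδ2 ht
  have e : ‖(4 * π : ℂ)‖ = 4 * π := by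
    rw [norm_mul, Complex.norm_real, norm_of_nonneg pi_pos.le]; simp
  rw [e]
  calc _ ≤ 4 * π * (200 / (δ * |t|)) := by gcongr
    _ = _ := by ring

theorem spheroidalKernel_cos {N L : ℝ → ℝ → ℝ} (hL : Measurable fun p : ℝ × ℝ => L p.1 p.2)
    (hNi : Integrable (fun p : ℝ × E3 => N p.1 (p.2 2)) spheroidal) (t : ℝ) (x : E3) :
    spheroidalKernel (fun s w => N s w * cos (π * s * w / 2)) L t x =
      (spheroidalKernel N L t (x + !₂[0, 0, π / 2]) +
        spheroidalKernel N L t (x + !₂[0, 0, -(π / 2)])) / 2 := by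
  unfold spheroidalKernel
  rw [← integral_add (integrable_spheroidalKernel hL hNi t _)
    (integrable_spheroidalKernel hL hNi t _), ← integral_div]
  refine integral_congr_ae (ae_of_all _ fun p => ?_)
  have h1 : ∀ r : ℝ, dot3 (x + !₂[0, 0, r]) (spheroid 1 p.1 p.2) =
      dot3 x (spheroid 1 p.1 p.2) + r * (p.1 * p.2 2) := fun r => by
    simp [dot3, spheroid]; ring
  simp only [h1]
  push_cast
  rw [Complex.cos, show (Complex.I * (t * L p.1 (p.2 2) + (dot3 x (spheroid 1 p.1 p.2) +
    π / 2 * (p.1 * p.2 2))) : ℂ) = Complex.I * (t * L p.1 (p.2 2) + dot3 x (spheroid 1 p.1 p.2)) +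
      π * p.1 * p.2 2 / 2 * Complex.I by ring,
    show (Complex.I * (t * L p.1 (p.2 2) + (dot3 x (spheroid 1 p.1 p.2) +
    -(π / 2) * (p.1 * p.2 2))) : ℂ) = Complex.I * (t * L p.1 (p.2 2) + dot3 x (spheroid 1 p.1 p.2)) +
      -(π * p.1 * p.2 2 / 2) * Complex.I by ring, Complex.exp_add, Complex.exp_add]
  ring

theorem spheroidalKernel_add {N N' L : ℝ → ℝ → ℝ} (hL : Measurable fun p : ℝ × ℝ => L p.1 p.2)
    (hN : Integrable (fun p : ℝ × E3 => N p.1 (p.2 2)) spheroidal)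
    (hN' : Integrable (fun p : ℝ × E3 => N' p.1 (p.2 2)) spheroidal) (t : ℝ) (x : E3) :
    spheroidalKernel (fun s w => N s w + N' s w) L t x =
      spheroidalKernel N L t x + spheroidalKernel N' L t x := by
  unfold spheroidalKernel
  rw [← integral_add (integrable_spheroidalKernel hL hN t _)
    (integrable_spheroidalKernel hL hN' t _)]
  refine integral_congr_ae (ae_of_all _ fun p => ?_)
  push_cast
  ring

theorem spheroidalKernel_const_mul (a : ℝ) (N L : ℝ → ℝ → ℝ) (t : ℝ) (x : E3) :
    spheroidalKernel (fun s w => a * N s w) L t x = a * spheroidalKernel N L t x := by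
  unfold spheroidalKernel
  rw [← integral_const_mul]
  refine integral_congr_ae (ae_of_all _ fun p => ?_)
  push_cast
  ring

end SpheroidalCoordinates

section SphericalZones

theorem concaveOn_sqrt_one_sub_sq : ConcaveOn ℝ (Ioo (-1 : ℝ) 1) fun w => √(1 - w ^ 2) := by
  have h : ConcaveOn ℝ (Ioo (-1 : ℝ) 1) fun w : ℝ => 1 - w ^ 2 :=
    (concaveOn_const 1 (convex_Ioo _ _)).sub
      ((even_two.convexOn_pow (𝕜 := ℝ)).subset (subset_univ _) (convex_Ioo _ _))
  refine ⟨convex_Ioo _ _, fun x hx y hy a b ha hb hab => ?_⟩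
  have h1 := h.2 hx hy ha hb hab
  have h2 := strictConcaveOn_sqrt.concaveOn.2 (x := 1 - x ^ 2) (y := 1 - y ^ 2)
    (by simp only [mem_Ici]; nlinarith [hx.1, hx.2]) (by simp only [mem_Ici]; nlinarith [hy.1, hy.2])
    ha hb hab
  exact h2.trans (sqrt_le_sqrt h1)

theorem norm_integral_zone_concave_le {h : ℝ → ℝ} (hh : ConcaveOn ℝ (Ioo (-1 : ℝ) 1) h)
    (hm : Measurable h) {r : ℝ} (hr : 0 < r) {a : ℝ} (ha : 0 ≤ a) :
    ‖∫ w in Ioo (-1) 1, (((Icc (-a) a).indicator (fun _ => (1 : ℝ)) (h w) : ℝ) : ℂ) *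
      Complex.exp (Complex.I * (r * w : ℝ))‖ ≤ 4 / r := by
  set f : ℝ → ℂ := fun w => Complex.exp (Complex.I * (r * w : ℝ)) with hf
  have hS : ∀ S : Set ℝ, MeasurableSet S → (Ioo (-1) 1 ∩ S).OrdConnected →
      ‖∫ w in Ioo (-1) 1, S.indicator f w‖ ≤ 2 / r := fun S hSm hSo => by
    rw [setIntegral_indicator hSm]
    refine norm_setIntegral_ordConnected_le hSo
      (ne_top_of_le_ne_top (by simp) (measure_mono (μ := volume) inter_subset_left))
      fun u v huv _ => ?_
    have := norm_setIntegral_Ioo_exp_le hr.ne' huv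
    rwa [abs_of_pos hr] at this
  have hm1 : MeasurableSet {w | -a ≤ h w} := measurableSet_le measurable_const hm
  have hm2 : MeasurableSet {w | a < h w} := measurableSet_lt measurable_const hm
  have e : ∀ w, (((Icc (-a) a).indicator (fun _ => (1 : ℝ)) (h w) : ℝ) : ℂ) * f w =
      {w | -a ≤ h w}.indicator f w - {w | a < h w}.indicator f w := fun w => by
    by_cases h1 : -a ≤ h w <;> by_cases h2 : h w ≤ a
    · simp [indicator, h1, h2, not_lt.2 h2]
    · simp [indicator, h1, h2, not_le.1 h2]
    · simp [indicator, h1, not_lt.2 h2]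
    · exfalso; linarith
  have hfi : IntegrableOn f (Ioo (-1) 1) :=
    ((by fun_prop : Continuous f).continuousOn.integrableOn_Icc).mono_set Ioo_subset_Icc_self
  rw [setIntegral_congr_fun measurableSet_Ioo (fun w _ => e w),
    integral_sub (hfi.indicator hm1) (hfi.indicator hm2)]
  calc _ ≤ 2 / r + 2 / r := (norm_sub_le _ _).trans (add_le_add
        (hS _ hm1 (hh.convex_ge (-a)).ordConnected) (hS _ hm2 (hh.convex_gt a).ordConnected))
    _ = 4 / r := by ring

theorem norm_integral_zone_le (A B : ℝ) {r : ℝ} (hr : 0 < r) {a : ℝ} (ha : 0 ≤ a) :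
    ‖∫ w in Ioo (-1) 1, (((Icc (-a) a).indicator (fun _ => (1 : ℝ)) (B * √(1 - w ^ 2) + A * w) : ℝ) : ℂ) *
      Complex.exp (Complex.I * (r * w : ℝ))‖ ≤ 4 / r := by
  have hlin : ∀ A : ℝ, ConcaveOn ℝ (Ioo (-1 : ℝ) 1) fun w => A * w := fun A =>
    (LinearMap.mulLeft ℝ A).concaveOn (convex_Ioo _ _)
  rcases le_total 0 B with hB | hB
  · exact norm_integral_zone_concave_le ((concaveOn_sqrt_one_sub_sq.smul hB).add (hlin A))
      (by fun_prop) hr ha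
  · have := norm_integral_zone_concave_le (h := fun w => (-B) * √(1 - w ^ 2) + (-A) * w)
      ((concaveOn_sqrt_one_sub_sq.smul (neg_nonneg.2 hB)).add (hlin (-A))) (by fun_prop) hr ha
    have e : ∀ w, (Icc (-a) a).indicator (fun _ => (1 : ℝ)) ((-B) * √(1 - w ^ 2) + (-A) * w) =
        (Icc (-a) a).indicator (fun _ => (1 : ℝ)) (B * √(1 - w ^ 2) + A * w) := fun w => by
      rw [show (-B) * √(1 - w ^ 2) + (-A) * w = -(B * √(1 - w ^ 2) + A * w) by ring]
      simp only [indicator, mem_Icc, neg_le_neg_iff]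
      congr 1
      rw [eq_iff_iff, and_comm, neg_le]
    simpa only [e] using this

theorem integral_sph_symm {f : E3 → ℂ} (hf : Integrable f sph) :
    ∫ y, f y ∂sph = ∫ φ in Ioo (-π) π, ∫ w in Ioo (-1) 1, f (spherePt w φ) := by
  rw [integral_sph hf]
  refine integral_integral_swap (f := fun w φ => f (spherePt w φ)) ?_
  rw [sph, integrable_map_measure (by simpa [sph] using hf.1)
    continuous_spherePt.measurable.aemeasurable] at hf
  exact hf

theorem norm_integral_zone_exp_dot3_le {V : E3} (hV : V ≠ 0) {a : ℝ} (ha : 0 ≤ a) :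
    ‖∫ y, (((Icc (-a) a).indicator (fun _ => (1 : ℝ)) (y 2) : ℝ) : ℂ) *
      Complex.exp (Complex.I * (dot3 V y : ℝ)) ∂sph‖ ≤ 8 * π / ‖V‖ := by
  have hr : 0 < ‖V‖ := norm_pos_iff.2 hV
  obtain ⟨e, he⟩ := exists_isometry_dot3 V
  set u : E3 := e.symm !₂[0, 0, 1] with hu
  have hu2 : ∀ y, (e y) 2 = dot3 u y := fun y => by
    rw [dot3_eq_inner, hu, ← e.inner_map_map, e.apply_symm_apply, ← dot3_eq_inner]
    simp [dot3]
  rw [← integral_sph_comp_isometry e]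
  simp only [he, hu2]
  have hind : Measurable fun w : ℝ => (Icc (-a) a).indicator (fun _ => (1 : ℝ)) w :=
    measurable_const.indicator measurableSet_Icc
  rw [integral_sph_symm]
  · refine (norm_setIntegral_le_of_norm_le_const (C := 4 / ‖V‖) (by simp) fun φ _ => ?_).trans_eq ?_
    · have := norm_integral_zone_le (u 2) (u 0 * cos φ + u 1 * sin φ) hr ha
      convert this using 7 with w
      · rfl
      · simp [dot3, spherePt]; ring
      · simp [spherePt]
    · rw [measureReal_def, Real.volume_Ioo, ENNReal.toReal_ofReal (by linarith [pi_pos])]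
      ring
  · refine Integrable.of_bound (Measurable.aestronglyMeasurable ?_) 1 (ae_of_all _ fun y => ?_)
    · refine Measurable.mul ?_ (by fun_prop)
      exact Complex.measurable_ofReal.comp (hind.comp (continuous_dot3 u).measurable)
    · rw [norm_mul, norm_exp_I_mul, mul_one, Complex.norm_real]
      simp only [indicator]; split_ifs <;> simp

end SphericalZones

section Hyperboloid

/-- The invariant measure `dp/√(1+|p|²)` of the hyperboloid, in the coordinates `p ∈ ℝ²`. -/
def hyperboloidMeasure : Measure (ℝ × ℝ) :=
  volume.withDensity fun p => ENNReal.ofReal (1 / √(1 + p.2 ^ 2 + p.1 ^ 2))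

theorem lintegral_hyperboloidMeasure {F : ℝ × ℝ → ℝ≥0∞} (hF : Measurable F) :
    ∫⁻ p, F p ∂hyperboloidMeasure =
      ∫⁻ p, ENNReal.ofReal (1 / √(1 + p.2 ^ 2 + p.1 ^ 2)) * F p := by
  rw [hyperboloidMeasure, lintegral_withDensity_eq_lintegral_mul _ (by fun_prop) hF]
  rfl

/-- The polar parametrization of the hyperboloid, `s` being the height. -/
def hyperboloidPt (p : ℝ × ℝ) : ℝ × ℝ := (√(p.1 ^ 2 - 1) * cos p.2, √(p.1 ^ 2 - 1) * sin p.2)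

theorem continuous_hyperboloidPt : Continuous hyperboloidPt := by
  unfold hyperboloidPt; fun_prop

theorem lintegral_Ioi_one_comp_sqrt (G : ℝ → ℝ≥0∞) :
    ∫⁻ s in Ioi 1, G √(s ^ 2 - 1) =
      ∫⁻ ρ in Ioi 0, ENNReal.ofReal ρ * ENNReal.ofReal (1 / √(1 + ρ ^ 2)) * G ρ := by
  have himg : (fun ρ : ℝ => √(1 + ρ ^ 2)) '' Ioi 0 = Ioi 1 := by
    ext s
    simp only [mem_image, mem_Ioi]
    constructor
    · rintro ⟨ρ, hρ, rfl⟩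
      exact lt_sqrt_of_sq_lt (by nlinarith)
    · intro hs
      refine ⟨√(s ^ 2 - 1), sqrt_pos.2 (by nlinarith), ?_⟩
      rw [sq_sqrt (by nlinarith), add_sub_cancel, sqrt_sq (by linarith)]
  have hd : ∀ ρ ∈ Ioi (0 : ℝ), HasDerivWithinAt (fun ρ : ℝ => √(1 + ρ ^ 2)) (ρ / √(1 + ρ ^ 2)) (Ioi 0) ρ := by
    intro ρ hρ
    have : HasDerivAt (fun ρ : ℝ => 1 + ρ ^ 2) (2 * ρ) ρ := by
      simpa using (hasDerivAt_pow 2 ρ).const_add 1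
    refine (this.sqrt (by positivity)).hasDerivWithinAt.congr_deriv ?_
    rw [mul_div_mul_left _ _ two_ne_zero]
  have hinj : InjOn (fun ρ : ℝ => √(1 + ρ ^ 2)) (Ioi 0) := by
    intro x hx y hy hxy
    have hx0 : 0 < x := hx
    have hy0 : 0 < y := hy
    have := (sqrt_inj (by positivity) (by positivity)).1 hxy
    exact (pow_left_inj₀ hx0.le hy0.le two_ne_zero).1 (by linarith)
  rw [← himg, lintegral_image_eq_lintegral_abs_deriv_mul measurableSet_Ioi hd hinj]
  refine setLIntegral_congr_fun measurableSet_Ioi fun ρ hρ => ?_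
  have hρ0 : 0 < ρ := hρ
  rw [sq_sqrt (by positivity), add_sub_cancel_left, sqrt_sq hρ0.le, abs_of_nonneg (by positivity),
    ← ENNReal.ofReal_mul hρ0.le, mul_one_div]

theorem map_hyperboloidPt :
    Measure.map hyperboloidPt ((volume.restrict (Ioi 1)).prod (volume.restrict (Ioo (-π) π))) =
      hyperboloidMeasure := by
  refine Measure.ext_of_lintegral _ fun F hF => ?_
  rw [lintegral_map hF continuous_hyperboloidPt.measurable, lintegral_hyperboloidMeasure hF,
    lintegral_prod (fun p => F (hyperboloidPt p))
      (hF.comp continuous_hyperboloidPt.measurable).aemeasurable,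
    ← lintegral_comp_polarCoord_symm]
  simp only [hyperboloidPt]
  rw [lintegral_Ioi_one_comp_sqrt (fun ρ => ∫⁻ φ in Ioo (-π) π, F (ρ * cos φ, ρ * sin φ)),
    polarCoord_target, Measure.volume_eq_prod, ← Measure.prod_restrict, lintegral_prod]
  · refine lintegral_congr fun ρ => ?_
    rw [← lintegral_const_mul _ (by fun_prop)]
    refine lintegral_congr fun φ => ?_
    simp only [polarCoord_symm_apply, smul_eq_mul]
    rw [show 1 + (ρ * sin φ) ^ 2 + (ρ * cos φ) ^ 2 = 1 + ρ ^ 2 by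
      linear_combination ρ ^ 2 * sin_sq_add_cos_sq φ, mul_assoc]
  · refine Measurable.aemeasurable ?_
    simp only [polarCoord_symm_apply, smul_eq_mul]
    fun_prop

theorem sqrt_boost {c k m q : ℝ} (hc : 0 < c) (hck : c ^ 2 - k ^ 2 = 1) (hm : 0 < m) :
    √(m + (c * q + k * √(m + q ^ 2)) ^ 2) = c * √(m + q ^ 2) + k * q := by
  have hE : √(m + q ^ 2) ^ 2 = m + q ^ 2 := sq_sqrt (by positivity)
  have h1 : |k * q| ≤ c * √(m + q ^ 2) := by
    refine abs_le_of_sq_le_sq ?_ (by positivity)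
    nlinarith [sq_nonneg q, sq_nonneg k, mul_pos (pow_pos hc 2) hm]
  rw [← sqrt_sq (show 0 ≤ c * √(m + q ^ 2) + k * q by linarith [neg_abs_le (k * q)])]
  congr 1
  linear_combination (-hE) + (√(m + q ^ 2) ^ 2 - q ^ 2) * (-hck) 

theorem lintegral_boost {c k m : ℝ} (hc : 0 < c) (hck : c ^ 2 - k ^ 2 = 1) (hm : 0 < m) (F : ℝ → ℝ≥0∞) :
    ∫⁻ q, ENNReal.ofReal (1 / √(m + q ^ 2)) * F (c * q + k * √(m + q ^ 2)) =
      ∫⁻ q, ENNReal.ofReal (1 / √(m + q ^ 2)) * F q := by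
  set f : ℝ → ℝ := fun q => c * q + k * √(m + q ^ 2) with hf
  have hE : ∀ q, 0 < √(m + q ^ 2) := fun q => sqrt_pos.2 (by positivity)
  have hd : ∀ q ∈ univ, HasDerivWithinAt f (√(m + f q ^ 2) / √(m + q ^ 2)) univ q := by
    intro q _
    have h1 : HasDerivAt (fun q : ℝ => m + q ^ 2) (2 * q) q := by
      simpa using (hasDerivAt_pow 2 q).const_add m
    have h2 := ((hasDerivAt_id q).const_mul c).add
      ((h1.sqrt (by positivity)).const_mul k)
    refine h2.hasDerivWithinAt.congr_deriv ?_
    rw [show f q = c * q + k * √(m + q ^ 2) from rfl, sqrt_boost hc hck hm]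
    have := (hE q).ne'
    field_simp
  have hinv : ∀ c k : ℝ, 0 < c → c ^ 2 - k ^ 2 = 1 → ∀ q, c * (c * q + k * √(m + q ^ 2)) -
      k * √(m + (c * q + k * √(m + q ^ 2)) ^ 2) = q := fun c k hc hck q => by
    rw [sqrt_boost hc hck hm]; linear_combination q * hck
  have hinj : InjOn f univ := fun x _ y _ hxy => by
    rw [← hinv c k hc hck x, ← hinv c k hc hck y]
    simp only [hf] at hxy
    rw [hxy]
  have himg : f '' univ = univ := by
    refine eq_univ_of_forall fun y => ⟨c * y + -k * √(m + y ^ 2), mem_univ _, ?_⟩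
    have := hinv c (-k) hc (by linarith) y
    simpa [hf] using this
  conv_rhs => rw [← setLIntegral_univ, ← himg,
    lintegral_image_eq_lintegral_abs_deriv_mul MeasurableSet.univ hd hinj, setLIntegral_univ]
  refine lintegral_congr fun q => ?_
  have h1 := hE q
  have h2 := hE (f q)
  rw [← mul_assoc, ← ENNReal.ofReal_mul (abs_nonneg _), abs_of_pos (by positivity)]
  congr 2
  field_simp

/-- Lorentz boost in the first coordinate. -/
def boost (c k : ℝ) (p : ℝ × ℝ) : ℝ × ℝ := (c * p.1 + k * √(1 + p.2 ^ 2 + p.1 ^ 2), p.2)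

theorem measurePreserving_boost {c k : ℝ} (hc : 0 < c) (hck : c ^ 2 - k ^ 2 = 1) :
    MeasurePreserving (boost c k) hyperboloidMeasure hyperboloidMeasure := by
  have hb : Measurable (boost c k) := by unfold boost; fun_prop
  refine ⟨hb, Measure.ext_of_lintegral _ fun F hF => ?_⟩
  rw [lintegral_map hF hb, lintegral_hyperboloidMeasure hF,
    lintegral_hyperboloidMeasure (F := fun p => F (boost c k p)) (hF.comp hb), Measure.volume_eq_prod, lintegral_prod_symm,
    lintegral_prod_symm]
  · refine lintegral_congr fun y => ?_
    exact lintegral_boost (m := 1 + y ^ 2) hc hck (by positivity) (fun q => F (q, y))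
  · fun_prop
  · have := hF.comp hb
    fun_prop

end Hyperboloid

section HyperboloidOscillation

theorem concaveOn_sqrt_sq_sub_one : ConcaveOn ℝ (Ioi (1 : ℝ)) fun s => √(s ^ 2 - 1) := by
  refine ⟨convex_Ioi _, fun x hx y hy a b ha hb hab => ?_⟩
  have hx1 : 1 < x := hx
  have hy1 : 1 < y := hy
  have h1 : √(x ^ 2 - 1) ^ 2 = x ^ 2 - 1 := sq_sqrt (by nlinarith)
  have h2 : √(y ^ 2 - 1) ^ 2 = y ^ 2 - 1 := sq_sqrt (by nlinarith)
  have h3 : √(x ^ 2 - 1) * √(y ^ 2 - 1) ≤ x * y - 1 := by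
    refine abs_le_of_sq_le_sq' ?_ (by nlinarith) |>.2
    rw [mul_pow, h1, h2]
    nlinarith [sq_nonneg (x - y)]
  simp only [smul_eq_mul]
  refine le_sqrt_of_sq_le ?_
  have h4 : (1 : ℝ) = (a + b) ^ 2 := by rw [hab]; norm_num
  have h5 : (a * √(x ^ 2 - 1) + b * √(y ^ 2 - 1)) ^ 2 =
      a ^ 2 * (x ^ 2 - 1) + b ^ 2 * (y ^ 2 - 1) + 2 * (a * b * (√(x ^ 2 - 1) * √(y ^ 2 - 1))) := by
    linear_combination a ^ 2 * h1 + b ^ 2 * h2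
  rw [h5]
  linarith [mul_le_mul_of_nonneg_left h3 (mul_nonneg ha hb)]

theorem one_le_hyperbolic {c k s : ℝ} (hc : 0 < c) (hck : c ^ 2 - k ^ 2 = 1) (hs : 1 < s) {k' : ℝ}
    (hk' : |k'| ≤ |k|) : 1 ≤ c * s + k' * √(s ^ 2 - 1) := by
  have h1 : √(s ^ 2 - 1) ^ 2 = s ^ 2 - 1 := sq_sqrt (by nlinarith)
  have h0 := sqrt_nonneg (s ^ 2 - 1)
  have h2 : |k'| * √(s ^ 2 - 1) ≤ |k| * √(s ^ 2 - 1) := by gcongr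
  have h3 : -(|k'| * √(s ^ 2 - 1)) ≤ k' * √(s ^ 2 - 1) := by
    nlinarith [neg_abs_le k']
  have hk2 : |k| ^ 2 = c ^ 2 - 1 := by rw [sq_abs]; linarith
  have hkc : |k| ≤ c := abs_le_of_sq_le_sq (by nlinarith) hc.le
  have hrs : √(s ^ 2 - 1) ≤ s := abs_le_of_sq_le_sq' (by nlinarith) (by linarith) |>.2
  have h4 : 0 ≤ c * s - |k| * √(s ^ 2 - 1) := by
    nlinarith [mul_le_mul hkc hrs h0 hc.le]
  have h5 : (c * s - |k| * √(s ^ 2 - 1)) ^ 2 = 1 + (c * √(s ^ 2 - 1) - |k| * s) ^ 2 := by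
    linear_combination (|k| ^ 2 - c ^ 2) * h1 - hk2
  nlinarith [sq_nonneg (c * √(s ^ 2 - 1) - |k| * s)]

theorem norm_integral_exp_hyperbolic_le {c k k' R δ : ℝ} (hc : 0 < c) (hck : c ^ 2 - k ^ 2 = 1)
    (hk' : |k'| ≤ |k|) (hR : R ≠ 0) (hδ : 0 < δ) :
    ‖∫ s in Ioi 1, ((rexp (-δ * (c * s + k' * √(s ^ 2 - 1) - 1)) : ℝ) : ℂ) *
      Complex.exp (Complex.I * (R * s : ℝ))‖ ≤ 2 / |R| := by
  have hA1 : ∀ s ∈ Ioi (1 : ℝ), rexp (-δ * (c * s + k' * √(s ^ 2 - 1) - 1)) ≤ 1 := fun s hs => by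
    rw [exp_le_one_iff]
    nlinarith [one_le_hyperbolic hc hck hs hk']
  have hkc : |k| < c := abs_lt_of_sq_lt_sq (by nlinarith) hc.le
  have hAi : IntegrableOn (fun s => rexp (-δ * (c * s + k' * √(s ^ 2 - 1) - 1))) (Ioi 1) := by
    have hi := (integrableOn_exp_decay (δ := δ * (c - |k|)) (mul_pos hδ (sub_pos.2 hkc)) 1).const_mul
      (rexp (δ * (1 - (c - |k|))))
    refine hi.mono' (by fun_prop) ((ae_restrict_mem measurableSet_Ioi).mono fun s hs => ?_)
    have hs1 : 1 < s := hs
    rw [norm_of_nonneg (exp_pos _).le, ← exp_add, exp_le_exp]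
    have hrs : √(s ^ 2 - 1) ≤ s := sqrt_le_iff.2 ⟨by linarith, by linarith⟩
    have h1 : -(|k| * s) ≤ k' * √(s ^ 2 - 1) := by
      have := mul_le_mul hk' hrs (sqrt_nonneg _) (abs_nonneg _)
      nlinarith [neg_abs_le k', sqrt_nonneg (s ^ 2 - 1)]
    nlinarith
  have := norm_integral_mul_le_of_superlevel (f := fun s => Complex.exp (Complex.I * (R * s : ℝ)))
    (A := fun s => rexp (-δ * (c * s + k' * √(s ^ 2 - 1) - 1))) (T := Ioi 1) (K := 1) (M := 2 / |R|)
    measurableSet_Ioi zero_le_one (by fun_prop) (fun s => (norm_exp_I_mul _).le) (by fun_prop) hAi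
    (fun s _ => (exp_pos _).le) hA1 ?_ (fun a b hab _ => norm_setIntegral_Ioo_exp_le hR hab)
  · simpa using this
  intro l hl
  have e : {s ∈ Ioi (1 : ℝ) | l < rexp (-δ * (c * s + k' * √(s ^ 2 - 1) - 1))} =
      {s ∈ Ioi (1 : ℝ) | c * s + k' * √(s ^ 2 - 1) < 1 - log l / δ} := by
    ext s
    simp only [mem_ofPred_eq, ← log_lt_iff_lt_exp hl]
    refine and_congr_right fun _ => ?_
    rw [lt_sub_comm, div_lt_iff₀ hδ, ← neg_lt_neg_iff] 
    constructor <;> intro h <;> linarith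
  rw [e]
  rcases le_total k' 0 with h | h
  · have hconv : ConvexOn ℝ (Ioi (1 : ℝ)) fun s => c * s + k' * √(s ^ 2 - 1) := by
      have h1 : ConvexOn ℝ (Ioi (1 : ℝ)) fun s => c * s :=
        (LinearMap.mulLeft ℝ c).convexOn (convex_Ioi _)
      have h2 := concaveOn_sqrt_sq_sub_one.smul (neg_nonneg.2 h)
      refine (h1.sub h2).congr fun s _ => ?_
      simp [smul_eq_mul]
    exact (hconv.convex_lt _).ordConnected
  · refine ⟨fun x hx y hy z hz => ⟨lt_of_lt_of_le hx.1 hz.1, lt_of_le_of_lt ?_ hy.2⟩⟩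
    have hx1 : 1 < x := hx.1
    have hzy := hz.2
    have hz1 : 1 < z := lt_of_lt_of_le hx.1 hz.1
    have : √(z ^ 2 - 1) ≤ √(y ^ 2 - 1) := sqrt_le_sqrt (by nlinarith)
    gcongr

theorem norm_integral_hyperboloid_le {α β δ : ℝ} (hαβ : β ^ 2 < α ^ 2) (hδ : 0 < δ) :
    ‖∫ p in Ioi (1 : ℝ) ×ˢ Ioo (-π) π, ((rexp (-δ * (p.1 - 1)) : ℝ) : ℂ) *
      Complex.exp (Complex.I * (α * p.1 + β * (√(p.1 ^ 2 - 1) * cos p.2) : ℝ))‖ ≤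
      4 * π / √(α ^ 2 - β ^ 2) := by
  have hD : 0 < α ^ 2 - β ^ 2 := sub_pos.2 hαβ
  obtain ⟨R, hR2, hRa⟩ : ∃ R : ℝ, R ^ 2 = α ^ 2 - β ^ 2 ∧ 0 < α / R := by
    have hα : α ≠ 0 := fun h => by rw [h] at hαβ; nlinarith [sq_nonneg β]
    rcases hα.lt_or_gt with h | h
    · exact ⟨-√(α ^ 2 - β ^ 2), by rw [neg_sq, sq_sqrt hD.le],
        div_pos_of_neg_of_neg h (neg_neg_of_pos (sqrt_pos.2 hD))⟩
    · exact ⟨√(α ^ 2 - β ^ 2), sq_sqrt hD.le, div_pos h (sqrt_pos.2 hD)⟩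
  have hR : R ≠ 0 := fun h => by rw [h] at hRa; simp at hRa
  have hRabs : |R| = √(α ^ 2 - β ^ 2) := by rw [← hR2, sqrt_sq_eq_abs]
  set c := α / R with hc
  set k := -β / R with hk
  have hck : c ^ 2 - k ^ 2 = 1 := by
    rw [hc, hk]; field_simp; linarith
  have hcR : α * c + β * k = R := by
    rw [hc, hk]; field_simp; linarith
  have hcR' : α * k + β * c = 0 := by
    rw [hc, hk]; field_simp; ring
  set g : ℝ × ℝ → ℂ := fun p => ((rexp (-δ * (√(1 + p.2 ^ 2 + p.1 ^ 2) - 1)) : ℝ) : ℂ) *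
      Complex.exp (Complex.I * (α * √(1 + p.2 ^ 2 + p.1 ^ 2) + β * p.1 : ℝ)) with hg
  have hgc : Continuous g := by fun_prop
  have hEpt : ∀ p : ℝ × ℝ, 1 < p.1 → √(1 + (hyperboloidPt p).2 ^ 2 + (hyperboloidPt p).1 ^ 2) = p.1 := by
    intro p hp
    have h1 : √(p.1 ^ 2 - 1) ^ 2 = p.1 ^ 2 - 1 := sq_sqrt (by nlinarith)
    rw [sqrt_eq_iff_mul_self_eq (by positivity) (by linarith)]
    simp only [hyperboloidPt]
    linear_combination h1 + √(p.1 ^ 2 - 1) ^ 2 * sin_sq_add_cos_sq p.2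
  have hms : MeasurableSet (Ioi (1 : ℝ) ×ˢ Ioo (-π) π) := measurableSet_Ioi.prod measurableSet_Ioo
  have hμ : (volume.restrict (Ioi (1 : ℝ) ×ˢ Ioo (-π) π)) =
      (volume.restrict (Ioi (1 : ℝ))).prod (volume.restrict (Ioo (-π) π)) := by
    rw [Measure.prod_restrict]; rfl
  have e1 : ∫ p in Ioi (1 : ℝ) ×ˢ Ioo (-π) π, ((rexp (-δ * (p.1 - 1)) : ℝ) : ℂ) *
      Complex.exp (Complex.I * (α * p.1 + β * (√(p.1 ^ 2 - 1) * cos p.2) : ℝ)) =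
      ∫ p, g p ∂hyperboloidMeasure := by
    rw [← map_hyperboloidPt, integral_map continuous_hyperboloidPt.measurable.aemeasurable
      hgc.aestronglyMeasurable, ← hμ]
    refine setIntegral_congr_fun hms fun p hp => ?_
    simp only [hg, hEpt p hp.1]
    simp [hyperboloidPt]
  have hb : Measurable (boost c k) := (measurePreserving_boost hRa hck).measurable
  have e2 : ∫ p, g p ∂hyperboloidMeasure = ∫ p in Ioi (1 : ℝ) ×ˢ Ioo (-π) π,
      ((rexp (-δ * (c * p.1 + (k * cos p.2) * √(p.1 ^ 2 - 1) - 1)) : ℝ) : ℂ) *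
      Complex.exp (Complex.I * (R * p.1 : ℝ)) := by
    conv_lhs => rw [← (measurePreserving_boost hRa hck).map_eq]
    rw [integral_map hb.aemeasurable hgc.aestronglyMeasurable, ← map_hyperboloidPt,
      integral_map (f := fun p => g (boost c k p)) continuous_hyperboloidPt.measurable.aemeasurable
        (hgc.measurable.comp hb).aestronglyMeasurable, ← hμ]
    refine setIntegral_congr_fun hms fun p hp => ?_
    have hB : ∀ p : ℝ × ℝ, √(1 + (boost c k p).2 ^ 2 + (boost c k p).1 ^ 2) =
        c * √(1 + p.2 ^ 2 + p.1 ^ 2) + k * p.1 := fun p =>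
      sqrt_boost hRa hck (by positivity)
    simp only [hg, hB]
    have hb1 : ∀ p, (boost c k p).1 = c * p.1 + k * √(1 + p.2 ^ 2 + p.1 ^ 2) := fun p => rfl
    rw [hb1, hEpt p hp.1]
    have hp1 : (hyperboloidPt p).1 = √(p.1 ^ 2 - 1) * cos p.2 := rfl
    rw [hp1]
    congr 3
    · ring_nf
    · congr 1
      linear_combination p.1 * hcR + √(p.1 ^ 2 - 1) * cos p.2 * hcR'
  have hkc : |k| < c := abs_lt_of_sq_lt_sq (by nlinarith) hRa.le
  have hi : Integrable (fun p : ℝ × ℝ =>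
      ((rexp (-δ * (c * p.1 + (k * cos p.2) * √(p.1 ^ 2 - 1) - 1)) : ℝ) : ℂ) *
      Complex.exp (Complex.I * (R * p.1 : ℝ)))
      ((volume.restrict (Ioi (1 : ℝ))).prod (volume.restrict (Ioo (-π) π))) := by
    have h0 : Integrable (fun s => rexp (δ * (1 - (c - |k|))) * rexp (-(δ * (c - |k|)) * (s - 1)))
        (volume.restrict (Ioi (1 : ℝ))) :=
      (integrableOn_exp_decay (δ := δ * (c - |k|)) (mul_pos hδ (sub_pos.2 hkc)) 1).const_mul _
    refine (h0.comp_fst (volume.restrict (Ioo (-π) π))).mono' (by fun_prop) ?_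
    rw [← hμ]
    refine (ae_restrict_mem hms).mono fun p hp => ?_
    have hs1 : 1 < p.1 := hp.1
    rw [norm_mul, norm_exp_I_mul, mul_one, Complex.norm_real, norm_of_nonneg (exp_pos _).le,
      ← exp_add, exp_le_exp]
    have hrs : √(p.1 ^ 2 - 1) ≤ p.1 := sqrt_le_iff.2 ⟨by linarith, by linarith⟩
    have hk' : |k * cos p.2| ≤ |k| := by
      rw [abs_mul]; exact mul_le_of_le_one_right (abs_nonneg _) (abs_cos_le_one _)
    have h1 : -(|k| * p.1) ≤ k * cos p.2 * √(p.1 ^ 2 - 1) := by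
      have := mul_le_mul hk' hrs (sqrt_nonneg _) (abs_nonneg _)
      nlinarith [neg_abs_le (k * cos p.2), sqrt_nonneg (p.1 ^ 2 - 1)]
    nlinarith
  rw [e1, e2, hμ, integral_prod_symm _ hi, ← hRabs]
  refine (norm_setIntegral_le_of_norm_le_const (C := 2 / |R|) (by simp) fun φ _ => ?_).trans_eq ?_
  · have hk' : |k * cos φ| ≤ |k| := by
      rw [abs_mul]; exact mul_le_of_le_one_right (abs_nonneg _) (abs_cos_le_one _)
    exact norm_integral_exp_hyperbolic_le (k' := k * cos φ) hRa hck hk' hR hδ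
  · rw [measureReal_def, Real.volume_Ioo, ENNReal.toReal_ofReal (by linarith [pi_pos])]
    ring

end HyperboloidOscillation

section SoundWaveKernel

theorem setIntegral_hyperboloid_rotate {α b₀ b₁ δ : ℝ} (hδ : 0 < δ) :
    ∫ p in Ioi (1 : ℝ) ×ˢ Ioo (-π) π, ((rexp (-δ * (p.1 - 1)) : ℝ) : ℂ) *
      Complex.exp (Complex.I * (α * p.1 + √(p.1 ^ 2 - 1) * (b₀ * cos p.2 + b₁ * sin p.2) : ℝ)) =
    ∫ p in Ioi (1 : ℝ) ×ˢ Ioo (-π) π, ((rexp (-δ * (p.1 - 1)) : ℝ) : ℂ) *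
      Complex.exp (Complex.I * (α * p.1 + √(b₀ ^ 2 + b₁ ^ 2) * (√(p.1 ^ 2 - 1) * cos p.2) : ℝ)) := by
  have hμ : (volume.restrict (Ioi (1 : ℝ) ×ˢ Ioo (-π) π)) =
      (volume.restrict (Ioi (1 : ℝ))).prod (volume.restrict (Ioo (-π) π)) := by
    rw [Measure.prod_restrict]; rfl
  have hi : ∀ ψ : ℝ × ℝ → ℝ, Continuous ψ → Integrable (fun p => ((rexp (-δ * (p.1 - 1)) : ℝ) : ℂ) *
      Complex.exp (Complex.I * (ψ p : ℝ)))
      ((volume.restrict (Ioi (1 : ℝ))).prod (volume.restrict (Ioo (-π) π))) := fun ψ hψ => by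
    have h0 : Integrable (fun s => rexp (-δ * (s - 1))) (volume.restrict (Ioi (1 : ℝ))) :=
      integrableOn_exp_decay hδ 1
    refine (h0.comp_fst (volume.restrict (Ioo (-π) π))).mono' (by fun_prop) (ae_of_all _ fun p => ?_)
    rw [norm_mul, norm_exp_I_mul, mul_one, Complex.norm_real, norm_of_nonneg (exp_pos _).le]
  have hθ : ∃ θ, ∀ φ, b₀ * cos φ + b₁ * sin φ = √(b₀ ^ 2 + b₁ ^ 2) * cos (φ - θ) := by
    set z : ℂ := ⟨b₀, b₁⟩ with hz
    refine ⟨z.arg, fun φ => ?_⟩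
    have h0 : ‖z‖ * cos z.arg = b₀ := Complex.norm_mul_cos_arg z
    have h1 : ‖z‖ * sin z.arg = b₁ := Complex.norm_mul_sin_arg z
    have h2 : √(b₀ ^ 2 + b₁ ^ 2) = ‖z‖ := by
      rw [Complex.norm_eq_sqrt_sq_add_sq]
    rw [h2, cos_sub, ← h0, ← h1]; ring
  obtain ⟨θ, hθ⟩ := hθ
  rw [hμ, integral_prod _ (hi (fun p => α * p.1 + √(p.1 ^ 2 - 1) * (b₀ * cos p.2 + b₁ * sin p.2))
    (by fun_prop)), integral_prod _ (hi (fun p => α * p.1 + √(b₀ ^ 2 + b₁ ^ 2) *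
      (√(p.1 ^ 2 - 1) * cos p.2)) (by fun_prop))]
  refine integral_congr_ae (ae_of_all _ fun s => ?_)
  simp only [hθ]
  have hI : ∀ f : ℝ → ℂ, ∫ φ in Ioo (-π) π, f φ = ∫ φ in (-π)..π, f φ := fun f => by
    rw [intervalIntegral.integral_of_le (by linarith [pi_pos]), integral_Ioc_eq_integral_Ioo]
  set f : ℝ → ℂ := fun φ => ((rexp (-δ * (s - 1)) : ℝ) : ℂ) *
      Complex.exp (Complex.I * (α * s + √(b₀ ^ 2 + b₁ ^ 2) * (√(s ^ 2 - 1) * cos φ) : ℝ)) with hf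
  have hper : Function.Periodic f (2 * π) := fun φ => by simp only [hf, cos_add_two_pi]
  calc _ = ∫ φ in Ioo (-π) π, f (φ - θ) := by
        refine integral_congr_ae (ae_of_all _ fun φ => ?_)
        simp only [hf]
        congr 4; ring
    _ = ∫ φ in Ioo (-π) π, f φ := by
        rw [hI, hI, intervalIntegral.integral_comp_sub_right]
        have := hper.intervalIntegral_add_eq (-π - θ) (-π)
        rwa [show -π - θ + 2 * π = π - θ by ring, show -π + 2 * π = π by ring] at this

theorem map_spherePt_eq_spheroidal :
    Measure.map (fun v : ℝ × (ℝ × ℝ) => (v.2.1, spherePt v.1 v.2.2))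
      ((volume.restrict (Ioo (-1) 1)).prod (volume.restrict (Ioi (1 : ℝ) ×ˢ Ioo (-π) π))) =
      spheroidal := by
  have hm : Measurable (fun v : ℝ × (ℝ × ℝ) => (v.2.1, spherePt v.1 v.2.2)) := by
    have := continuous_spherePt.measurable
    fun_prop
  have hμ : (volume.restrict (Ioi (1 : ℝ) ×ˢ Ioo (-π) π)) =
      (volume.restrict (Ioi (1 : ℝ))).prod (volume.restrict (Ioo (-π) π)) := by
    rw [Measure.prod_restrict]; rfl
  refine Measure.ext_of_lintegral _ fun F hF => ?_
  have hFm : Measurable fun v : ℝ × (ℝ × ℝ) => F (v.2.1, spherePt v.1 v.2.2) := hF.comp hm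
  rw [lintegral_map hF hm, lintegral_prod _ hFm.aemeasurable, spheroidal,
    lintegral_prod _ hF.aemeasurable]
  calc _ = ∫⁻ w in Ioo (-1) 1, ∫⁻ s in Ioi 1, ∫⁻ φ in Ioo (-π) π, F (s, spherePt w φ) := by
        refine lintegral_congr fun w => ?_
        have hw : Measurable fun p : ℝ × ℝ => F (p.1, spherePt w p.2) :=
          hFm.comp measurable_prodMk_left
        rw [hμ]
        exact lintegral_prod _ hw.aemeasurable
    _ = ∫⁻ s in Ioi 1, ∫⁻ w in Ioo (-1) 1, ∫⁻ φ in Ioo (-π) π, F (s, spherePt w φ) := by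
        refine lintegral_lintegral_swap (Measurable.aemeasurable ?_)
        have : Measurable fun v : (ℝ × ℝ) × ℝ => F (v.1.2, spherePt v.1.1 v.2) :=
          hFm.comp (f := fun v : (ℝ × ℝ) × ℝ => (v.1.1, (v.1.2, v.2))) (by fun_prop)
        exact this.lintegral_prod_right'
    _ = _ := lintegral_congr fun s => (lintegral_sph (hF.comp measurable_prodMk_left)).symm

theorem integral_spheroidal {F : ℝ × E3 → ℂ} (hF : Integrable F spheroidal) :
    ∫ p, F p ∂spheroidal = ∫ w in Ioo (-1) 1, ∫ p in Ioi (1 : ℝ) ×ˢ Ioo (-π) π,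
      F (p.1, spherePt w p.2) := by
  have hm : Measurable (fun v : ℝ × (ℝ × ℝ) => (v.2.1, spherePt v.1 v.2.2)) := by
    have := continuous_spherePt.measurable
    fun_prop
  rw [← map_spherePt_eq_spheroidal] at hF ⊢
  rw [integral_map hm.aemeasurable hF.1]
  exact integral_prod _ ((integrable_map_measure hF.1 hm.aemeasurable).1 hF)

theorem integrableOn_exp_decay_rpow {δ : ℝ} (hδ : 0 < δ) :
    IntegrableOn (fun s => rexp (-δ * (s - 1)) / √(s - 1)) (Ioi 1) ∧
      ∫ s in Ioi 1, rexp (-δ * (s - 1)) / √(s - 1) ≤ 2 / √δ := by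
  have h := Real.integral_rpow_mul_exp_neg_mul_Ioi (a := 1 / 2) (r := δ) (by norm_num) hδ
  rw [Real.Gamma_one_half_eq] at h
  have e : ∫ s in Ioi (1 : ℝ), rexp (-δ * (s - 1)) / √(s - 1) = (1 / δ) ^ (1 / 2 : ℝ) * √π := by
    rw [← h, ← (measurePreserving_add_right volume (1 : ℝ)).setIntegral_preimage_emb
      (measurableEmbedding_addRight 1)]
    simp only [preimage_add_const_Ioi, sub_self, add_sub_cancel_right]
    refine setIntegral_congr_fun measurableSet_Ioi fun u hu => ?_
    have hu0 : 0 < u := hu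
    rw [show (1 / 2 - 1 : ℝ) = -(1 / 2) by norm_num, rpow_neg hu0.le, ← sqrt_eq_rpow, neg_mul,
      div_eq_inv_mul]
  have hpos : 0 < (1 / δ) ^ (1 / 2 : ℝ) * √π := by positivity
  refine ⟨Integrable.of_integral_ne_zero (by rw [e]; exact hpos.ne'), ?_⟩
  rw [e, ← sqrt_eq_rpow, sqrt_div zero_le_one, sqrt_one, one_div_mul_eq_div]
  gcongr
  rw [sqrt_le_left (by norm_num)]
  linarith [pi_le_four]

/-- The amplitude localized to the equatorial zone `|Ω| ≤ a` and decaying at rate `δ`. -/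
def zoneAmplitude (δ a s w : ℝ) : ℝ :=
  rexp (-δ * (s - 1)) * (Icc (-a) a).indicator (fun _ => (1 : ℝ)) w

theorem measurable_zoneAmplitude (δ a : ℝ) :
    Measurable fun p : ℝ × ℝ => zoneAmplitude δ a p.1 p.2 := by
  have hind : Measurable fun w : ℝ => (Icc (-a) a).indicator (fun _ => (1 : ℝ)) w :=
    measurable_const.indicator measurableSet_Icc
  unfold zoneAmplitude
  fun_prop

theorem zoneAmplitude_nonneg (δ a s w : ℝ) : 0 ≤ zoneAmplitude δ a s w :=
  mul_nonneg (exp_pos _).le (indicator_nonneg (fun _ _ => zero_le_one) _)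

theorem zoneAmplitude_le (δ a s w : ℝ) : zoneAmplitude δ a s w ≤ rexp (-δ * (s - 1)) :=
  mul_le_of_le_one_right (exp_pos _).le (indicator_le_self' (fun _ _ => zero_le_one) _)

theorem integrable_zoneAmplitude {δ : ℝ} (hδ : 0 < δ) (a : ℝ) :
    Integrable (fun p : ℝ × E3 => zoneAmplitude δ a p.1 (p.2 2)) spheroidal := by
  refine (integrable_exp_decay_spheroidal hδ).mono' ?_ (ae_of_all _ fun p => ?_)
  · exact ((measurable_zoneAmplitude δ a).comp
      (f := fun p : ℝ × E3 => (p.1, p.2 2)) (by fun_prop)).aestronglyMeasurable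
  · rw [norm_of_nonneg (zoneAmplitude_nonneg _ _ _ _)]
    exact zoneAmplitude_le _ _ _ _

theorem norm_kernel_Sig_zone_le_of_far {δ a : ℝ} (hδ : 0 < δ) (ha : 0 ≤ a) (t : ℝ) {x : E3}
    (hx : x ≠ 0) :
    ‖spheroidalKernel (zoneAmplitude δ a) (fun s _ => s) t x‖ ≤ 16 * π / (√δ * ‖x‖) := by
  have hx0 : 0 < ‖x‖ := norm_pos_iff.2 hx
  rw [spheroidalKernel, spheroidal, integral_prod _ (integrable_spheroidalKernel
    (L := fun s _ => s) measurable_fst (integrable_zoneAmplitude hδ a) t x)]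
  obtain ⟨hi, hle⟩ := integrableOn_exp_decay_rpow hδ
  have hb : ∀ s ∈ Ioi (1 : ℝ), ‖∫ y, (zoneAmplitude δ a s (y 2) : ℂ) * Complex.exp (Complex.I *
      (t * s + dot3 x (spheroid 1 s y) : ℝ)) ∂sph‖ ≤
      8 * π / ‖x‖ * (rexp (-δ * (s - 1)) / √(s - 1)) := by
    intro s hs
    have hs1 : 1 < s := hs
    set V : E3 := !₂[x 0 * √(s ^ 2 - 1 ^ 2), x 1 * √(s ^ 2 - 1 ^ 2), x 2 * s] with hVdef
    have hV : ∀ y, dot3 x (spheroid 1 s y) = dot3 V y := by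
      intro y; simp [hVdef, dot3, spheroid]; ring
    have hVn : ‖x‖ * √(s - 1) ≤ ‖V‖ := by
      refine abs_le_of_sq_le_sq' ?_ (norm_nonneg _) |>.2
      rw [mul_pow, sq_sqrt (by linarith), norm_sq_E3, norm_sq_E3]
      simp only [hVdef, Matrix.cons_val, mul_pow, sq_sqrt (show 0 ≤ s ^ 2 - 1 ^ 2 by nlinarith)]
      have h1 : s - 1 ≤ s ^ 2 - 1 ^ 2 := by nlinarith
      have h2 : s - 1 ≤ s ^ 2 := by nlinarith
      nlinarith [mul_le_mul_of_nonneg_left h1 (sq_nonneg (x 0)),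
        mul_le_mul_of_nonneg_left h1 (sq_nonneg (x 1)), mul_le_mul_of_nonneg_left h2 (sq_nonneg (x 2))]
    have hs0 : 0 < √(s - 1) := sqrt_pos.2 (by linarith)
    have hV0 : V ≠ 0 := norm_pos_iff.1 (lt_of_lt_of_le (by positivity) hVn)
    have e : ∀ y : E3, (zoneAmplitude δ a s (y 2) : ℂ) * Complex.exp (Complex.I *
      (t * s + dot3 x (spheroid 1 s y) : ℝ)) =
      ((rexp (-δ * (s - 1)) : ℝ) * Complex.exp (Complex.I * (t * s : ℝ))) *
      ((((Icc (-a) a).indicator (fun _ => (1 : ℝ)) (y 2) : ℝ) : ℂ) *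
        Complex.exp (Complex.I * (dot3 V y : ℝ))) := fun y => by
      rw [hV, zoneAmplitude]
      push_cast
      rw [mul_add, Complex.exp_add]; ring
    simp only [e]
    rw [integral_const_mul, norm_mul, norm_mul, norm_exp_I_mul, mul_one, Complex.norm_real,
      norm_of_nonneg (exp_pos _).le]
    calc _ ≤ rexp (-δ * (s - 1)) * (8 * π / ‖V‖) := by
          gcongr; exact norm_integral_zone_exp_dot3_le hV0 ha
      _ ≤ rexp (-δ * (s - 1)) * (8 * π / (‖x‖ * √(s - 1))) := by
          have : 0 < ‖x‖ * √(s - 1) := by positivity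
          gcongr
      _ = _ := by field_simp
  refine (norm_integral_le_of_norm_le (hi.const_mul (8 * π / ‖x‖))
    ((ae_restrict_mem measurableSet_Ioi).mono hb)).trans ?_
  rw [integral_const_mul]
  calc _ ≤ 8 * π / ‖x‖ * (2 / √δ) := by gcongr
    _ = _ := by field_simp; norm_num

theorem norm_kernel_Sig_zone_le_of_near {δ a : ℝ} (hδ : 0 < δ) (ha : 0 ≤ a) {t : ℝ} {x : E3}
    (hx : 10 * ‖x‖ < |t|) :
    ‖spheroidalKernel (zoneAmplitude δ a) (fun s _ => s) t x‖ ≤ 10 * π * a / |t| := by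
  have ht0 : 0 < |t| := lt_of_le_of_lt (by positivity) hx
  rw [spheroidalKernel, integral_spheroidal (integrable_spheroidalKernel
    (L := fun s _ => s) measurable_fst (integrable_zoneAmplitude hδ a) t x)]
  have hb : ∀ w ∈ Ioo (-1 : ℝ) 1, ‖∫ p in Ioi (1 : ℝ) ×ˢ Ioo (-π) π,
      (zoneAmplitude δ a p.1 (spherePt w p.2 2) : ℂ) * Complex.exp (Complex.I *
        (t * p.1 + dot3 x (spheroid 1 p.1 (spherePt w p.2)) : ℝ))‖ ≤
      (Icc (-a) a).indicator (fun _ => 5 * π / |t|) w := by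
    intro w hw
    have hw2 : 0 ≤ 1 - w ^ 2 := by nlinarith [hw.1, hw.2]
    have hw3 : √(1 - w ^ 2) ^ 2 = 1 - w ^ 2 := sq_sqrt hw2
    have e : ∀ p : ℝ × ℝ, (zoneAmplitude δ a p.1 (spherePt w p.2 2) : ℂ) * Complex.exp (Complex.I *
        (t * p.1 + dot3 x (spheroid 1 p.1 (spherePt w p.2)) : ℝ)) =
        (((Icc (-a) a).indicator (fun _ => (1 : ℝ)) w : ℝ) : ℂ) *
        (((rexp (-δ * (p.1 - 1)) : ℝ) : ℂ) * Complex.exp (Complex.I * ((t + x 2 * w) * p.1 +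
          √(p.1 ^ 2 - 1) * ((x 0 * √(1 - w ^ 2)) * cos p.2 + (x 1 * √(1 - w ^ 2)) * sin p.2) : ℝ))) := by
      intro p
      have h1 : t * p.1 + dot3 x (spheroid 1 p.1 (spherePt w p.2)) = (t + x 2 * w) * p.1 +
          √(p.1 ^ 2 - 1) * ((x 0 * √(1 - w ^ 2)) * cos p.2 + (x 1 * √(1 - w ^ 2)) * sin p.2) := by
        simp [dot3, spheroid, spherePt]; ring
      rw [h1, zoneAmplitude, show spherePt w p.2 2 = w from rfl]
      push_cast
      ring
    simp only [e]
    rw [integral_const_mul, norm_mul, Complex.norm_real, setIntegral_hyperboloid_rotate hδ]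
    by_cases hwa : w ∈ Icc (-a) a
    swap
    · simp [hwa]
    rw [indicator_of_mem hwa, indicator_of_mem hwa, norm_one, one_mul]
    have hsq := norm_sq_E3 x
    have hx2 : |x 2| ≤ ‖x‖ := abs_le_of_sq_le_sq (by nlinarith [sq_nonneg (x 0), sq_nonneg (x 1)])
      (norm_nonneg _)
    have hxw : |x 2 * w| ≤ |t| / 10 := by
      rw [abs_mul]
      have : |w| ≤ 1 := abs_le.2 ⟨hw.1.le, hw.2.le⟩
      nlinarith [abs_nonneg (x 2), abs_nonneg w]
    have hα : 9 / 10 * |t| ≤ |t + x 2 * w| := by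
      have := abs_sub_abs_le_abs_sub t (-(x 2 * w))
      rw [abs_neg, sub_neg_eq_add] at this
      linarith
    have hα2 : (9 / 10 * |t|) ^ 2 ≤ (t + x 2 * w) ^ 2 := by
      rw [← sq_abs (t + x 2 * w)]; gcongr
    have hβ2 : √((x 0 * √(1 - w ^ 2)) ^ 2 + (x 1 * √(1 - w ^ 2)) ^ 2) ^ 2 ≤ (|t| / 10) ^ 2 := by
      rw [sq_sqrt (by positivity), mul_pow, mul_pow, hw3]
      have h1 : ‖x‖ ^ 2 ≤ (|t| / 10) ^ 2 := by gcongr; linarith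
      nlinarith [sq_nonneg (x 0), sq_nonneg (x 1), sq_nonneg (x 2), sq_nonneg w]
    have hD : (4 / 5 * |t|) ^ 2 ≤ (t + x 2 * w) ^ 2 -
        √((x 0 * √(1 - w ^ 2)) ^ 2 + (x 1 * √(1 - w ^ 2)) ^ 2) ^ 2 := by nlinarith
    refine (norm_integral_hyperboloid_le (by nlinarith [sq_pos_of_pos ht0]) hδ).trans ?_
    calc _ ≤ 4 * π / (4 / 5 * |t|) := by
          gcongr
          exact le_sqrt_of_sq_le hD
      _ = _ := by field_simp
  have hgi : IntegrableOn ((Icc (-a) a).indicator (fun _ => 5 * π / |t|)) (Ioo (-1) 1) :=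
    (integrableOn_const (by simp)).indicator measurableSet_Icc
  refine (norm_integral_le_of_norm_le hgi ((ae_restrict_mem measurableSet_Ioo).mono hb)).trans ?_
  rw [setIntegral_indicator measurableSet_Icc, setIntegral_const, smul_eq_mul]
  have hvol : volume.real (Ioo (-1) 1 ∩ Icc (-a) a) ≤ 2 * a := by
    refine (measureReal_mono inter_subset_right (by simp)).trans_eq ?_
    rw [measureReal_def, Real.volume_Icc, ENNReal.toReal_ofReal (by linarith)]; ring
  calc _ ≤ 2 * a * (5 * π / |t|) := by gcongr
    _ = _ := by ring

/-- Dispersion of the sound waves, with amplitude localized to an equatorial zone. -/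
theorem norm_kernel_Sig_zone_le {δ a : ℝ} (hδ : 0 < δ) (ha : 0 ≤ a) {t : ℝ} (ht : t ≠ 0) (x : E3) :
    ‖spheroidalKernel (zoneAmplitude δ a) (fun s _ => s) t x‖ ≤ 160 * π * (a + 1 / √δ) / |t| := by
  have ht0 : 0 < |t| := abs_pos.2 ht
  have hd : 0 < √δ := sqrt_pos.2 hδ
  rcases lt_or_ge (10 * ‖x‖) |t| with h | h
  · refine (norm_kernel_Sig_zone_le_of_near hδ ha h).trans ?_
    gcongr
    · norm_num
    · linarith [one_div_pos.2 hd]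
  · have hx : 0 < ‖x‖ := by linarith
    refine (norm_kernel_Sig_zone_le_of_far hδ ha t (norm_pos_iff.1 hx)).trans ?_
    calc 16 * π / (√δ * ‖x‖) ≤ 16 * π / (√δ * (|t| / 10)) := by gcongr; linarith
      _ = 160 * π * (1 / √δ) / |t| := by field_simp; norm_num
      _ ≤ _ := by gcongr; linarith

end SoundWaveKernel

section Amplitudes

/-- The amplitude `N` yields a kernel with phase `L` decaying like `D/|t|`. -/
structure IsDispersive (N L : ℝ → ℝ → ℝ) (D : ℝ) : Prop where
  measurable : Measurable fun p : ℝ × ℝ => N p.1 p.2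
  integrable : Integrable (fun p : ℝ × E3 => N p.1 (p.2 2)) spheroidal
  norm_kernel_le : ∀ t : ℝ, t ≠ 0 → ∀ x, ‖spheroidalKernel N L t x‖ ≤ D / |t|

variable {N N' L : ℝ → ℝ → ℝ} {D D' : ℝ}

theorem IsDispersive.mono (h : IsDispersive N L D) (hD : D ≤ D') : IsDispersive N L D' :=
  ⟨h.measurable, h.integrable, fun t ht x => (h.norm_kernel_le t ht x).trans (by gcongr)⟩

theorem IsDispersive.add (hL : Measurable fun p : ℝ × ℝ => L p.1 p.2) (h : IsDispersive N L D)
    (h' : IsDispersive N' L D') : IsDispersive (fun s w => N s w + N' s w) L (D + D') :=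
  ⟨h.measurable.add h'.measurable, h.integrable.add h'.integrable, fun t ht x => by
    rw [spheroidalKernel_add hL h.integrable h'.integrable, add_div]
    exact (norm_add_le _ _).trans (add_le_add (h.norm_kernel_le t ht x) (h'.norm_kernel_le t ht x))⟩

theorem IsDispersive.const_mul (h : IsDispersive N L D) (a : ℝ) :
    IsDispersive (fun s w => a * N s w) L (|a| * D) :=
  ⟨h.measurable.const_mul a, h.integrable.const_mul a, fun t ht x => by
    rw [spheroidalKernel_const_mul, norm_mul, Complex.norm_real, norm_eq_abs, mul_div_assoc]
    gcongr
    exact h.norm_kernel_le t ht x⟩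

theorem IsDispersive.mul_cos (hL : Measurable fun p : ℝ × ℝ => L p.1 p.2) (h : IsDispersive N L D) :
    IsDispersive (fun s w => N s w * cos (π * s * w / 2)) L D := by
  have hm : Measurable fun p : ℝ × ℝ => N p.1 p.2 * cos (π * p.1 * p.2 / 2) :=
    h.measurable.mul (by fun_prop)
  refine ⟨hm, h.integrable.norm.mono' ?_ (ae_of_all _ fun p => ?_), fun t ht x => ?_⟩
  · exact (hm.comp (f := fun p : ℝ × E3 => (p.1, p.2 2)) (by fun_prop)).aestronglyMeasurable
  · rw [norm_mul]
    exact mul_le_of_le_one_right (norm_nonneg _) (abs_cos_le_one _)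
  · rw [spheroidalKernel_cos hL h.integrable, norm_div]
    have h1 := h.norm_kernel_le t ht (x + !₂[0, 0, π / 2])
    have h2 := h.norm_kernel_le t ht (x + !₂[0, 0, -(π / 2)])
    have h3 := norm_add_le (spheroidalKernel N L t (x + !₂[0, 0, π / 2]))
      (spheroidalKernel N L t (x + !₂[0, 0, -(π / 2)]))
    rw [show ‖(2 : ℂ)‖ = 2 by simp, div_le_iff₀ two_pos]
    linarith

theorem isDispersive_exp_Om {δ : ℝ} (hδ : 0 < δ) (hδ2 : δ ≤ 2) :
    IsDispersive (fun s _ => rexp (-δ * (s - 1))) (fun _ w => w) (800 * π / δ) :=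
  ⟨by fun_prop, integrable_exp_decay_spheroidal hδ, fun t ht x => by
    rw [div_div]; exact norm_kernel_Om_exp_le hδ hδ2 ht x⟩

theorem isDispersive_zone_Sig {δ a : ℝ} (hδ : 0 < δ) (ha : 0 ≤ a) :
    IsDispersive (zoneAmplitude δ a) (fun s _ => s) (160 * π * (a + 1 / √δ)) :=
  ⟨measurable_zoneAmplitude δ a, integrable_zoneAmplitude hδ a, fun _ ht x =>
    norm_kernel_Sig_zone_le hδ ha ht x⟩

theorem isDispersive_exp_Sig {δ : ℝ} (hδ : 0 < δ) :
    IsDispersive (fun s _ => rexp (-δ * (s - 1))) (fun s _ => s) (160 * π * (1 + 1 / √δ)) := by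
  refine ⟨by fun_prop, integrable_exp_decay_spheroidal hδ, fun t ht x => ?_⟩
  have h := norm_kernel_Sig_zone_le hδ zero_le_one ht x
  have e : spheroidalKernel (fun s _ => rexp (-δ * (s - 1))) (fun s _ => s) t x =
      spheroidalKernel (zoneAmplitude δ 1) (fun s _ => s) t x := by
    refine integral_congr_ae (ae_spheroidal.mono fun p hp => ?_)
    simp only [zoneAmplitude, indicator_of_mem (Ioo_subset_Icc_self hp.2.2), mul_one]
  rwa [e]

/-- `N` is a bump adapted to the shell `lam ≤ |ξ| ≤ 4 lam` in spheroidal coordinates. -/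
structure IsShellBump (N : ℝ → ℝ → ℝ) (lam c₀ : ℝ) : Prop where
  nonneg : ∀ s w : ℝ, 1 ≤ s → |w| ≤ 1 → 0 ≤ N s w
  le : ∀ s w : ℝ, 1 ≤ s → |w| ≤ 1 → N s w ≤ s ^ 2 - w ^ 2
  ge : ∀ s w ρ : ℝ, 1 ≤ s → |w| ≤ 1 → lam ≤ ρ → ρ ≤ 4 * lam → |w| ≤ ρ →
    s ^ 2 + w ^ 2 = 1 + ρ ^ 2 → c₀ * (s ^ 2 - w ^ 2) ≤ N s w

theorem IsShellBump.mono {lam c₀ c₁ : ℝ} (h : IsShellBump N lam c₀) (hc : c₁ ≤ c₀) :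
    IsShellBump N lam c₁ := by
  refine ⟨h.nonneg, h.le, fun s w ρ hs hw h1 h2 h3 h4 => le_trans ?_ (h.ge s w ρ hs hw h1 h2 h3 h4)⟩
  have : 0 ≤ s ^ 2 - w ^ 2 := (h.nonneg s w hs hw).trans (h.le s w hs hw)
  gcongr

theorem div_one_add_le_one_sub_exp {u : ℝ} (hu : 0 ≤ u) : u / (1 + u) ≤ 1 - rexp (-u) := by
  rw [exp_neg, div_le_iff₀ (by linarith)]
  have h1 := add_one_le_exp u
  have h2 : (rexp u)⁻¹ * (1 + u) ≤ 1 := by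
    rw [inv_mul_le_one₀ (exp_pos _)]; linarith
  nlinarith

/-- The bump used for high frequencies. -/
def highBump (lam s : ℝ) : ℝ :=
  lam ^ 2 * (rexp (-(1 / lam) * (s - 1)) + (-2) * rexp (-(2 / lam) * (s - 1)) +
    rexp (-(3 / lam) * (s - 1)))

theorem highBump_eq {lam : ℝ} (s : ℝ) : highBump lam s =
    lam ^ 2 * (rexp (-((s - 1) / lam)) * (1 - rexp (-((s - 1) / lam))) ^ 2) := by
  have h2 : rexp (-(2 / lam) * (s - 1)) = rexp (-((s - 1) / lam)) ^ 2 := by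
    rw [← exp_nat_mul]; congr 1; push_cast; ring
  have h3 : rexp (-(3 / lam) * (s - 1)) = rexp (-((s - 1) / lam)) ^ 3 := by
    rw [← exp_nat_mul]; congr 1; push_cast; ring
  rw [highBump, h2, h3, show -(1 / lam) * (s - 1) = -((s - 1) / lam) by ring]
  ring

theorem isShellBump_highBump {lam : ℝ} (hlam : 2 ≤ lam) :
    IsShellBump (fun s _ => highBump lam s) lam (rexp (-5) / 200) := by
  have hl : 0 < lam := by linarith
  refine ⟨fun s w hs hw => ?_, fun s w hs hw => ?_, fun s w ρ hs hw h1 h2 h3 h4 => ?_⟩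
  · rw [highBump_eq]; positivity
  · rw [highBump_eq]
    have hw2 : w ^ 2 ≤ 1 := (sq_le_one_iff_abs_le_one w).2 hw
    have hv : 0 ≤ (s - 1) / lam := div_nonneg (by linarith) hl.le
    have hv1 : rexp (-((s - 1) / lam)) ≤ 1 := exp_le_one_iff.2 (by linarith)
    have hv2 : 1 - rexp (-((s - 1) / lam)) ≤ (s - 1) / lam := by
      linarith [add_one_le_exp (-((s - 1) / lam))]
    calc _ ≤ lam ^ 2 * (1 * ((s - 1) / lam) ^ 2) := by gcongr
      _ = (s - 1) ^ 2 := by field_simp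
      _ ≤ _ := by nlinarith
  · simp only [highBump_eq]
    have hw2 : w ^ 2 ≤ 1 := (sq_le_one_iff_abs_le_one w).2 hw
    have hs1 : lam ≤ s := abs_le_of_sq_le_sq' (by nlinarith) (by linarith) |>.2
    have hs2 : s ^ 2 ≤ 17 * lam ^ 2 := by nlinarith
    have hs5 : s ≤ 5 * lam := abs_le_of_sq_le_sq' (by nlinarith) (by linarith) |>.2
    have hv5 : (s - 1) / lam ≤ 5 := by rw [div_le_iff₀ hl]; linarith
    have hv12 : 1 / 2 ≤ (s - 1) / lam := by rw [le_div_iff₀ hl]; linarith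
    have hv : 1 / 3 ≤ 1 - rexp (-((s - 1) / lam)) := by
      refine le_trans ?_ (div_one_add_le_one_sub_exp (by linarith))
      rw [le_div_iff₀ (by linarith)]; linarith
    calc rexp (-5) / 200 * (s ^ 2 - w ^ 2) ≤ rexp (-5) / 200 * (17 * lam ^ 2) := by
          gcongr; nlinarith [sq_nonneg w]
      _ ≤ lam ^ 2 * (rexp (-5) * (1 / 3) ^ 2) := by
          have : 0 ≤ lam ^ 2 * rexp (-5) := by positivity
          linarith
      _ ≤ _ := by gcongr

theorem isDispersive_highBump (hL : Measurable fun p : ℝ × ℝ => L p.1 p.2) {lam : ℝ}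
    (h1 : IsDispersive (fun s _ => rexp (-(1 / lam) * (s - 1))) L D)
    (h2 : IsDispersive (fun s _ => rexp (-(2 / lam) * (s - 1))) L D)
    (h3 : IsDispersive (fun s _ => rexp (-(3 / lam) * (s - 1))) L D) :
    IsDispersive (fun s _ => highBump lam s) L (4 * lam ^ 2 * D) := by
  refine (((h1.add hL (h2.const_mul (-2))).add hL h3).const_mul (lam ^ 2)).mono (le_of_eq ?_)
  rw [abs_of_nonneg (sq_nonneg _), abs_neg, abs_two]
  ring

/-- The bump used for frequencies of moderate size. -/
def midBump (s w : ℝ) : ℝ :=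
  (1 / 12) * (10 * rexp (-1 * (s - 1)) + (-10) * rexp (-2 * (s - 1)) +
    rexp (-1 * (s - 1)) * cos (π * s * w / 2))

theorem midBump_eq (s w : ℝ) : midBump s w =
    (1 / 12) * (rexp (-(s - 1)) * (10 * (1 - rexp (-(s - 1))) + cos (π * s * w / 2))) := by
  have h2 : rexp (-2 * (s - 1)) = rexp (-(s - 1)) ^ 2 := by
    rw [← exp_nat_mul]; congr 1; push_cast; ring
  rw [midBump, h2, neg_one_mul]
  ring

theorem abs_cos_sub_le {s w : ℝ} (hs : 1 ≤ s) (hw : |w| ≤ 1) :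
    |cos (π * s * w / 2) - cos (π * |w| / 2)| ≤ 1.6 * (s - 1) := by
  have e : cos (π * |w| / 2) = cos (π * w / 2) := by
    rcases abs_choice w with h | h <;> rw [h]
    rw [← cos_neg]; congr 1; ring
  rw [e]
  refine (abs_cos_sub_cos_le _ _).trans ?_
  rw [show π * s * w / 2 - π * w / 2 = π / 2 * (s - 1) * w by ring, abs_mul,
    abs_of_nonneg (mul_nonneg (by positivity) (by linarith))]
  have h1 : 0 ≤ π / 2 * (s - 1) := mul_nonneg (by positivity) (by linarith)
  have h2 : π / 2 * (s - 1) ≤ 1.6 * (s - 1) := by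
    gcongr
    linarith [pi_lt_d2]
  nlinarith

theorem le_midBump {s w : ℝ} (hs : 1 ≤ s) (hw : |w| ≤ 1) :
    rexp (-(s - 1)) * ((s ^ 2 - w ^ 2) / (2 * s ^ 2)) ≤ 12 * midBump s w := by
  have h1 := abs_cos_sub_le hs hw
  rw [abs_le] at h1
  have h2 : 1 - |w| ≤ cos (π * |w| / 2) := by
    have := one_sub_mul_le_cos (x := π * |w| / 2) (by positivity)
      (by nlinarith [pi_pos, abs_nonneg w])
    rwa [show 2 / π * (π * |w| / 2) = |w| by field_simp] at this
  have h3 := div_one_add_le_one_sub_exp (u := s - 1) (by linarith)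
  rw [midBump_eq, ← mul_assoc, show (12 : ℝ) * (1 / 12) = 1 by norm_num, one_mul]
  gcongr
  have hw2 : |w| ^ 2 = w ^ 2 := sq_abs w
  rw [← hw2]
  have hw0 := abs_nonneg w
  set v := |w|
  have hs2 : (s ^ 2 - v ^ 2) / (2 * s ^ 2) ≤ 1 / 2 := by
    rw [div_le_div_iff₀ (by positivity) two_pos]; nlinarith
  rcases le_total s 2 with h | h
  · have h5 : 5 * (s - 1) ≤ 10 * ((s - 1) / (1 + (s - 1))) := by
      rw [mul_div_assoc', le_div_iff₀ (by linarith)]; nlinarith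
    have h6 : (s ^ 2 - v ^ 2) / (2 * s ^ 2) ≤ 3 * (s - 1) + (1 - v) := by
      rw [div_le_iff₀ (by positivity)]
      have : s ^ 2 - v ^ 2 ≤ 2 * (3 * (s - 1) + (1 - v)) := by nlinarith
      have h0 : 0 ≤ 3 * (s - 1) + (1 - v) := by linarith
      nlinarith [mul_le_mul_of_nonneg_left (show 1 ≤ s ^ 2 by nlinarith) h0]
    linarith
  · have h5 : 5 ≤ 10 * ((s - 1) / (1 + (s - 1))) := by
      rw [mul_div_assoc', le_div_iff₀ (by linarith)]; linarith
    linarith [neg_one_le_cos (π * s * w / 2)]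

theorem isShellBump_midBump {lam : ℝ} (hlam : lam ≤ 2) :
    IsShellBump midBump lam (rexp (-8) / 3000) := by
  refine ⟨fun s w hs hw => ?_, fun s w hs hw => ?_, fun s w ρ hs hw h1 h2 h3 h4 => ?_⟩
  · have h := le_midBump hs hw
    have hw2 : w ^ 2 ≤ 1 := (sq_le_one_iff_abs_le_one w).2 hw
    have : 0 ≤ rexp (-(s - 1)) * ((s ^ 2 - w ^ 2) / (2 * s ^ 2)) := by
      have : 0 ≤ s ^ 2 - w ^ 2 := by nlinarith
      positivity
    linarith
  · have h1 := abs_cos_sub_le hs hw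
    rw [abs_le] at h1
    have h2 : cos (π * |w| / 2) ≤ 1.6 * (1 - |w|) := by
      rw [← sin_pi_div_two_sub]
      refine (sin_le ?_).trans ?_
      · nlinarith [pi_pos]
      · nlinarith [pi_lt_d2]
    have h3 : 1 - rexp (-(s - 1)) ≤ s - 1 := by linarith [add_one_le_exp (-(s - 1))]
    have h4 : rexp (-(s - 1)) ≤ 1 := exp_le_one_iff.2 (by linarith)
    have hw2 : |w| ^ 2 = w ^ 2 := sq_abs w
    have hw0 := abs_nonneg w
    rw [midBump_eq, ← hw2]
    have h5 : 10 * (1 - rexp (-(s - 1))) + cos (π * s * w / 2) ≤ 12 * (s ^ 2 - |w| ^ 2) := by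
      nlinarith
    have h6 : 0 ≤ s ^ 2 - |w| ^ 2 := by nlinarith
    nlinarith [mul_le_mul_of_nonneg_left h5 (exp_pos (-(s - 1))).le]
  · have hw2 : w ^ 2 ≤ 1 := (sq_le_one_iff_abs_le_one w).2 hw
    have hρ0 : 0 ≤ ρ := (abs_nonneg w).trans h3
    have hs9 : s ≤ 9 := by nlinarith
    have h := le_midBump hs hw
    have h0 : 0 ≤ s ^ 2 - w ^ 2 := by nlinarith
    have : rexp (-8) * ((s ^ 2 - w ^ 2) / 162) ≤ rexp (-(s - 1)) * ((s ^ 2 - w ^ 2) / (2 * s ^ 2)) := by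
      gcongr
      · linarith
      · nlinarith
    have h5 : 0 ≤ rexp (-8) * (s ^ 2 - w ^ 2) := by positivity
    linarith

theorem isDispersive_midBump (hL : Measurable fun p : ℝ × ℝ => L p.1 p.2)
    (h1 : IsDispersive (fun s _ => rexp (-1 * (s - 1))) L D)
    (h2 : IsDispersive (fun s _ => rexp (-2 * (s - 1))) L D) :
    IsDispersive midBump L (7 / 4 * D) := by
  refine ((((h1.const_mul 10).add hL (h2.const_mul (-10))).add hL
    (h1.mul_cos hL)).const_mul (1 / 12)).mono (le_of_eq ?_)
  rw [abs_neg, abs_of_pos (by norm_num : (0 : ℝ) < 10), abs_of_pos (by norm_num : (0 : ℝ) < 1 / 12)]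
  ring

theorem isShellBump_zoneAmplitude {lam : ℝ} (hlam : 0 < lam) (hlam' : lam ≤ 1 / 16) :
    IsShellBump (fun s w => (1 / 2) * zoneAmplitude (1 / lam ^ 2) (4 * lam) s w) lam (rexp (-8) / 4) := by
  refine ⟨fun s w hs hw => ?_, fun s w hs hw => ?_, fun s w ρ hs hw h1 h2 h3 h4 => ?_⟩
  · exact mul_nonneg (by norm_num) (zoneAmplitude_nonneg _ _ _ _)
  · have hw2 : w ^ 2 ≤ 1 := (sq_le_one_iff_abs_le_one w).2 hw
    by_cases h : w ∈ Icc (-(4 * lam)) (4 * lam)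
    · have h1 := zoneAmplitude_le (1 / lam ^ 2) (4 * lam) s w
      have h2 : rexp (-(1 / lam ^ 2) * (s - 1)) ≤ 1 := by
        rw [exp_le_one_iff, neg_mul, neg_nonpos]
        exact mul_nonneg (by positivity) (by linarith)
      have h3 : w ^ 2 ≤ 1 / 4 := by nlinarith [h.1, h.2]
      nlinarith
    · simp only [zoneAmplitude, indicator_of_notMem h, mul_zero]
      nlinarith
  · have hρ0 : 0 ≤ ρ := (abs_nonneg w).trans h3
    have hmem : w ∈ Icc (-(4 * lam)) (4 * lam) := abs_le.1 (h3.trans h2)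
    simp only [zoneAmplitude, indicator_of_mem hmem, mul_one]
    have hs2 : s ^ 2 ≤ 1 + 16 * lam ^ 2 := by nlinarith [sq_nonneg w]
    have h5 : rexp (-8) ≤ rexp (-(1 / lam ^ 2) * (s - 1)) := by
      rw [exp_le_exp, neg_mul, neg_le_neg_iff, one_div_mul_eq_div, div_le_iff₀ (by positivity)]
      nlinarith
    have h6 : s ^ 2 - w ^ 2 ≤ 2 := by nlinarith [sq_nonneg w]
    calc _ ≤ rexp (-8) / 4 * 2 := by gcongr
      _ = 1 / 2 * rexp (-8) := by ring
      _ ≤ _ := by gcongr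

theorem exists_shellBump_Om : ∃ C c₀ : ℝ, 0 < C ∧ 0 < c₀ ∧ ∀ lam : ℝ, 0 < lam → ∃ N,
    IsShellBump N lam c₀ ∧
      IsDispersive N (fun _ w => w) (C * (1 + lam ^ 2) ^ ((3 / 2 : ℝ))) := by
  have hc : rexp (-8) / 3000 ≤ rexp (-5) / 200 := by
    gcongr <;> norm_num
  have hp := pi_pos
  refine ⟨3200 * π, rexp (-8) / 3000, by positivity, by positivity, fun lam hlam => ?_⟩
  rcases le_total lam 2 with h | h
  · refine ⟨midBump, isShellBump_midBump h, (isDispersive_midBump measurable_snd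
      ((isDispersive_exp_Om one_pos one_le_two).mono (D' := 800 * π) (by simp))
      ((isDispersive_exp_Om two_pos le_rfl).mono (by linarith))).mono ?_⟩
    have : (1 : ℝ) ≤ (1 + lam ^ 2) ^ ((3 / 2 : ℝ)) :=
      one_le_rpow (by nlinarith) (by norm_num)
    nlinarith
  · have hδ : ∀ j : ℝ, 1 ≤ j → j ≤ 3 → IsDispersive (fun s _ => rexp (-(j / lam) * (s - 1)))
        (fun _ w => w) (800 * π * lam) := fun j hj hj3 => by
      refine (isDispersive_exp_Om (div_pos (by linarith) hlam) ?_).mono ?_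
      · rw [div_le_iff₀ hlam]; linarith
      · rw [div_div_eq_mul_div]
        exact div_le_self (by positivity) hj
    refine ⟨fun s _ => highBump lam s, (isShellBump_highBump h).mono hc,
      (isDispersive_highBump measurable_snd (hδ 1 le_rfl (by norm_num))
        (hδ 2 (by norm_num) (by norm_num)) (hδ 3 (by norm_num) le_rfl)).mono ?_⟩
    have h1 : lam ^ 3 ≤ (1 + lam ^ 2) ^ ((3 / 2 : ℝ)) := by
      have : lam ^ 3 = (lam ^ 2) ^ (3 / 2 : ℝ) := by
        rw [← rpow_natCast lam 2, ← rpow_mul hlam.le, ← rpow_natCast]; norm_num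
      rw [this]
      gcongr; linarith
    calc 4 * lam ^ 2 * (800 * π * lam) = 3200 * π * lam ^ 3 := by ring
      _ ≤ _ := by gcongr

theorem exists_shellBump_Sig : ∃ C c₀ : ℝ, 0 < C ∧ 0 < c₀ ∧ ∀ lam : ℝ, 0 < lam → ∃ N,
    IsShellBump N lam c₀ ∧ IsDispersive N (fun s _ => s)
      (C * ((1 + lam ^ 2) ^ ((7 / 6 : ℝ)) * lam ^ ((1 / 3 : ℝ)))) := by
  have hp := pi_pos
  refine ⟨10000 * π, rexp (-8) / 3000, by positivity, by positivity, fun lam hlam => ?_⟩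
  have h1 : (1 : ℝ) ≤ (1 + lam ^ 2) ^ ((7 / 6 : ℝ)) := one_le_rpow (by nlinarith) (by norm_num)
  have h13 : ∀ r : ℝ, 0 < r → r ≤ 1 → r ≤ r ^ (1 / 3 : ℝ) := fun r hr hr1 => by
    conv_lhs => rw [← rpow_one r]
    exact rpow_le_rpow_of_exponent_ge hr hr1 (by norm_num)
  have hl13 : 0 < lam ^ (1 / 3 : ℝ) := by positivity
  have h2 : lam ^ (1 / 3 : ℝ) ≤ (1 + lam ^ 2) ^ ((7 / 6 : ℝ)) * lam ^ ((1 / 3 : ℝ)) :=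
    le_mul_of_one_le_left hl13.le h1
  rcases le_total lam (1 / 16) with h | h
  · refine ⟨_, (isShellBump_zoneAmplitude hlam h).mono (by gcongr; norm_num),
      ((isDispersive_zone_Sig (by positivity) (by positivity)).const_mul (1 / 2)).mono ?_⟩
    rw [sqrt_div zero_le_one, sqrt_one, sqrt_sq hlam.le, one_div_one_div,
      abs_of_pos (by norm_num : (0 : ℝ) < 1 / 2)]
    have h3 := (h13 lam hlam (by linarith)).trans h2
    nlinarith
  rcases le_total lam 2 with h' | h'
  · have hδ : ∀ δ : ℝ, 1 ≤ δ → IsDispersive (fun s _ => rexp (-δ * (s - 1)))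
        (fun s _ => s) (320 * π) := fun δ hδ => by
      refine (isDispersive_exp_Sig (by linarith)).mono ?_
      have : 1 / √δ ≤ 1 := by
        rw [div_le_one (sqrt_pos.2 (by linarith))]; exact one_le_sqrt.2 hδ
      nlinarith
    refine ⟨midBump, isShellBump_midBump h', (isDispersive_midBump measurable_fst
      (hδ 1 le_rfl) (hδ 2 one_le_two)).mono ?_⟩
    have h3 : 1 / 16 ≤ lam ^ (1 / 3 : ℝ) :=
      (h13 (1 / 16) (by norm_num) (by norm_num)).trans (by gcongr)
    nlinarith
  · have hl1 : 1 ≤ √lam := one_le_sqrt.2 (by linarith)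
    have hδ : ∀ j : ℝ, 1 ≤ j → IsDispersive (fun s _ => rexp (-(j / lam) * (s - 1)))
        (fun s _ => s) (320 * π * √lam) := fun j hj => by
      refine (isDispersive_exp_Sig (div_pos (by linarith) hlam)).mono ?_
      have : 1 / √(j / lam) ≤ √lam := by
        rw [sqrt_div (by linarith), one_div_div]
        exact div_le_self (sqrt_nonneg _) (one_le_sqrt.2 hj)
      nlinarith
    refine ⟨fun s _ => highBump lam s, (isShellBump_highBump h').mono (by gcongr <;> norm_num),
      (isDispersive_highBump measurable_fst (hδ 1 le_rfl) (hδ 2 (by norm_num))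
        (hδ 3 (by norm_num))).mono ?_⟩
    have h3 : lam ^ 2 * √lam ≤ (1 + lam ^ 2) ^ ((7 / 6 : ℝ)) * lam ^ ((1 / 3 : ℝ)) := by
      have e1 : lam ^ 2 * √lam = lam ^ (5 / 2 : ℝ) := by
        rw [sqrt_eq_rpow, ← rpow_natCast lam 2, ← rpow_add hlam]; norm_num
      have e2 : (lam ^ 2) ^ (7 / 6 : ℝ) * lam ^ (1 / 3 : ℝ) = lam ^ (8 / 3 : ℝ) := by
        rw [← rpow_natCast lam 2, ← rpow_mul hlam.le, ← rpow_add hlam]; norm_num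
      calc _ = lam ^ (5 / 2 : ℝ) := e1
        _ ≤ lam ^ (8 / 3 : ℝ) := rpow_le_rpow_of_exponent_le (by linarith) (by norm_num)
        _ = _ := e2.symm
        _ ≤ _ := by gcongr; linarith
    calc 4 * lam ^ 2 * (320 * π * √lam) = 1280 * π * (lam ^ 2 * √lam) := by ring
      _ ≤ 10000 * π * (lam ^ 2 * √lam) := by gcongr; norm_num
      _ ≤ _ := by gcongr

end Amplitudes

theorem d1_scale {κ : ℝ} (hκ : 0 < κ) (ξ : E3) : d1 κ ξ = κ⁻¹ * d1 1 (κ • ξ) := by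
  rw [d1, d1, ← sqrt_sq (inv_nonneg.2 hκ.le), ← sqrt_mul (sq_nonneg _), sqrt_sq (by positivity)]
  congr 1
  simp only [PiLp.smul_apply, smul_eq_mul]
  field_simp

theorem d2_scale {κ : ℝ} (hκ : 0 < κ) (ξ : E3) : d2 κ ξ = κ⁻¹ * d2 1 (κ • ξ) := by
  rw [d2, d2, ← sqrt_sq (inv_nonneg.2 hκ.le), ← sqrt_mul (sq_nonneg _), sqrt_sq (by positivity)]
  congr 1
  simp only [PiLp.smul_apply, smul_eq_mul]
  field_simp

theorem Sig_scale {κ : ℝ} (hκ : 0 < κ) (ξ : E3) : Sig κ ξ = κ⁻¹ * Sig 1 (κ • ξ) := by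
  rw [Sig, Sig, d1_scale hκ, d2_scale hκ]; ring

theorem Om_scale {κ : ℝ} (hκ : 0 < κ) (ξ : E3) : Om κ ξ = κ⁻¹ * Om 1 (κ • ξ) := by
  rw [Om, Om, d1_scale hκ, d2_scale hκ]; ring

theorem d1_one_sq (η : E3) : d1 1 η ^ 2 = ‖η‖ ^ 2 - 2 * η 2 + 1 := by
  rw [d1, sq_sqrt (by positivity), norm_sq_E3]; ring

theorem d2_one_sq (η : E3) : d2 1 η ^ 2 = ‖η‖ ^ 2 + 2 * η 2 + 1 := by
  rw [d2, sq_sqrt (by positivity), norm_sq_E3]; ring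

theorem Sig_sq_add_Om_sq (η : E3) : Sig 1 η ^ 2 + Om 1 η ^ 2 = 1 + ‖η‖ ^ 2 := by
  rw [Sig, Om]; linear_combination (1 / 2) * d1_one_sq η + (1 / 2) * d2_one_sq η

theorem Sig_mul_Om (η : E3) : Sig 1 η * Om 1 η = η 2 := by
  rw [Sig, Om]; linear_combination (1 / 4) * d2_one_sq η - (1 / 4) * d1_one_sq η

theorem Sig_sq_sub_Om_sq (η : E3) : Sig 1 η ^ 2 - Om 1 η ^ 2 = d1 1 η * d2 1 η := by
  rw [Sig, Om]; ring

theorem sq_apply_two_le (η : E3) : η 2 ^ 2 ≤ ‖η‖ ^ 2 := by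
  rw [norm_sq_E3]; nlinarith [sq_nonneg (η 0), sq_nonneg (η 1)]

theorem sq_sub_one_mul_one_sub_sq (η : E3) :
    (Sig 1 η ^ 2 - 1) * (1 - Om 1 η ^ 2) = ‖η‖ ^ 2 - η 2 ^ 2 := by
  rw [← Sig_mul_Om]; linear_combination Sig_sq_add_Om_sq η

theorem one_le_Sig (η : E3) : 1 ≤ Sig 1 η ∧ |Om 1 η| ≤ 1 := by
  have hd1 : 0 ≤ d1 1 η := sqrt_nonneg _
  have hd2 : 0 ≤ d2 1 η := sqrt_nonneg _
  have hs : 0 ≤ Sig 1 η := by rw [Sig]; positivity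
  have hge : Om 1 η ^ 2 ≤ Sig 1 η ^ 2 := by
    have := Sig_sq_sub_Om_sq η
    nlinarith [mul_nonneg hd1 hd2]
  have hp : 0 ≤ (Sig 1 η ^ 2 - 1) * (1 - Om 1 η ^ 2) := by
    rw [sq_sub_one_mul_one_sub_sq]; linarith [sq_apply_two_le η]
  have hsum : 1 ≤ Sig 1 η ^ 2 + Om 1 η ^ 2 := by
    rw [Sig_sq_add_Om_sq]; linarith [sq_nonneg ‖η‖]
  have h : 1 ≤ Sig 1 η ^ 2 ∧ Om 1 η ^ 2 ≤ 1 := by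
    constructor <;> by_contra! h
    · nlinarith
    · nlinarith
  exact ⟨by nlinarith [h.1], (sq_le_one_iff_abs_le_one _).1 h.2⟩

theorem abs_Om_le_norm (η : E3) : |Om 1 η| ≤ ‖η‖ := by
  refine abs_le_of_sq_le_sq (le_trans ?_ (sq_apply_two_le η)) (norm_nonneg _)
  rw [← Sig_mul_Om, mul_pow]
  exact le_mul_of_one_le_left (sq_nonneg _) (one_le_pow₀ (one_le_Sig η).1)

theorem ae_Sig_sq_sub_Om_sq_ne_zero {κ : ℝ} (hκ : κ ≠ 0) :
    ∀ᵐ ξ : E3, Sig 1 (κ • ξ) ^ 2 - Om 1 (κ • ξ) ^ 2 ≠ 0 := by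
  have hfin : ({κ⁻¹ • !₂[0, 0, 1], κ⁻¹ • !₂[0, 0, -1]} : Set E3).Finite := by simp
  filter_upwards [compl_mem_ae_iff.2 (hfin.measure_zero volume)] with ξ hξ h0
  apply hξ
  have key : κ • ξ = !₂[0, 0, 1] ∨ κ • ξ = !₂[0, 0, -1] := by
    rw [Sig_sq_sub_Om_sq, mul_eq_zero] at h0
    generalize κ • ξ = η at h0
    refine h0.imp (fun h => ?_) (fun h => ?_)
    · rw [d1, sqrt_eq_zero (by positivity)] at h
      have a0 : η 0 = 0 := by nlinarith [sq_nonneg (η 0), sq_nonneg (η 1), sq_nonneg (η 2 - 1⁻¹)]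
      have a1 : η 1 = 0 := by nlinarith [sq_nonneg (η 0), sq_nonneg (η 1), sq_nonneg (η 2 - 1⁻¹)]
      have a2 : η 2 - 1⁻¹ = 0 := by
        nlinarith [sq_nonneg (η 0), sq_nonneg (η 1), sq_nonneg (η 2 - 1⁻¹)]
      ext i; fin_cases i
      · simpa using a0
      · simpa using a1
      · simp at a2 ⊢; linarith
    · rw [d2, sqrt_eq_zero (by positivity)] at h
      have a0 : η 0 = 0 := by nlinarith [sq_nonneg (η 0), sq_nonneg (η 1), sq_nonneg (η 2 + 1⁻¹)]
      have a1 : η 1 = 0 := by nlinarith [sq_nonneg (η 0), sq_nonneg (η 1), sq_nonneg (η 2 + 1⁻¹)]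
      have a2 : η 2 + 1⁻¹ = 0 := by
        nlinarith [sq_nonneg (η 0), sq_nonneg (η 1), sq_nonneg (η 2 + 1⁻¹)]
      ext i; fin_cases i
      · simpa using a0
      · simpa using a1
      · simp at a2 ⊢; linarith
  rcases key with h | h
  · left; rw [← h, inv_smul_smul₀ hκ]
  · right; rw [mem_singleton_iff, ← h, inv_smul_smul₀ hκ]

theorem IsShellBump.symbol_mem {N : ℝ → ℝ → ℝ} {lam c₀ : ℝ} (h : IsShellBump N lam c₀) (η : E3) :
    0 ≤ spheroidalSymbol N η ∧ spheroidalSymbol N η ≤ 1 := by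
  obtain ⟨hs, hw⟩ := one_le_Sig η
  have h0 := h.nonneg _ _ hs hw
  have h1 := h.le _ _ hs hw
  exact ⟨div_nonneg h0 (h0.trans h1), div_le_one_of_le₀ h1 (h0.trans h1)⟩

theorem IsShellBump.le_symbol {N : ℝ → ℝ → ℝ} {lam c₀ : ℝ} (h : IsShellBump N lam c₀) {η : E3}
    (h1 : lam ≤ ‖η‖) (h2 : ‖η‖ ≤ 4 * lam) (h0 : Sig 1 η ^ 2 - Om 1 η ^ 2 ≠ 0) :
    c₀ ≤ spheroidalSymbol N η := by
  obtain ⟨hs, hw⟩ := one_le_Sig η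
  have hp : 0 < Sig 1 η ^ 2 - Om 1 η ^ 2 :=
    lt_of_le_of_ne ((h.nonneg _ _ hs hw).trans (h.le _ _ hs hw)) h0.symm
  rw [spheroidalSymbol, le_div_iff₀ hp]
  exact h.ge _ _ _ hs hw h1 h2 (abs_Om_le_norm η) (Sig_sq_add_Om_sq η)

theorem norm_fourierDot_scaled_le {N L : ℝ → ℝ → ℝ} {A : ℝ}
    (hL : Measurable fun p : ℝ × ℝ => L p.1 p.2)
    (hLs : ∀ b s w : ℝ, L (b * s) (b * w) = b * L s w) (hN : IsDispersive N L A) {c ε : ℝ}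
    (hc : 0 < c) (hε : 0 < ε) {t : ℝ} (ht : t ≠ 0) (x : E3) :
    ‖fourierDot (fun ξ => spheroidalSymbol N ((c * ε) • ξ) * Complex.exp (Complex.I *
      (t * (c * L (Sig (c * ε) ξ) (Om (c * ε) ξ)) : ℝ))) x‖ ≤ A * (ε ^ 2)⁻¹ * (c ^ 3)⁻¹ / |t| := by
  have hκ : 0 < c * ε := mul_pos hc hε
  set κ := c * ε with hκd
  set F : E3 → ℂ := fun η => Complex.exp (Complex.I * (dot3 (κ⁻¹ • x) η : ℝ)) *
    (spheroidalSymbol N η * Complex.exp (Complex.I *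
      (t * c * κ⁻¹ * L (Sig 1 η) (Om 1 η) : ℝ))) with hFd
  have hF : ∀ ξ : E3, Complex.exp (Complex.I * (dot3 x ξ : ℝ)) *
      (spheroidalSymbol N (κ • ξ) * Complex.exp (Complex.I *
        (t * (c * L (Sig κ ξ) (Om κ ξ)) : ℝ))) = F (κ • ξ) := by
    intro ξ
    rw [hFd]
    have e1 : dot3 (κ⁻¹ • x) (κ • ξ) = dot3 x ξ := by
      simp only [dot3, PiLp.smul_apply, smul_eq_mul]; field_simp
    simp only [e1]
    rw [Sig_scale hκ, Om_scale hκ, hLs]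
    congr 5; ring
  have hτ : t * c * κ⁻¹ ≠ 0 := by positivity
  have hb := hN.norm_kernel_le _ hτ (κ⁻¹ • x)
  rw [← fourierDot_spheroidalSymbol hN.measurable hL, fourierDot] at hb
  rw [fourierDot, integral_congr_ae (Filter.Eventually.of_forall hF),
    Measure.integral_comp_smul volume F, norm_smul]
  refine (mul_le_mul_of_nonneg_left hb (norm_nonneg _)).trans_eq ?_
  have hκ3 : 0 < (κ ^ 3)⁻¹ := by positivity
  rw [finrank_euclideanSpace_fin, norm_eq_abs, abs_abs, abs_of_pos hκ3, abs_mul, abs_mul,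
    abs_of_pos hc, abs_of_pos (inv_pos.2 hκ), hκd]
  have := abs_pos.2 ht
  field_simp

theorem strichartz_of_shellBump {q : ℝ} (hq : 2 < q) : ∃ C : ℝ, 0 < C ∧
    ∀ (N L : ℝ → ℝ → ℝ) (A c₀ c ε : ℝ) (k : ℤ) (g : SchwartzMap E3 ℂ),
      (Measurable fun p : ℝ × ℝ => L p.1 p.2) →
      (∀ b s w : ℝ, L (b * s) (b * w) = b * L s w) → 0 < A → 0 < c₀ → 0 < c → 0 < ε →
      IsShellBump N ((2 : ℝ) ^ k * c * ε) c₀ → IsDispersive N L A →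
      (∀ ξ : E3, g ξ ≠ 0 → (2 : ℝ) ^ k ≤ ‖ξ‖ ∧ ‖ξ‖ ≤ (2 : ℝ) ^ (k + 2)) →
      (∫ t : ℝ, ((eLpNorm (fun x : E3 => ∫ ξ : E3, Complex.exp (Complex.I *
          ((t * c * L (Sig (c * ε) ξ) (Om (c * ε) ξ) + dot3 x ξ : ℝ) : ℂ)) * g ξ)
          (ENNReal.ofReal (2 * q / (q - 2))) volume).toReal) ^ q) ^ (1 / q) ≤
        C * (A * (ε ^ 2)⁻¹ * (c ^ 3)⁻¹) ^ (1 / q) * c₀ ^ (-(1 / 2) : ℝ) *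
          √(∫ ξ, ‖g ξ‖ ^ 2) := by
  obtain ⟨C, hC, hS⟩ := strichartz_of_dispersive hq
  refine ⟨C, hC, fun N L A c₀ c ε k g hL hLs hA hc₀ hc hε hb hN hg => ?_⟩
  have hκ : 0 < c * ε := mul_pos hc hε
  have hLm : Measurable fun ξ : E3 => L (Sig (c * ε) ξ) (Om (c * ε) ξ) :=
    hL.comp ((continuous_Sig _).measurable.prodMk (continuous_Om _).measurable)
  have key := hS (fun ξ => c * L (Sig (c * ε) ξ) (Om (c * ε) ξ))
    (fun ξ => spheroidalSymbol N ((c * ε) • ξ)) (A * (ε ^ 2)⁻¹ * (c ^ 3)⁻¹) c₀ g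
    (hLm.const_mul c)
    ((integrable_spheroidalSymbol hN.measurable hN.integrable).comp_smul hκ.ne')
    (fun ξ => hb.symbol_mem _) (by positivity) hc₀
    (fun t ht x => norm_fourierDot_scaled_le hL hLs hN hc hε ht x)
    g.integrable g.continuous.measurable (g.memLp 2) (by
      filter_upwards [ae_Sig_sq_sub_Om_sq_ne_zero hκ.ne'] with ξ h0 hgξ
      obtain ⟨h1, h2⟩ := hg ξ hgξ
      rw [zpow_add₀ two_ne_zero] at h2
      have hn : ‖(c * ε) • ξ‖ = c * ε * ‖ξ‖ := by rw [norm_smul, norm_of_nonneg hκ.le]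
      refine hb.le_symbol ?_ ?_ h0
      · rw [hn]; nlinarith
      · rw [hn]; norm_num at h2; nlinarith)
  convert key using 7 with t
  ext x
  rw [fourierDot]
  congr 1 with ξ
  rw [← mul_assoc, ← Complex.exp_add]
  congr 2
  push_cast
  ring

end Strichartz

/-- Frequency-localized Strichartz estimates for the two half-waves
`e^{itcΛ_{cε}}`, `Λ ∈ {Ω, Σ}`, for an admissible pair `(q, r)` with `2/q + 2/r = 1`. -/
theorem frequency_localized_Strichartz (q : ℝ) (hq : 2 < q) :
    ∃ C > 0, ∀ (c ε : ℝ) (k : ℤ) (g : SchwartzMap E3 ℂ), 0 < c → 0 < ε →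
      (∀ ξ : E3, g ξ ≠ 0 → (2 : ℝ) ^ k ≤ ‖ξ‖ ∧ ‖ξ‖ ≤ (2 : ℝ) ^ (k + 2)) →
      ((∫ t : ℝ,
          ((eLpNorm (fun x : E3 =>
              ∫ ξ : E3, Complex.exp (Complex.I * ((t * c * Om (c * ε) ξ + dot3 x ξ : ℝ) : ℂ))
                * g ξ) (ENNReal.ofReal (2 * q / (q - 2))) volume).toReal) ^ q) ^ (1 / q)
        ≤ C * ((1 + ((2 : ℝ) ^ k * c * ε) ^ 2) ^ ((3 / 2) : ℝ) * (ε ^ 2)⁻¹ * (c ^ 3)⁻¹) ^ (1 / q)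
          * Real.sqrt (∫ ξ : E3, ‖g ξ‖ ^ 2)) ∧
      ((∫ t : ℝ,
          ((eLpNorm (fun x : E3 =>
              ∫ ξ : E3, Complex.exp (Complex.I * ((t * c * Sig (c * ε) ξ + dot3 x ξ : ℝ) : ℂ))
                * g ξ) (ENNReal.ofReal (2 * q / (q - 2))) volume).toReal) ^ q) ^ (1 / q)
        ≤ C * ((1 + ((2 : ℝ) ^ k * c * ε) ^ 2) ^ ((7 / 6) : ℝ) * (2 : ℝ) ^ ((k : ℝ) / 3)
              * ε ^ (-(5 / 3) : ℝ) * c ^ (-(8 / 3) : ℝ)) ^ (1 / q)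
          * Real.sqrt (∫ ξ : E3, ‖g ξ‖ ^ 2)) := by
  obtain ⟨C, hC, hS⟩ := strichartz_of_shellBump hq
  obtain ⟨C₁, c₁, hC₁, hc₁, h₁⟩ := exists_shellBump_Om
  obtain ⟨C₂, c₂, hC₂, hc₂, h₂⟩ := exists_shellBump_Sig
  refine ⟨max (C * C₁ ^ (1 / q) * c₁ ^ (-(1 / 2) : ℝ)) (C * C₂ ^ (1 / q) * c₂ ^ (-(1 / 2) : ℝ)),
    lt_max_of_lt_left (by positivity), fun c ε k g hc hε hg => ⟨?_, ?_⟩⟩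
  · obtain ⟨N, hb, hN⟩ := h₁ ((2 : ℝ) ^ k * c * ε) (by positivity)
    refine (hS N (fun _ w => w) _ c₁ c ε k g measurable_snd (fun _ _ _ => rfl) (by positivity)
      hc₁ hc hε hb hN hg).trans ?_
    refine mul_le_mul_of_nonneg_right ?_ (Real.sqrt_nonneg _)
    rw [mul_assoc C₁, mul_assoc C₁, Real.mul_rpow hC₁.le (by positivity)]
    calc _ = C * C₁ ^ (1 / q) * c₁ ^ (-(1 / 2) : ℝ) *
        ((1 + ((2 : ℝ) ^ k * c * ε) ^ 2) ^ ((3 / 2) : ℝ) * (ε ^ 2)⁻¹ * (c ^ 3)⁻¹) ^ (1 / q) := by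
          ring
      _ ≤ _ := by gcongr; exact le_max_left _ _
  · obtain ⟨N, hb, hN⟩ := h₂ ((2 : ℝ) ^ k * c * ε) (by positivity)
    refine (hS N (fun s _ => s) _ c₂ c ε k g measurable_fst (fun _ _ _ => rfl) (by positivity)
      hc₂ hc hε hb hN hg).trans ?_
    have e : ((2 : ℝ) ^ k * c * ε) ^ (1 / 3 : ℝ) * (ε ^ 2)⁻¹ * (c ^ 3)⁻¹ =
        (2 : ℝ) ^ ((k : ℝ) / 3) * ε ^ (-(5 / 3) : ℝ) * c ^ (-(8 / 3) : ℝ) := by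
      rw [Real.mul_rpow (by positivity) hε.le, Real.mul_rpow (by positivity) hc.le, ← Real.rpow_intCast,
        ← Real.rpow_mul two_pos.le, show -(5 / 3 : ℝ) = 1 / 3 + -(2 : ℕ) by norm_num,
        show -(8 / 3 : ℝ) = 1 / 3 + -(3 : ℕ) by norm_num, Real.rpow_add hε, Real.rpow_add hc,
        Real.rpow_neg hε.le, Real.rpow_neg hc.le, Real.rpow_natCast, Real.rpow_natCast, mul_one_div]
      ring
    set X : ℝ := (1 + ((2 : ℝ) ^ k * c * ε) ^ 2) ^ ((7 / 6) : ℝ)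
    have hX : 0 < X := by positivity
    have e' : C₂ * (X * ((2 : ℝ) ^ k * c * ε) ^ (1 / 3 : ℝ)) * (ε ^ 2)⁻¹ * (c ^ 3)⁻¹ =
        C₂ * (X * (2 : ℝ) ^ ((k : ℝ) / 3) * ε ^ (-(5 / 3) : ℝ) * c ^ (-(8 / 3) : ℝ)) := by
      linear_combination C₂ * X * e
    rw [e', Real.mul_rpow hC₂.le (by positivity)]
    refine mul_le_mul_of_nonneg_right ?_ (Real.sqrt_nonneg _)
    calc _ = C * C₂ ^ (1 / q) * c₂ ^ (-(1 / 2) : ℝ) * (X * (2 : ℝ) ^ ((k : ℝ) / 3)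
              * ε ^ (-(5 / 3) : ℝ) * c ^ (-(8 / 3) : ℝ)) ^ (1 / q) := by
          ring
      _ ≤ _ := by gcongr; exact le_max_right _ _
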